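/- arXiv:1905.05728 — 4 statements merged into one kernel-verified Lean document; each statement's English description precedes it below -/
import Mathlib

section
/- For every h ∈ (1,2) there exist a velocity field u : [0,∞)×ℝ² → ℝ² and a family of finite Borel measures ω(t) on ℝ² (t ≥ 0) such that: u is bounded and uniformly continuous on [0,∞)×ℝ², u has compact support, u is weakly divergence free, u is locally Lipschitz on ([0,∞)×ℝ²) \ {(0,(0,0))} (i.e. away from the single space-time point (t,x) = (0,(0,0))); ω(0) is the Dirac measure at the origin, so supp ω(0) = {(0,0)}; ω is weakly advected by u on [0,T] for every T > 0; and the Hausdorff dimension of supp ω(t) equals h for every t > 0. -/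
open MeasureTheory Set

noncomputable section

/-- Dot product on `ℝ × ℝ`. -/
def dot2 (u v : ℝ × ℝ) : ℝ := u.1 * v.1 + u.2 * v.2

/-- Spatial gradient of a scalar function on `ℝ × ℝ`. -/
def grad2 (ψ : ℝ × ℝ → ℝ) (x : ℝ × ℝ) : ℝ × ℝ :=
  (fderiv ℝ ψ x (1, 0), fderiv ℝ ψ x (0, 1))

/-- A velocity field is weakly divergence free at time `t`. -/
def WeakDivFreeAt (u : ℝ → ℝ × ℝ → ℝ × ℝ) (t : ℝ) : Prop :=
  ∀ ψ : ℝ × ℝ → ℝ, ContDiff ℝ (⊤ : ℕ∞) ψ → HasCompactSupport ψ →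
    ∫ x, dot2 (u t x) (grad2 ψ x) = 0

/-- A family of measures `μ t` is weakly advected by the velocity `u` on `[0, T]`. -/
def WeaklyAdvected (T : ℝ) (u : ℝ → ℝ × ℝ → ℝ × ℝ)
    (μ : ℝ → Measure (ℝ × ℝ)) : Prop :=
  ∀ φ : ℝ → ℝ × ℝ → ℝ,
    ContDiff ℝ (⊤ : ℕ∞) (Function.uncurry φ) → HasCompactSupport (Function.uncurry φ) →
    (∫ t in Icc (0 : ℝ) T, ∫ x, deriv (fun s => φ s x) t ∂(μ t))
      - (∫ x, φ T x ∂(μ T)) + (∫ x, φ 0 x ∂(μ 0))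
      + (∫ t in Icc (0 : ℝ) T, ∫ x, dot2 (u t x) (grad2 (φ t) x) ∂(μ t)) = 0

/-- The support of a Borel measure: points all of whose neighbourhoods have
positive measure. -/
def mSupp (μ : Measure (ℝ × ℝ)) : Set (ℝ × ℝ) := {x | ∀ U ∈ nhds x, 0 < μ U}

/-- Centres of the four quadrants of the square `[-1, 1]²`. -/
def corner : Fin 4 → ℝ × ℝ :=
  ![(1 / 2, 1 / 2), (1 / 2, -(1 / 2)), (-(1 / 2), 1 / 2), (-(1 / 2), -(1 / 2))]

lemma norm_corner (j : Fin 4) : ‖corner j‖ = 1 / 2 := by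
  fin_cases j <;> norm_num [corner, Prod.norm_def]

lemma one_le_norm_corner_sub {i j : Fin 4} (hij : i ≠ j) : 1 ≤ ‖corner i - corner j‖ := by
  fin_cases i <;> fin_cases j <;> first | exact absurd rfl hij | norm_num [corner, Prod.norm_def]

/-- The point of the four-corner Cantor set with contraction ratio `r` coded by `σ`. -/
def cantorPoint (r : ℝ) (σ : ℕ → Fin 4) : ℝ × ℝ := ∑' n, r ^ n • corner (σ n)

section CantorSet

variable {r : ℝ}

lemma norm_pow_smul_corner (hr : 0 < r) (σ : ℕ → Fin 4) (n : ℕ) :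
    ‖r ^ n • corner (σ n)‖ = r ^ n * (1 / 2) := by
  rw [norm_smul, norm_corner, norm_pow, Real.norm_of_nonneg hr.le]

lemma summable_pow_smul_corner (hr : 0 < r) (hr2 : r < 1 / 2) (σ : ℕ → Fin 4) :
    Summable fun n ↦ r ^ n • corner (σ n) := by
  refine Summable.of_norm ?_
  simp_rw [norm_pow_smul_corner hr]
  exact (summable_geometric_of_lt_one hr.le (by linarith)).mul_right _

lemma cantorPoint_eq (hr : 0 < r) (hr2 : r < 1 / 2) (σ : ℕ → Fin 4) :
    cantorPoint r σ = corner (σ 0) + r • cantorPoint r (fun n ↦ σ (n + 1)) := by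
  rw [cantorPoint, (summable_pow_smul_corner hr hr2 σ).tsum_eq_zero_add, cantorPoint,
    ← (summable_pow_smul_corner hr hr2 _).tsum_const_smul]
  simp [pow_succ', smul_smul]

lemma norm_cantorPoint_le (hr : 0 < r) (hr2 : r < 1 / 2) (σ : ℕ → Fin 4) :
    ‖cantorPoint r σ‖ ≤ 1 / (2 * (1 - r)) := by
  have hg := (hasSum_geometric_of_lt_one hr.le (by linarith)).mul_right (1 / 2)
  refine (tsum_of_norm_bounded hg fun n ↦ (norm_pow_smul_corner hr σ n).le).trans_eq ?_
  field_simp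

lemma norm_cantorPoint_lt_one (hr : 0 < r) (hr2 : r < 1 / 2) (σ : ℕ → Fin 4) :
    ‖cantorPoint r σ‖ < 1 := by
  refine (norm_cantorPoint_le hr hr2 σ).trans_lt ?_
  rw [div_lt_one (by linarith)]
  linarith

lemma continuous_cantorPoint (hr : 0 < r) (hr2 : r < 1 / 2) : Continuous (cantorPoint r) := by
  refine continuous_tsum (u := fun n ↦ r ^ n * (1 / 2)) (fun n ↦ ?_) ?_
    fun n σ ↦ (norm_pow_smul_corner hr σ n).le
  · have : Continuous fun σ : ℕ → Fin 4 ↦ corner (σ n) :=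
      (continuous_of_discreteTopology (f := corner)).comp (continuous_apply n)
    exact this.const_smul (r ^ n)
  · exact (summable_geometric_of_lt_one hr.le (by linarith)).mul_right _

lemma cantorPoint_sub_eq_of_agree (hr : 0 < r) (hr2 : r < 1 / 2) (n : ℕ) (σ τ : ℕ → Fin 4)
    (h : ∀ i < n, σ i = τ i) :
    cantorPoint r σ - cantorPoint r τ =
      r ^ n • (cantorPoint r (fun i ↦ σ (i + n)) - cantorPoint r (fun i ↦ τ (i + n))) := by
  induction n generalizing σ τ with
  | zero => simp
  | succ n ih =>
    rw [cantorPoint_eq hr hr2 σ, cantorPoint_eq hr hr2 τ, h 0 (by omega), add_sub_add_left_eq_sub,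
      ← smul_sub, ih _ _ fun i hi ↦ h (i + 1) (by omega), smul_smul, ← pow_succ']
    simp only [add_assoc, add_comm, add_left_comm]

lemma norm_cantorPoint_sub_le_of_agree (hr : 0 < r) (hr2 : r < 1 / 2) (n : ℕ)
    (σ τ : ℕ → Fin 4) (h : ∀ i < n, σ i = τ i) :
    ‖cantorPoint r σ - cantorPoint r τ‖ ≤ 2 * r ^ n := by
  rw [cantorPoint_sub_eq_of_agree hr hr2 n σ τ h, norm_smul, norm_pow, Real.norm_of_nonneg hr.le]
  have := norm_sub_le (cantorPoint r fun i ↦ σ (i + n)) (cantorPoint r fun i ↦ τ (i + n))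
  have h1 := norm_cantorPoint_lt_one hr hr2 fun i ↦ σ (i + n)
  have h2 := norm_cantorPoint_lt_one hr hr2 fun i ↦ τ (i + n)
  rw [mul_comm]
  gcongr
  linarith

lemma le_norm_cantorPoint_sub (hr : 0 < r) (hr2 : r < 1 / 2) {σ τ : ℕ → Fin 4} (h : σ ≠ τ) :
    (1 - 2 * r) / (1 - r) * r ^ PiNat.firstDiff σ τ ≤ ‖cantorPoint r σ - cantorPoint r τ‖ := by
  set n := PiNat.firstDiff σ τ
  rw [cantorPoint_sub_eq_of_agree hr hr2 n σ τ fun i hi ↦ PiNat.apply_eq_of_lt_firstDiff hi,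
    norm_smul, norm_pow, Real.norm_of_nonneg hr.le, mul_comm]
  gcongr
  rw [cantorPoint_eq hr hr2, cantorPoint_eq hr hr2 (fun i ↦ τ (i + n)), add_sub_add_comm,
    ← smul_sub]
  have h0 : 1 ≤ ‖corner (σ (0 + n)) - corner (τ (0 + n))‖ :=
    one_le_norm_corner_sub (by rw [zero_add]; exact PiNat.apply_firstDiff_ne h)
  have h1 := norm_sub_le (cantorPoint r fun i ↦ σ (i + 1 + n)) (cantorPoint r fun i ↦ τ (i + 1 + n))
  have h2 := norm_cantorPoint_le hr hr2 fun i ↦ σ (i + 1 + n)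
  have h3 := norm_cantorPoint_le hr hr2 fun i ↦ τ (i + 1 + n)
  have h4 : ‖r • ((cantorPoint r fun i ↦ σ (i + 1 + n)) - cantorPoint r fun i ↦ τ (i + 1 + n))‖
      ≤ r * (2 * (1 / (2 * (1 - r)))) := by
    rw [norm_smul, Real.norm_of_nonneg hr.le]
    gcongr
    linarith
  have h5 := norm_sub_le_norm_add (corner (σ (0 + n)) - corner (τ (0 + n)))
    (r • ((cantorPoint r fun i ↦ σ (i + 1 + n)) - cantorPoint r fun i ↦ τ (i + 1 + n)))
  have h6 : (1 - 2 * r) / (1 - r) = 1 - r * (2 * (1 / (2 * (1 - r)))) := by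
    have : 1 - r ≠ 0 := by linarith
    field_simp
    ring
  linarith

lemma dimH_range_cantorPoint_le (hr : 0 < r) (hr2 : r < 1 / 2) {h : ℝ} (hh : 0 < h)
    (hrh : r ^ h = 1 / 4) : dimH (range (cantorPoint r)) ≤ ENNReal.ofReal h := by
  refine dimH_le_of_hausdorffMeasure_ne_top (d := h.toNNReal) ?_
  rw [Real.coe_toNNReal _ hh.le]
  let t : ∀ n : ℕ, (Fin n → Fin 4) → Set (ℝ × ℝ) := fun n w ↦
    cantorPoint r '' {σ | ∀ i : Fin n, σ i = w i}
  have hd : ∀ n w, Metric.ediam (t n w) ≤ ENNReal.ofReal (2 * r ^ n) := by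
    intro n w
    refine Metric.ediam_le ?_
    rintro _ ⟨σ, hσ, rfl⟩ _ ⟨τ, hτ, rfl⟩
    rw [edist_dist, dist_eq_norm]
    refine ENNReal.ofReal_le_ofReal (norm_cantorPoint_sub_le_of_agree hr hr2 n σ τ fun i hi ↦ ?_)
    exact (hσ ⟨i, hi⟩).trans (hτ ⟨i, hi⟩).symm
  have key := Measure.hausdorffMeasure_le_liminf_sum h (range (cantorPoint r)) (l := Filter.atTop)
    (fun n : ℕ ↦ ENNReal.ofReal (2 * r ^ n)) ?_ t (.of_forall hd) (.of_forall fun n ↦ ?_)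
  · refine ne_top_of_le_ne_top (b := ENNReal.ofReal (2 ^ h)) ENNReal.ofReal_ne_top
      (key.trans ?_)
    refine Filter.liminf_le_of_le (by isBoundedDefault) fun b hb ↦ ?_
    obtain ⟨n, hn⟩ := hb.exists
    refine hn.trans ((Finset.sum_le_sum fun w _ ↦ ENNReal.rpow_le_rpow (hd n w) hh.le).trans ?_)
    rw [Finset.sum_const, Finset.card_univ, Fintype.card_fun, Fintype.card_fin, Fintype.card_fin,
      ENNReal.ofReal_rpow_of_nonneg (by positivity) hh.le, nsmul_eq_mul,
      Real.mul_rpow (by norm_num) (by positivity), ← Real.rpow_pow_comm hr.le, hrh,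
      ← ENNReal.ofReal_natCast, ← ENNReal.ofReal_mul (by positivity)]
    refine ENNReal.ofReal_le_ofReal (le_of_eq ?_)
    push_cast
    rw [mul_left_comm, ← mul_pow]
    norm_num
  · have h0 : Filter.Tendsto (fun n : ℕ ↦ 2 * r ^ n) Filter.atTop (nhds (2 * 0)) :=
      (tendsto_pow_atTop_nhds_zero_of_lt_one hr.le (by linarith)).const_mul 2
    simpa using ENNReal.tendsto_ofReal h0
  · rintro _ ⟨σ, rfl⟩
    exact mem_iUnion.2 ⟨fun i ↦ σ i, σ, fun _ ↦ rfl, rfl⟩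

lemma le_dimH_range_cantorPoint (hr : 0 < r) (hr2 : r < 1 / 2) {h : ℝ} (hh : 0 < h)
    (hrh : r ^ h = 1 / 4) : ENNReal.ofReal h ≤ dimH (range (cantorPoint r)) := by
  set c := (1 - 2 * r) / (1 - r)
  have hc : 0 < c := div_pos (by linarith) (by linarith)
  have hinj : Function.Injective (cantorPoint r) := by
    intro σ τ hστ
    by_contra hne
    have := le_norm_cantorPoint_sub hr hr2 hne
    rw [hστ, sub_self, norm_zero] at this
    exact absurd this (not_le.2 (by positivity))
  let f : ℝ × ℝ → ℝ := fun x ↦ Real.ofDigits (Function.invFun (cantorPoint r) x)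
  have hf : ∀ σ, f (cantorPoint r σ) = Real.ofDigits σ := fun σ ↦ by
    simp only [f, Function.leftInverse_invFun hinj σ]
  have hhol : HolderOnWith (c⁻¹ ^ h).toNNReal h.toNNReal f (range (cantorPoint r)) := by
    rintro _ ⟨σ, rfl⟩ _ ⟨τ, rfl⟩
    rw [hf, hf, Real.coe_toNNReal _ hh.le, edist_dist, edist_dist,
      ENNReal.ofReal_rpow_of_nonneg dist_nonneg hh.le]
    change _ ≤ ENNReal.ofReal _ * _
    rw [← ENNReal.ofReal_mul (by positivity)]
    refine ENNReal.ofReal_le_ofReal ?_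
    rcases eq_or_ne σ τ with rfl | hne
    · rw [dist_self]; positivity
    rw [Real.dist_eq, dist_eq_norm, ← Real.mul_rpow (by positivity) (norm_nonneg _)]
    refine (Real.abs_ofDigits_sub_ofDigits_le (x := σ) (y := τ) (n := PiNat.firstDiff σ τ)
      fun i hi ↦ PiNat.apply_eq_of_lt_firstDiff (E := fun _ ↦ Fin 4) hi).trans ?_
    have h1 : r ^ PiNat.firstDiff σ τ ≤ c⁻¹ * ‖cantorPoint r σ - cantorPoint r τ‖ := by
      rw [inv_mul_eq_div, le_div_iff₀' hc]
      exact le_norm_cantorPoint_sub hr hr2 hne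
    refine le_trans (le_of_eq ?_) (Real.rpow_le_rpow (by positivity) h1 hh.le)
    rw [← Real.rpow_pow_comm hr.le, hrh]
    simp
  have hsub : Icc (0 : ℝ) 1 ⊆ f '' range (cantorPoint r) := by
    intro y hy
    obtain ⟨σ, -, rfl⟩ := Real.ofDigits_SurjOn (b := 4) (by norm_num) hy
    exact ⟨_, ⟨σ, rfl⟩, hf σ⟩
  have h1 : (1 : ENNReal) ≤ dimH (range (cantorPoint r)) / ENNReal.ofReal h := by
    calc (1 : ENNReal) = dimH (Icc (0 : ℝ) 1) := by
          rw [Real.dimH_of_nonempty_interior (by simp)]; simp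
      _ ≤ _ := dimH_mono hsub
      _ ≤ _ := hhol.dimH_image_le (Real.toNNReal_pos.2 hh)
  rwa [ENNReal.le_div_iff_mul_le (by simp [hh]) (by simp), one_mul] at h1

lemma dimH_range_cantorPoint (hr : 0 < r) (hr2 : r < 1 / 2) {h : ℝ} (hh : 0 < h)
    (hrh : r ^ h = 1 / 4) : dimH (range (cantorPoint r)) = ENNReal.ofReal h :=
  (dimH_range_cantorPoint_le hr hr2 hh hrh).antisymm (le_dimH_range_cantorPoint hr hr2 hh hrh)

end CantorSet

/-- Time-independent version of `WeakDivFreeAt`. -/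
def WeakDivFree (F : ℝ × ℝ → ℝ × ℝ) : Prop :=
  ∀ ψ : ℝ × ℝ → ℝ, ContDiff ℝ (⊤ : ℕ∞) ψ → HasCompactSupport ψ →
    ∫ x, dot2 (F x) (grad2 ψ x) = 0

lemma continuous_dot2 : Continuous fun p : (ℝ × ℝ) × (ℝ × ℝ) ↦ dot2 p.1 p.2 := by
  unfold dot2
  fun_prop

lemma ContDiff.continuous_grad2 {ψ : ℝ × ℝ → ℝ} (hψ : ContDiff ℝ (⊤ : ℕ∞) ψ) :
    Continuous (grad2 ψ) := by
  have := hψ.continuous_fderiv (by simp)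
  unfold grad2
  fun_prop

lemma HasCompactSupport.grad2 {ψ : ℝ × ℝ → ℝ} (hc : HasCompactSupport ψ) :
    HasCompactSupport (grad2 ψ) :=
  (hc.fderiv (𝕜 := ℝ)).comp_left (g := fun A : ℝ × ℝ →L[ℝ] ℝ ↦ (A (1, 0), A (0, 1))) (by simp)

lemma integrable_dot2_grad2 {F : ℝ × ℝ → ℝ × ℝ} (hF : Continuous F) {ψ : ℝ × ℝ → ℝ}
    (hψ : ContDiff ℝ (⊤ : ℕ∞) ψ) (hc : HasCompactSupport ψ) :
    Integrable fun x ↦ dot2 (F x) (grad2 ψ x) := by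
  refine (continuous_dot2.comp (hF.prodMk hψ.continuous_grad2)).integrable_of_hasCompactSupport ?_
  refine hc.grad2.mono fun x hx h0 ↦ hx ?_
  simp [h0, dot2]

lemma WeakDivFree.add {F G : ℝ × ℝ → ℝ × ℝ} (hF : WeakDivFree F) (hG : WeakDivFree G)
    (hFc : Continuous F) (hGc : Continuous G) : WeakDivFree (F + G) := by
  intro ψ hψ hc
  have := integral_add (integrable_dot2_grad2 hFc hψ hc) (integrable_dot2_grad2 hGc hψ hc)
  rw [hF ψ hψ hc, hG ψ hψ hc, add_zero] at this
  rw [← this]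
  congr 1 with x
  simp only [dot2, Pi.add_apply, Prod.fst_add, Prod.snd_add]
  ring

lemma WeakDivFree.sum {ι : Type*} (s : Finset ι) {F : ι → ℝ × ℝ → ℝ × ℝ}
    (hF : ∀ i, WeakDivFree (F i)) (hFc : ∀ i, Continuous (F i)) :
    WeakDivFree (∑ i ∈ s, F i) := by
  classical
  induction s using Finset.induction_on with
  | empty => intro ψ _ _; simp [dot2]
  | insert i s hi ih =>
    rw [Finset.sum_insert hi]
    refine (hF i).add ih (hFc i) ?_
    rw [Finset.sum_fn]
    exact continuous_finsetSum s fun i _ ↦ hFc i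

lemma WeakDivFree.const_smul {F : ℝ × ℝ → ℝ × ℝ} (hF : WeakDivFree F) (c : ℝ) :
    WeakDivFree (c • F) := by
  intro ψ hψ hc
  rw [← mul_zero c, ← hF ψ hψ hc, ← integral_const_mul]
  congr 1 with x
  simp only [dot2, Pi.smul_apply, Prod.smul_fst, Prod.smul_snd, smul_eq_mul]
  ring

lemma grad2_comp_add_smul {ψ : ℝ × ℝ → ℝ} (hψ : Differentiable ℝ ψ) (r : ℝ) (d z : ℝ × ℝ) :
    grad2 (fun z ↦ ψ (d + r • z)) z = r • grad2 ψ (d + r • z) := by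
  have h1 : HasFDerivAt (fun z : ℝ × ℝ ↦ d + r • z) (r • ContinuousLinearMap.id ℝ (ℝ × ℝ)) z :=
    ((hasFDerivAt_id z).const_smul r).const_add d
  have h2 := (hψ (d + r • z)).hasFDerivAt.comp z h1
  have h3 : fderiv ℝ (fun z ↦ ψ (d + r • z)) z = _ := h2.fderiv
  simp only [grad2, h3]
  simp

/-- The field `F` transported to the square of centre `d` and size `r`. -/
def rescale (r : ℝ) (d : ℝ × ℝ) (F : ℝ × ℝ → ℝ × ℝ) (x : ℝ × ℝ) : ℝ × ℝ :=
  r • F (r⁻¹ • (x - d))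

lemma WeakDivFree.rescale {r : ℝ} (hr : 0 < r) (d : ℝ × ℝ) {F : ℝ × ℝ → ℝ × ℝ}
    (hF : WeakDivFree F) : WeakDivFree (rescale r d F) := by
  intro ψ hψ hc
  let e : (ℝ × ℝ) ≃ₜ (ℝ × ℝ) := (Homeomorph.smulOfNeZero r hr.ne').trans (Homeomorph.addLeft d)
  have hG := hF (fun z ↦ ψ (d + r • z)) (hψ.comp (by fun_prop)) (hc.comp_homeomorph e)
  have h1 : ∀ x, dot2 (_root_.rescale r d F x) (grad2 ψ x) =
      (fun z ↦ dot2 (F z) (grad2 (fun z ↦ ψ (d + r • z)) z)) (r⁻¹ • (x - d)) := by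
    intro x
    simp only [grad2_comp_add_smul (hψ.differentiable (by simp)), _root_.rescale,
      smul_inv_smul₀ hr.ne', add_sub_cancel, dot2, Prod.smul_fst, Prod.smul_snd, smul_eq_mul]
    ring
  simp_rw [h1]
  rw [integral_sub_right_eq_self (fun x ↦
    (fun z ↦ dot2 (F z) (grad2 (fun z ↦ ψ (d + r • z)) z)) (r⁻¹ • x)) d]
  refine (Measure.integral_comp_smul volume
    (fun z ↦ dot2 (F z) (grad2 (fun z ↦ ψ (d + r • z)) z)) r⁻¹).trans ?_
  rw [hG, smul_zero]

/-- The rotated gradient of a stream function. -/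
def perpGrad (η : ℝ × ℝ → ℝ) (x : ℝ × ℝ) : ℝ × ℝ :=
  (-fderiv ℝ η x (0, 1), fderiv ℝ η x (1, 0))

lemma weakDivFree_perpGrad {η : ℝ × ℝ → ℝ} (hη : ContDiff ℝ (⊤ : ℕ∞) η)
    (hηc : HasCompactSupport η) : WeakDivFree (perpGrad η) := by
  intro ψ hψ hc
  have hdη : ContDiff ℝ (⊤ : ℕ∞) (fderiv ℝ η) := hη.fderiv_right (by simp)
  have hdψ : ContDiff ℝ (⊤ : ℕ∞) (fderiv ℝ ψ) := hψ.fderiv_right (by simp)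
  have hd2 : Continuous (fderiv ℝ (fderiv ℝ ψ)) := hdψ.continuous_fderiv (by simp)
  have happly : ∀ v w x, fderiv ℝ (fun x ↦ fderiv ℝ ψ x v) x w = fderiv ℝ (fderiv ℝ ψ) x w v := by
    intro v w x
    rw [fderiv_clm_apply (hdψ.differentiable (by simp) x) (differentiableAt_const v)]
    simp
  have cη := hη.continuous
  have cdη := hdη.continuous
  have cdψ := hdψ.continuous
  have hintegr : ∀ v w : ℝ × ℝ, Integrable fun x ↦ fderiv ℝ ψ x v * fderiv ℝ η x w := fun v w ↦
    (show Continuous _ by fun_prop).integrable_of_hasCompactSupport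
      ((hηc.fderiv_apply (𝕜 := ℝ) w).mul_left)
  have hparts : ∀ v w : ℝ × ℝ, ∫ x, fderiv ℝ ψ x v * fderiv ℝ η x w =
      -∫ x, fderiv ℝ (fderiv ℝ ψ) x w v * η x := by
    intro v w
    simp_rw [← happly]
    refine integral_mul_fderiv_eq_neg_fderiv_mul_of_integrable ?_ (hintegr v w) ?_ ?_ ?_
    · simp_rw [happly]
      exact (show Continuous _ by fun_prop).integrable_of_hasCompactSupport hηc.mul_left
    · exact (show Continuous _ by fun_prop).integrable_of_hasCompactSupport hηc.mul_left
    · exact fun x _ ↦ (hdψ.differentiable (by simp) x).clm_apply (differentiableAt_const v)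
    · exact fun x _ ↦ hη.differentiable (by simp) x
  have hsymm : ∀ x v w, fderiv ℝ (fderiv ℝ ψ) x w v = fderiv ℝ (fderiv ℝ ψ) x v w := fun x v w ↦
    hψ.contDiffAt.isSymmSndFDerivAt (by
      rw [minSmoothness_of_isRCLikeNormedField]; exact WithTop.coe_le_coe.2 le_top) w v
  have h1 : ∀ x, dot2 (perpGrad η x) (grad2 ψ x) =
      fderiv ℝ ψ x (0, 1) * fderiv ℝ η x (1, 0) - fderiv ℝ ψ x (1, 0) * fderiv ℝ η x (0, 1) := by
    intro x
    simp only [dot2, perpGrad, grad2]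
    ring
  simp_rw [h1]
  rw [integral_sub (hintegr _ _) (hintegr _ _), hparts, hparts]
  simp_rw [hsymm _ (0, 1) (1, 0)]
  exact sub_self _

/-- A compactly supported divergence-free field which is constant on the unit square. -/
lemma exists_weakDivFree_eq_const {R : ℝ} (hR : 1 < R) (e : ℝ × ℝ) :
    ∃ E : ℝ × ℝ → ℝ × ℝ, ContDiff ℝ 1 E ∧ WeakDivFree E ∧ (∀ x ∈ Metric.ball 0 1, E x = e) ∧
      tsupport E ⊆ Metric.ball 0 R ∧ ∃ L, ∀ x, ‖fderiv ℝ E x‖ ≤ L := by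
  let χ : ContDiffBump (0 : ℝ × ℝ) := ⟨1, (1 + R) / 2, one_pos, by linarith⟩
  let ℓ : ℝ × ℝ →L[ℝ] ℝ :=
    e.2 • ContinuousLinearMap.fst ℝ ℝ ℝ - e.1 • ContinuousLinearMap.snd ℝ ℝ ℝ
  let η : ℝ × ℝ → ℝ := fun x ↦ χ x * ℓ x
  have hη : ContDiff ℝ (⊤ : ℕ∞) η := χ.contDiff.mul ℓ.contDiff
  have hηc : HasCompactSupport η := χ.hasCompactSupport.mul_right
  have hdη : ContDiff ℝ 1 (fderiv ℝ η) := hη.fderiv_right (by norm_cast)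
  have hE : ContDiff ℝ 1 (perpGrad η) := by
    unfold perpGrad
    fun_prop
  have hsupp : tsupport (perpGrad η) ⊆ tsupport η := by
    refine (closure_mono ?_).trans (tsupport_fderiv_subset ℝ)
    intro x hx h0
    exact hx (by simp [perpGrad, h0])
  refine ⟨perpGrad η, hE, weakDivFree_perpGrad hη hηc, fun x hx ↦ ?_, ?_, ?_⟩
  · have h1 : η =ᶠ[nhds x] ℓ := by
      filter_upwards [χ.eventuallyEq_one_of_mem_ball hx] with y hy
      simp [η, hy]
    simp only [perpGrad, h1.fderiv_eq, ℓ.fderiv]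
    simp [ℓ]
  · refine hsupp.trans ((closure_mono (Function.support_mul_subset_left _ _)).trans ?_)
    refine χ.tsupport_eq.subset.trans (Metric.closedBall_subset_ball ?_)
    change (1 + R) / 2 < R
    linarith
  · obtain ⟨L, hL⟩ := ((hηc.mono' (subset_closure.trans hsupp)).fderiv
      (𝕜 := ℝ)).exists_bound_of_continuous (hE.continuous_fderiv (by simp))
    exact ⟨L, hL⟩

lemma norm_sum_le_of_pairwise_zero {ι G : Type*} [SeminormedAddCommGroup G] [Fintype ι] {f : ι → G}
    {L : ℝ} (hL : 0 ≤ L) (h0 : ∀ i j, i ≠ j → f i = 0 ∨ f j = 0) (hf : ∀ i, ‖f i‖ ≤ L) :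
    ‖∑ i, f i‖ ≤ L := by
  by_cases h : ∃ i, f i ≠ 0
  · obtain ⟨i, hi⟩ := h
    rw [Fintype.sum_eq_single i fun j hj ↦ (h0 i j hj.symm).resolve_left hi]
    exact hf i
  · push Not at h
    simpa [h] using hL

lemma eq_of_mem_ball_corner {i j : Fin 4} {x : ℝ × ℝ} (hi : x ∈ Metric.ball (corner i) (1 / 2))
    (hj : x ∈ Metric.ball (corner j) (1 / 2)) : i = j := by
  by_contra hij
  have h1 := one_le_norm_corner_sub hij
  rw [← dist_eq_norm] at h1
  have h2 := dist_triangle_left (corner i) (corner j) x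
  rw [Metric.mem_ball] at hi hj
  linarith

lemma ball_corner_subset (j : Fin 4) : Metric.ball (corner j) (1 / 2) ⊆ Metric.ball 0 1 :=
  Metric.ball_subset_ball' (by rw [dist_zero_right, norm_corner]; norm_num)

section Rescale

variable {r : ℝ} {G : ℝ × ℝ → ℝ × ℝ} {d : ℝ × ℝ}

lemma ContDiff.rescale (hG : ContDiff ℝ 1 G) : ContDiff ℝ 1 (rescale r d G) := by
  unfold _root_.rescale
  fun_prop

lemma norm_fderiv_rescale (hr : 0 < r) (hG : ContDiff ℝ 1 G) (x : ℝ × ℝ) :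
    ‖fderiv ℝ (rescale r d G) x‖ = ‖fderiv ℝ G (r⁻¹ • (x - d))‖ := by
  have h1 : HasFDerivAt (fun x : ℝ × ℝ ↦ r⁻¹ • (x - d))
      (r⁻¹ • ContinuousLinearMap.id ℝ (ℝ × ℝ)) x :=
    ((hasFDerivAt_id x).sub_const d).const_smul r⁻¹
  have h2 := ((hG.differentiable (by simp) _).hasFDerivAt.comp x h1).const_smul r
  have h3 : fderiv ℝ (rescale r d G) x = _ := h2.fderiv
  rw [h3, ContinuousLinearMap.comp_smul, smul_inv_smul₀ hr.ne', ContinuousLinearMap.comp_id]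

lemma tsupport_rescale_subset (hr : 0 < r) (hG : tsupport G ⊆ Metric.ball 0 (1 / (2 * r))) :
    tsupport (rescale r d G) ⊆ Metric.ball d (1 / 2) := by
  have h1 : tsupport (rescale r d G) ⊆ tsupport (G ∘ fun x ↦ r⁻¹ • (x - d)) :=
    closure_mono (Function.support_const_smul_subset r _)
  intro x hx
  have h2 := hG (tsupport_comp_subset_preimage G (f := fun x ↦ r⁻¹ • (x - d)) (by fun_prop) (h1 hx))
  rw [mem_ball_zero_iff, norm_smul, norm_inv, Real.norm_of_nonneg hr.le,
    inv_mul_lt_iff₀ hr] at h2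
  rw [mem_ball_iff_norm]
  have h3 : r * (1 / (2 * r)) = 1 / 2 := by field_simp
  rwa [h3] at h2

end Rescale

/-- Continuously differentiable divergence-free fields supported in the open unit square whose
derivative is bounded by `L`. -/
structure IsUnitField (L : ℝ) (F : ℝ × ℝ → ℝ × ℝ) : Prop where
  contDiff : ContDiff ℝ 1 F
  weakDivFree : WeakDivFree F
  tsupport_subset : tsupport F ⊆ Metric.ball 0 1
  norm_fderiv_le : ∀ x, ‖fderiv ℝ F x‖ ≤ L

lemma IsUnitField.lipschitzWith {L : ℝ} {F : ℝ × ℝ → ℝ × ℝ} (hF : IsUnitField L F) :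
    LipschitzWith L.toNNReal F :=
  lipschitzWith_of_nnnorm_fderiv_le (hF.contDiff.differentiable (by simp)) fun x ↦
    NNReal.coe_le_coe.1 ((hF.norm_fderiv_le x).trans (Real.le_coe_toNNReal L))

lemma IsUnitField.eq_zero {L : ℝ} {F : ℝ × ℝ → ℝ × ℝ} (hF : IsUnitField L F) {x : ℝ × ℝ}
    (hx : 1 ≤ ‖x‖) : F x = 0 :=
  image_eq_zero_of_notMem_tsupport fun h ↦ by
    simpa using (mem_ball_zero_iff.1 (hF.tsupport_subset h)).trans_le hx

lemma IsUnitField.norm_le {L : ℝ} (hL : 0 ≤ L) {F : ℝ × ℝ → ℝ × ℝ} (hF : IsUnitField L F)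
    (x : ℝ × ℝ) : ‖F x‖ ≤ 2 * L := by
  rcases le_or_gt 1 ‖x‖ with hx | hx
  · rw [hF.eq_zero hx, norm_zero]
    positivity
  · have h1 := hF.lipschitzWith.dist_le_mul x (1, 0)
    have h2 : ‖((1 : ℝ), (0 : ℝ))‖ = 1 := by simp
    rw [hF.eq_zero (x := (1, 0)) h2.ge, dist_zero_right, Real.coe_toNNReal _ hL] at h1
    have h3 : dist x (1, 0) ≤ 2 := by
      rw [dist_eq_norm]
      refine (norm_sub_le _ _).trans ?_
      linarith
    nlinarith

/-- Sum over the four quadrants of rescaled copies of `F` added to the corrector `E j`. -/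
def subdivide (r : ℝ) (E : Fin 4 → ℝ × ℝ → ℝ × ℝ) (F : ℝ × ℝ → ℝ × ℝ) : ℝ × ℝ → ℝ × ℝ :=
  ∑ j, rescale r (corner j) (E j + F)

/-- Iterates of `subdivide` starting with the zero field. -/
def subdivideIter (r : ℝ) (E : Fin 4 → ℝ × ℝ → ℝ × ℝ) (n : ℕ) : ℝ × ℝ → ℝ × ℝ :=
  (subdivide r E)^[n] 0

/-- Correctors for `subdivide`: field number `j` moves the unit square towards `corner j`. -/
structure IsCorrector (r L : ℝ) (E : Fin 4 → ℝ × ℝ → ℝ × ℝ) : Prop where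
  pos : 0 < r
  lt_half : r < 1 / 2
  nonneg : 0 ≤ L
  contDiff : ∀ j, ContDiff ℝ 1 (E j)
  weakDivFree : ∀ j, WeakDivFree (E j)
  eq_const : ∀ j, ∀ x ∈ Metric.ball 0 1, E j x = r⁻¹ • corner j
  tsupport_subset : ∀ j, tsupport (E j) ⊆ Metric.ball 0 (1 / (2 * r))
  norm_fderiv_le : ∀ j x, ‖fderiv ℝ (E j) x‖ ≤ L

lemma exists_isCorrector {r : ℝ} (hr : 0 < r) (hr2 : r < 1 / 2) :
    ∃ L E, IsCorrector r L E := by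
  have hR : 1 < 1 / (2 * r) := by
    rw [lt_div_iff₀ (by positivity)]
    linarith
  choose E h1 h2 h3 h4 L hL using fun j ↦ exists_weakDivFree_eq_const hR (r⁻¹ • corner j)
  have h0 : ∀ j, 0 ≤ L j := fun j ↦ (norm_nonneg _).trans (hL j 0)
  exact ⟨∑ j, L j, E, hr, hr2, Finset.sum_nonneg fun j _ ↦ h0 j, h1, h2, h3, h4, fun j x ↦
    (hL j x).trans (Finset.single_le_sum (fun j _ ↦ h0 j) (Finset.mem_univ j))⟩

section Refine

variable {r L : ℝ} {E : Fin 4 → ℝ × ℝ → ℝ × ℝ} {F : ℝ × ℝ → ℝ × ℝ}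

lemma IsCorrector.tsupport_add_subset (hE : IsCorrector r L E) (hF : IsUnitField L F)
    (j : Fin 4) : tsupport (E j + F) ⊆ Metric.ball 0 (1 / (2 * r)) := by
  refine (tsupport_add _ _).trans (union_subset (hE.tsupport_subset j)
    (hF.tsupport_subset.trans (Metric.ball_subset_ball ?_)))
  have := hE.pos
  have := hE.lt_half
  rw [le_div_iff₀ (by positivity)]
  linarith

lemma IsCorrector.tsupport_rescale_subset (hE : IsCorrector r L E) (hF : IsUnitField L F)
    (j : Fin 4) :
    tsupport (rescale r (corner j) (E j + F)) ⊆ Metric.ball (corner j) (1 / 2) :=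
  _root_.tsupport_rescale_subset hE.pos (hE.tsupport_add_subset hF j)

lemma IsCorrector.norm_fderiv_add_le (hE : IsCorrector r L E) (hF : IsUnitField L F)
    (j : Fin 4) (x : ℝ × ℝ) : ‖fderiv ℝ (E j + F) x‖ ≤ L := by
  rw [fderiv_add ((hE.contDiff j).differentiable (by simp) x)
    (hF.contDiff.differentiable (by simp) x)]
  by_cases hx : x ∈ Metric.ball 0 1
  · have h1 : E j =ᶠ[nhds x] fun _ ↦ r⁻¹ • corner j := by
      filter_upwards [Metric.isOpen_ball.mem_nhds hx] with y hy using hE.eq_const j y hy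
    rw [h1.fderiv_eq]
    simpa using hF.norm_fderiv_le x
  · have h1 : fderiv ℝ F x = 0 := by
      by_contra h0
      exact hx (hF.tsupport_subset (support_fderiv_subset ℝ h0))
    rw [h1, add_zero]
    exact hE.norm_fderiv_le j x

lemma isUnitField_subdivide (hE : IsCorrector r L E) (hF : IsUnitField L F) :
    IsUnitField L (subdivide r E F) := by
  have hG : ∀ j, ContDiff ℝ 1 (E j + F) := fun j ↦ (hE.contDiff j).add hF.contDiff
  have hsupp := hE.tsupport_rescale_subset hF
  refine ⟨?_, ?_, ?_, fun x ↦ ?_⟩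
  · unfold subdivide
    rw [Finset.sum_fn]
    exact ContDiff.sum fun j _ ↦ (hG j).rescale
  · exact WeakDivFree.sum _ (fun j ↦ ((hE.weakDivFree j).add hF.weakDivFree
      (hE.contDiff j).continuous hF.contDiff.continuous).rescale hE.pos _)
      fun j ↦ (hG j).rescale.continuous
  · have hsub : Function.support (subdivide r E F) ⊆
        ⋃ j, tsupport (rescale r (corner j) (E j + F)) := by
      intro x hx
      by_contra h0
      simp only [mem_iUnion, not_exists] at h0
      refine hx ?_
      unfold subdivide
      rw [Finset.sum_apply]
      exact Finset.sum_eq_zero fun j _ ↦ image_eq_zero_of_notMem_tsupport (h0 j)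
    refine (closure_minimal hsub (isClosed_iUnion_of_finite fun j ↦ isClosed_tsupport _)).trans ?_
    exact iUnion_subset fun j ↦ (hsupp j).trans (ball_corner_subset j)
  · unfold subdivide
    rw [fderiv_sum fun j _ ↦ (hG j).rescale.differentiable (by simp) x]
    refine norm_sum_le_of_pairwise_zero hE.nonneg (fun i j hij ↦ ?_) fun j ↦ ?_
    · by_contra! h0
      exact hij (eq_of_mem_ball_corner (hsupp i (support_fderiv_subset ℝ h0.1))
        (hsupp j (support_fderiv_subset ℝ h0.2)))
    · rw [norm_fderiv_rescale hE.pos (hG j)]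
      exact hE.norm_fderiv_add_le hF j _

lemma subdivideIter_succ (n : ℕ) :
    subdivideIter r E (n + 1) = subdivide r E (subdivideIter r E n) :=
  Function.iterate_succ_apply' _ _ _

lemma isUnitField_subdivideIter (hE : IsCorrector r L E) (n : ℕ) :
    IsUnitField L (subdivideIter r E n) := by
  induction n with
  | zero =>
    refine ⟨contDiff_const, fun ψ _ _ ↦ by simp [subdivideIter, dot2], by simp [subdivideIter], ?_⟩
    intro x
    simpa [subdivideIter] using hE.nonneg
  | succ n ih =>
    rw [subdivideIter_succ]
    exact isUnitField_subdivide hE ih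

lemma norm_subdivideIter_succ_sub_le (hE : IsCorrector r L E) (n : ℕ) (x : ℝ × ℝ) :
    ‖subdivideIter r E (n + 1) x - subdivideIter r E n x‖ ≤ 2 * L * r ^ n := by
  have hr := hE.pos
  have hL := hE.nonneg
  induction n generalizing x with
  | zero => simpa [subdivideIter] using (isUnitField_subdivideIter hE 1).norm_le hE.nonneg x
  | succ n ih =>
    have hF := isUnitField_subdivideIter hE n
    have hF' := isUnitField_subdivideIter hE (n + 1)
    have hz : ∀ {j} {G : ℝ × ℝ → ℝ × ℝ}, IsUnitField L G →
        x ∉ Metric.ball (corner j) (1 / 2) → rescale r (corner j) (E j + G) x = 0 :=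
      fun hG hx ↦ image_eq_zero_of_notMem_tsupport fun h ↦ hx (hE.tsupport_rescale_subset hG _ h)
    rw [subdivideIter_succ (n + 1)]
    nth_rw 2 [subdivideIter_succ n]
    rw [subdivide, subdivide, Finset.sum_apply, Finset.sum_apply, ← Finset.sum_sub_distrib]
    refine norm_sum_le_of_pairwise_zero (by positivity) (fun i j hij ↦ ?_) fun j ↦ ?_
    · by_cases hi : x ∈ Metric.ball (corner i) (1 / 2)
      · right
        have hj : x ∉ Metric.ball (corner j) (1 / 2) := fun hj ↦ hij (eq_of_mem_ball_corner hi hj)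
        rw [hz hF hj, hz hF' hj, sub_zero]
      · left
        rw [hz hF hi, hz hF' hi, sub_zero]
    · simp only [rescale, Pi.add_apply]
      rw [← smul_sub, add_sub_add_left_eq_sub, norm_smul, Real.norm_of_nonneg hr.le, pow_succ']
      calc _ ≤ r * (2 * L * r ^ n) := by gcongr; exact ih _
        _ = _ := by ring

lemma norm_subdivideIter_cantorPoint_sub_le (hE : IsCorrector r L E) (n : ℕ) (σ : ℕ → Fin 4) :
    ‖subdivideIter r E n (cantorPoint r σ) - cantorPoint r σ‖ ≤ r ^ n := by
  have hr := hE.pos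
  induction n generalizing σ with
  | zero => simpa [subdivideIter] using (norm_cantorPoint_lt_one hE.pos hE.lt_half σ).le
  | succ n ih =>
    have hF := isUnitField_subdivideIter hE n
    have hlt := norm_cantorPoint_lt_one hE.pos hE.lt_half fun i ↦ σ (i + 1)
    have heq := cantorPoint_eq hE.pos hE.lt_half σ
    have hmem : cantorPoint r σ ∈ Metric.ball (corner (σ 0)) (1 / 2) := by
      rw [heq, mem_ball_iff_norm, add_sub_cancel_left, norm_smul, Real.norm_of_nonneg hr.le]
      nlinarith [hE.lt_half]
    rw [subdivideIter_succ, subdivide, Finset.sum_apply, Fintype.sum_eq_single (σ 0) fun j hj ↦ ?_]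
    · nth_rw 2 [heq]
      rw [rescale, heq, add_sub_cancel_left, inv_smul_smul₀ hr.ne', Pi.add_apply,
        hE.eq_const _ _ (mem_ball_zero_iff.2 hlt), smul_add, smul_inv_smul₀ hr.ne',
        add_sub_add_left_eq_sub, ← smul_sub, norm_smul, Real.norm_of_nonneg hr.le, pow_succ']
      gcongr
      exact ih _
    · exact image_eq_zero_of_notMem_tsupport fun h ↦
        hj (eq_of_mem_ball_corner (hE.tsupport_rescale_subset hF _ h) hmem)

end Refine

/-- A uniform limit of bounded continuous divergence-free fields is divergence free. -/
lemma WeakDivFree.of_tendsto {F : ℕ → ℝ × ℝ → ℝ × ℝ} {V : ℝ × ℝ → ℝ × ℝ} {M : ℝ}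
    (hF : ∀ n, WeakDivFree (F n)) (hc : ∀ n, Continuous (F n)) (hM : ∀ n x, ‖F n x‖ ≤ M)
    (hlim : ∀ x, Filter.Tendsto (fun n ↦ F n x) Filter.atTop (nhds (V x))) : WeakDivFree V := by
  intro ψ hψ hψc
  have hg := hψ.continuous_grad2
  have h1 := tendsto_integral_of_dominated_convergence (μ := volume)
    (F := fun n x ↦ dot2 (F n x) (grad2 ψ x)) (f := fun x ↦ dot2 (V x) (grad2 ψ x))
    (fun x ↦ 2 * (M * ‖grad2 ψ x‖))
    (fun n ↦ (integrable_dot2_grad2 (hc n) hψ hψc).aestronglyMeasurable)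
    ((((hg.integrable_of_hasCompactSupport hψc.grad2).norm.const_mul M).const_mul 2))
    (fun n ↦ .of_forall fun x ↦ ?_) (.of_forall fun x ↦ ?_)
  · simp_rw [hF _ ψ hψ hψc] at h1
    exact tendsto_nhds_unique h1 tendsto_const_nhds
  · have hb : ∀ a b : ℝ × ℝ, ‖dot2 a b‖ ≤ 2 * (‖a‖ * ‖b‖) := by
      intro a b
      unfold dot2
      refine (norm_add_le _ _).trans ?_
      rw [norm_mul, norm_mul, two_mul]
      gcongr
      exacts [norm_fst_le a, norm_fst_le b, norm_snd_le a, norm_snd_le b]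
    refine (hb _ _).trans ?_
    gcongr
    exact hM n x
  · exact (continuous_dot2.tendsto (V x, grad2 ψ x)).comp
      ((hlim x).prodMk_nhds tendsto_const_nhds)

/-- A Lipschitz divergence-free field, supported in the unit square, which agrees with the identity
on the four-corner Cantor set. -/
lemma exists_field_eq_self_on_cantor {r : ℝ} (hr : 0 < r) (hr2 : r < 1 / 2) :
    ∃ (V : ℝ × ℝ → ℝ × ℝ) (K : NNReal) (M : ℝ), LipschitzWith K V ∧ (∀ x, ‖V x‖ ≤ M) ∧
      (∀ x, 1 ≤ ‖x‖ → V x = 0) ∧ WeakDivFree V ∧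
      ∀ σ, V (cantorPoint r σ) = cantorPoint r σ := by
  obtain ⟨L, E, hE⟩ := exists_isCorrector hr hr2
  have hF := isUnitField_subdivideIter hE
  have hcauchy : ∀ x, CauchySeq fun n ↦ subdivideIter r E n x := fun x ↦
    cauchySeq_of_le_geometric r (2 * L) (by linarith) fun n ↦ by
      rw [dist_comm, dist_eq_norm]
      exact norm_subdivideIter_succ_sub_le hE n x
  choose V hV using fun x ↦ cauchySeq_tendsto_of_complete (hcauchy x)
  refine ⟨V, L.toNNReal, 2 * L, ?_, fun x ↦ ?_, fun x hx ↦ ?_, ?_, fun σ ↦ ?_⟩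
  · refine LipschitzWith.of_dist_le_mul fun x y ↦ ?_
    exact le_of_tendsto ((hV x).dist (hV y)) (.of_forall fun n ↦
      (hF n).lipschitzWith.dist_le_mul x y)
  · exact le_of_tendsto (hV x).norm (.of_forall fun n ↦ (hF n).norm_le hE.nonneg x)
  · refine tendsto_nhds_unique (hV x) ?_
    simp_rw [(hF _).eq_zero hx]
    exact tendsto_const_nhds
  · exact .of_tendsto (fun n ↦ (hF n).weakDivFree) (fun n ↦ (hF n).contDiff.continuous)
      (fun n ↦ (hF n).norm_le hE.nonneg) hV
  · refine tendsto_nhds_unique (hV _) (tendsto_iff_norm_sub_tendsto_zero.2 ?_)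
    exact squeeze_zero (fun n ↦ norm_nonneg _)
      (fun n ↦ norm_subdivideIter_cantorPoint_sub_le hE n σ)
      (tendsto_pow_atTop_nhds_zero_of_lt_one hr.le (by linarith))

open Real (smoothTransition)

lemma contDiff_deriv_smoothTransition : ContDiff ℝ (⊤ : ℕ∞) (deriv smoothTransition) :=
  (contDiff_infty_iff_deriv.1 Real.smoothTransition.contDiff).2

lemma deriv_smoothTransition_of_nonpos {t : ℝ} (ht : t ≤ 0) : deriv smoothTransition t = 0 := by
  have h : EqOn (deriv smoothTransition) 0 (closure (Iio 0)) := by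
    refine EqOn.closure (fun s hs ↦ ?_) contDiff_deriv_smoothTransition.continuous continuous_zero
    have : smoothTransition =ᶠ[nhds s] fun _ ↦ 0 := by
      filter_upwards [Iio_mem_nhds hs] with x hx
      exact Real.smoothTransition.zero_of_nonpos (le_of_lt hx)
    simpa using this.deriv_eq
  rw [closure_Iio] at h
  exact h ht

lemma deriv_smoothTransition_of_one_lt {t : ℝ} (ht : 1 < t) : deriv smoothTransition t = 0 := by
  have : smoothTransition =ᶠ[nhds t] fun _ ↦ 1 := by
    filter_upwards [Ioi_mem_nhds ht] with x hx
    exact Real.smoothTransition.one_of_one_le (le_of_lt hx)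
  simpa using this.deriv_eq

/-- The velocity which dilates a set on which `V` is the identity by the factor
`smoothTransition t`. -/
def dilationField (V : ℝ × ℝ → ℝ × ℝ) (t : ℝ) (x : ℝ × ℝ) : ℝ × ℝ :=
  deriv smoothTransition t • V ((smoothTransition t)⁻¹ • x)

section DilationField

variable {V : ℝ × ℝ → ℝ × ℝ} {K : NNReal} {M : ℝ}

lemma dilationField_of_nonpos {t : ℝ} (ht : t ≤ 0) (x : ℝ × ℝ) : dilationField V t x = 0 := by
  rw [dilationField, deriv_smoothTransition_of_nonpos ht, zero_smul]

lemma dilationField_of_le_norm (hV0 : ∀ x, 1 ≤ ‖x‖ → V x = 0) {t : ℝ} {x : ℝ × ℝ}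
    (hx : smoothTransition t ≤ ‖x‖) : dilationField V t x = 0 := by
  rcases le_or_gt t 0 with ht | ht
  · exact dilationField_of_nonpos ht x
  have hp := Real.smoothTransition.pos_of_pos ht
  rw [dilationField, hV0, smul_zero]
  rw [norm_smul, norm_inv, Real.norm_of_nonneg hp.le, ← div_eq_inv_mul]
  exact (one_le_div hp).2 hx

lemma dilationField_smul {y : ℝ × ℝ} (hy : V y = y) (t : ℝ) :
    dilationField V t (smoothTransition t • y) = deriv smoothTransition t • y := by
  rcases le_or_gt t 0 with ht | ht
  · rw [dilationField_of_nonpos ht, deriv_smoothTransition_of_nonpos ht, zero_smul]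
  · rw [dilationField, inv_smul_smul₀ (Real.smoothTransition.pos_of_pos ht).ne', hy]

lemma exists_lipschitzOnWith_dilationField (hV : LipschitzWith K V) {p : ℝ × ℝ × ℝ}
    (hp : 0 < p.1) :
    ∃ C, ∃ s ∈ nhds p, LipschitzOnWith C (Function.uncurry (dilationField V)) s := by
  have hρ := Real.smoothTransition.pos_of_pos hp
  have h1 : ContDiffAt ℝ 1 (fun q : ℝ × ℝ × ℝ ↦ (smoothTransition q.1)⁻¹ • q.2) p :=
    ((Real.smoothTransition.contDiffAt.comp p contDiffAt_fst).inv hρ.ne').smul contDiffAt_snd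
  obtain ⟨C₁, s₁, hs₁, hL₁⟩ := h1.exists_lipschitzOnWith
  have hL₂ : LipschitzOnWith (max 1 (K * C₁))
      (fun q : ℝ × ℝ × ℝ ↦ (q, V ((smoothTransition q.1)⁻¹ • q.2))) s₁ :=
    (LipschitzWith.id.lipschitzOnWith (s := s₁)).prodMk (hV.comp_lipschitzOnWith hL₁)
  have hΦ : ContDiff ℝ 1 fun q : (ℝ × ℝ × ℝ) × (ℝ × ℝ) ↦ deriv smoothTransition q.1.1 • q.2 :=
    ((contDiff_deriv_smoothTransition.of_le (by norm_cast)).comp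
      (contDiff_fst.comp contDiff_fst)).smul contDiff_snd
  obtain ⟨C₂, s₂, hs₂, hL₃⟩ := (hΦ.contDiffAt
    (x := (p, V ((smoothTransition p.1)⁻¹ • p.2)))).exists_lipschitzOnWith
  have hg : ContinuousAt (fun q : ℝ × ℝ × ℝ ↦ (q, V ((smoothTransition q.1)⁻¹ • q.2))) p :=
    continuousAt_id.prodMk (hV.continuous.continuousAt.comp h1.continuousAt)
  have hcomp := LipschitzOnWith.comp hL₃ (hL₂.mono inter_subset_left)
    (s := s₁ ∩ (fun q : ℝ × ℝ × ℝ ↦ (q, V ((smoothTransition q.1)⁻¹ • q.2))) ⁻¹' s₂)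
    fun q hq ↦ hq.2
  exact ⟨C₂ * max 1 (K * C₁), _, Filter.inter_mem hs₁ (hg hs₂), fun a ha b hb ↦ hcomp ha hb⟩

lemma locallyLipschitzOn_dilationField (hV : LipschitzWith K V) (hV0 : ∀ x, 1 ≤ ‖x‖ → V x = 0) :
    LocallyLipschitzOn ((Ici (0 : ℝ) ×ˢ (univ : Set (ℝ × ℝ))) \ {(0, (0, 0))})
      (Function.uncurry (dilationField V)) := by
  rintro ⟨t, x⟩ ⟨⟨ht, -⟩, hne⟩
  rcases (show 0 ≤ t from ht).eq_or_lt with rfl | ht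
  · have hx : x ≠ 0 := by
      rintro rfl
      exact hne rfl
    refine ⟨0, {q | smoothTransition q.1 < ‖q.2‖}, mem_nhdsWithin_of_mem_nhds ?_, ?_⟩
    · refine (isOpen_lt (Real.smoothTransition.continuous.comp continuous_fst)
        continuous_snd.norm).mem_nhds ?_
      simpa using hx
    · intro a ha b hb
      change edist (dilationField V a.1 a.2) (dilationField V b.1 b.2) ≤ _
      rw [dilationField_of_le_norm hV0 (le_of_lt ha), dilationField_of_le_norm hV0 (le_of_lt hb)]
      simp
  · obtain ⟨C, s, hs, hL⟩ := exists_lipschitzOnWith_dilationField hV (p := (t, x)) ht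
    exact ⟨C, s, mem_nhdsWithin_of_mem_nhds hs, hL⟩

lemma continuous_dilationField (hV : LipschitzWith K V) (hM : ∀ x, ‖V x‖ ≤ M) :
    Continuous (Function.uncurry (dilationField V)) := by
  rw [continuous_iff_continuousAt]
  rintro ⟨t, x⟩
  rcases le_or_gt t 0 with ht | ht
  · have h0 : Function.uncurry (dilationField V) (t, x) = 0 := dilationField_of_nonpos ht x
    rw [ContinuousAt, h0]
    refine squeeze_zero_norm (a := fun q : ℝ × ℝ × ℝ ↦ ‖deriv smoothTransition q.1‖ * M)
      (fun q ↦ ?_) ?_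
    · change ‖dilationField V q.1 q.2‖ ≤ _
      rw [dilationField, norm_smul]
      gcongr
      exact hM _
    · have hc : Continuous fun q : ℝ × ℝ × ℝ ↦ ‖deriv smoothTransition q.1‖ * M :=
        (contDiff_deriv_smoothTransition.continuous.comp continuous_fst).norm.mul continuous_const
      simpa [deriv_smoothTransition_of_nonpos ht] using hc.tendsto (t, x)
  · obtain ⟨C, s, hs, hL⟩ := exists_lipschitzOnWith_dilationField hV (p := (t, x)) ht
    exact hL.continuousOn.continuousAt hs

lemma hasCompactSupport_dilationField (hV0 : ∀ x, 1 ≤ ‖x‖ → V x = 0) :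
    HasCompactSupport (Function.uncurry (dilationField V)) := by
  refine HasCompactSupport.intro (isCompact_Icc (a := (0 : ℝ)) (b := 1) |>.prod
    (isCompact_closedBall (0 : ℝ × ℝ) 1)) ?_
  rintro ⟨t, x⟩ hq
  by_contra hne
  refine hq ⟨⟨?_, ?_⟩, mem_closedBall_zero_iff.2 ?_⟩
  · by_contra! ht
    exact hne (dilationField_of_nonpos ht.le x)
  · by_contra! ht
    exact hne (by simp [dilationField, deriv_smoothTransition_of_one_lt ht])
  · by_contra! hx
    exact hne (dilationField_of_le_norm hV0 ((Real.smoothTransition.le_one t).trans hx.le))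

lemma weakDivFreeAt_dilationField (hdiv : WeakDivFree V) (t : ℝ) :
    WeakDivFreeAt (dilationField V) t := by
  intro ψ hψ hc
  rcases le_or_gt t 0 with ht | ht
  · simp [dilationField_of_nonpos ht, dot2]
  have hρ := Real.smoothTransition.pos_of_pos ht
  have heq : dilationField V t = (deriv smoothTransition t * (smoothTransition t)⁻¹) •
      rescale (smoothTransition t) 0 V := by
    funext x
    rw [Pi.smul_apply, rescale, smul_smul, inv_mul_cancel_right₀ hρ.ne', sub_zero, dilationField]
  rw [heq]
  exact (hdiv.rescale hρ 0).const_smul _ ψ hψ hc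

end DilationField

/-- Distribution at time `t` of points `y n` with random `n`, dilated by `smoothTransition t`. -/
def dilatedMeasure (P : Measure ℕ) (y : ℕ → ℝ × ℝ) (t : ℝ) : Measure (ℝ × ℝ) :=
  P.map fun n ↦ smoothTransition t • y n

lemma integral_dilatedMeasure (P : Measure ℕ) (y : ℕ → ℝ × ℝ) (t : ℝ) {f : ℝ × ℝ → ℝ}
    (hf : Continuous f) :
    ∫ x, f x ∂(dilatedMeasure P y t) = ∫ n, f (smoothTransition t • y n) ∂P :=
  integral_map (measurable_from_nat).aemeasurable hf.aestronglyMeasurable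

lemma weaklyAdvected_dilatedMeasure {V : ℝ × ℝ → ℝ × ℝ} {K : NNReal} {M : ℝ}
    (hV : LipschitzWith K V) (hM : ∀ x, ‖V x‖ ≤ M) (P : Measure ℕ) [IsProbabilityMeasure P]
    {y : ℕ → ℝ × ℝ} (hy : ∀ n, V (y n) = y n) {T : ℝ} (hT : 0 < T) :
    WeaklyAdvected T (dilationField V) (dilatedMeasure P y) := by
  intro φ hφ hc
  have hu := continuous_dilationField hV hM
  set Φ := Function.uncurry φ
  have hdΦ : Continuous (fderiv ℝ Φ) := hφ.continuous_fderiv (by simp)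
  have hdiff : Differentiable ℝ Φ := hφ.differentiable (by simp)
  obtain ⟨B, hB⟩ := (hc.fderiv (𝕜 := ℝ)).exists_bound_of_continuous hdΦ
  have hB0 : 0 ≤ B := (norm_nonneg _).trans (hB 0)
  have hφt : ∀ t, ContDiff ℝ (⊤ : ℕ∞) (φ t) := fun t ↦ hφ.comp (contDiff_prodMk_right t)
  have htime : ∀ t x, deriv (fun s ↦ φ s x) t = fderiv ℝ Φ (t, x) (1, 0) := fun t x ↦
    (HasFDerivAt.comp_hasDerivAt (f := fun s ↦ (s, x)) t (hdiff (t, x)).hasFDerivAt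
      ((hasDerivAt_id t).prodMk (hasDerivAt_const t x))).deriv
  have hspace : ∀ t x v, dot2 v (grad2 (φ t) x) = fderiv ℝ Φ (t, x) (0, v) := by
    intro t x v
    have h1 : fderiv ℝ (φ t) x = (fderiv ℝ Φ (t, x)).comp (ContinuousLinearMap.inr ℝ ℝ (ℝ × ℝ)) :=
      ((hdiff (t, x)).hasFDerivAt.comp x (hasFDerivAt_prodMk_right t x)).fderiv
    have h2 : v = v.1 • ((1 : ℝ), (0 : ℝ)) + v.2 • ((0 : ℝ), (1 : ℝ)) := by ext <;> simp
    have h3 : fderiv ℝ Φ (t, x) (0, v) = fderiv ℝ (φ t) x v := by rw [h1]; simp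
    rw [h3]
    nth_rw 2 [h2]
    simp only [map_add, map_smul, dot2, grad2, smul_eq_mul]
  let path : ℕ → ℝ → ℝ × ℝ × ℝ := fun n t ↦ (t, smoothTransition t • y n)
  have hpath : ∀ n, Continuous (path n) := fun n ↦
    continuous_id.prodMk (Real.smoothTransition.continuous.smul continuous_const)
  have hcu : ∀ t, Continuous (dilationField V t) := fun t ↦ hu.comp (Continuous.prodMk_right t)
  have hcg : Continuous (deriv smoothTransition) := contDiff_deriv_smoothTransition.continuous
  obtain ⟨G, hG⟩ : ∃ G, ∀ t ∈ Icc 0 T, ‖deriv smoothTransition t‖ ≤ G :=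
    isCompact_Icc.exists_bound_of_continuousOn hcg.continuousOn
  let F₁ : ℕ → ℝ → ℝ := fun n t ↦ fderiv ℝ Φ (path n t) (1, 0)
  let F₂ : ℕ → ℝ → ℝ := fun n t ↦ fderiv ℝ Φ (path n t) (0, deriv smoothTransition t • y n)
  have hF₁ : ∀ n, Continuous (F₁ n) := fun n ↦ by
    have := hdΦ.comp (hpath n)
    exact this.clm_apply continuous_const
  have hF₂ : ∀ n, Continuous (F₂ n) := fun n ↦ by
    have := hdΦ.comp (hpath n)
    exact this.clm_apply (continuous_const.prodMk (hcg.smul continuous_const))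
  have e₁ : ∀ t, ∫ x, deriv (fun s ↦ φ s x) t ∂(dilatedMeasure P y t) = ∫ n, F₁ n t ∂P := by
    intro t
    simp_rw [htime]
    exact integral_dilatedMeasure P y t
      ((hdΦ.comp (Continuous.prodMk_right t)).clm_apply continuous_const)
  have e₂ : ∀ t, ∫ x, dot2 (dilationField V t x) (grad2 (φ t) x) ∂(dilatedMeasure P y t) =
      ∫ n, F₂ n t ∂P := by
    intro t
    simp_rw [hspace]
    refine (integral_dilatedMeasure P y t ((hdΦ.comp (Continuous.prodMk_right t)).clm_apply
      (continuous_const.prodMk (hcu t)))).trans ?_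
    simp only [dilationField_smul (hy _)]
    rfl
  have hintegr : ∀ F : ℕ → ℝ → ℝ, (∀ n, Continuous (F n)) → (∃ C, ∀ n, ∀ t ∈ Icc 0 T, ‖F n t‖ ≤ C) →
      Integrable (fun q : ℝ × ℕ ↦ F q.2 q.1) ((volume.restrict (Icc 0 T)).prod P) := by
    rintro F hF ⟨C, hC⟩
    have hcont : Continuous fun q : ℝ × ℕ ↦ F q.2 q.1 := by
      rw [continuous_prod_of_discrete_right]
      exact hF
    refine Integrable.of_bound hcont.aestronglyMeasurable C ?_
    have h1 : ∀ᵐ t ∂volume.restrict (Icc (0 : ℝ) T), t ∈ Icc 0 T :=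
      ae_restrict_mem measurableSet_Icc
    filter_upwards [Measure.quasiMeasurePreserving_fst.ae h1] with q hq using hC _ _ hq
  have hI₁ := hintegr F₁ hF₁ ⟨B, fun n t _ ↦ by
    refine ((fderiv ℝ Φ (path n t)).le_of_opNorm_le (hB _) _).trans_eq ?_
    simp⟩
  have hI₂ := hintegr F₂ hF₂ ⟨B * (G * M), fun n t ht ↦ by
    refine ((fderiv ℝ Φ (path n t)).le_of_opNorm_le (hB _) _).trans ?_
    have h1 : ‖((0 : ℝ), deriv smoothTransition t • y n)‖ = ‖deriv smoothTransition t‖ * ‖y n‖ := by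
      rw [Prod.norm_mk, norm_zero, norm_smul, max_eq_right (by positivity)]
    have h2 := hM (y n)
    rw [hy] at h2
    rw [h1]
    have := hG t ht
    have := (norm_nonneg _).trans this
    gcongr⟩
  have hderiv : ∀ n t, HasDerivAt (fun s ↦ φ s (smoothTransition s • y n)) (F₁ n t + F₂ n t) t := by
    intro n t
    have h1 : HasDerivAt (path n) (1, deriv smoothTransition t • y n) t :=
      (hasDerivAt_id t).prodMk
        (((Real.smoothTransition.contDiff (n := 1)).differentiable
          (by simp) t).hasDerivAt.smul_const _)
    have h2 := (hdiff (path n t)).hasFDerivAt.comp_hasDerivAt t h1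
    have h3 : F₁ n t + F₂ n t = fderiv ℝ Φ (path n t) (1, deriv smoothTransition t • y n) := by
      simp only [F₁, F₂]
      rw [← map_add]
      simp
    rw [h3]
    exact h2
  have hFTC : ∀ n, ∫ t in Icc 0 T, (F₁ n t + F₂ n t) = φ T (smoothTransition T • y n) - φ 0 0 := by
    intro n
    rw [integral_Icc_eq_integral_Ioc, ← intervalIntegral.integral_of_le hT.le,
      intervalIntegral.integral_eq_sub_of_hasDerivAt (fun t _ ↦ hderiv n t)
        (((hF₁ n).add (hF₂ n)).intervalIntegrable _ _)]
    simp
  have hsum : (∫ t in Icc 0 T, ∫ n, F₁ n t ∂P) + (∫ t in Icc 0 T, ∫ n, F₂ n t ∂P) =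
      (∫ n, φ T (smoothTransition T • y n) ∂P) - φ 0 0 := by
    obtain ⟨C, hC⟩ := hc.exists_bound_of_continuous hφ.continuous
    have hT' : Integrable (fun n ↦ φ T (smoothTransition T • y n)) P :=
      .of_bound (measurable_from_nat).aestronglyMeasurable C (.of_forall fun n ↦ hC (T, _))
    have hadd := integral_integral_add hI₁ hI₂
    rw [← hadd, integral_integral_swap (f := fun t n ↦ F₁ n t + F₂ n t) (hI₁.add hI₂)]
    simp_rw [hFTC]
    rw [integral_sub hT' (integrable_const _)]
    simp
  simp_rw [e₁, e₂]
  rw [integral_dilatedMeasure P y T (hφt T).continuous,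
    integral_dilatedMeasure P y 0 (hφt 0).continuous]
  simp only [Real.smoothTransition.zero, zero_smul, integral_const, probReal_univ,
    one_smul]
  linarith

lemma mSupp_map {P : Measure ℕ} (hP : ∀ n, P {n} ≠ 0) (f : ℕ → ℝ × ℝ) :
    mSupp (P.map f) = closure (range f) := by
  ext x
  rw [mem_closure_iff_nhds]
  constructor
  · intro hx U hU
    obtain ⟨W, hWU, hW, hxW⟩ := mem_nhds_iff.1 hU
    have h1 := hx W (hW.mem_nhds hxW)
    rw [Measure.map_apply measurable_from_nat hW.measurableSet] at h1
    obtain ⟨n, hn⟩ := nonempty_of_measure_ne_zero h1.ne'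
    exact ⟨f n, hWU hn, mem_range_self n⟩
  · intro hx U hU
    obtain ⟨_, hnU, n, rfl⟩ := hx U hU
    have h1 : P {n} ≤ P (f ⁻¹' U) := measure_mono (singleton_subset_iff.2 hnU)
    exact (pos_iff_ne_zero.2 (hP n)).trans_le
      (h1.trans (Measure.le_map_apply measurable_from_nat.aemeasurable U))

lemma exists_isProbabilityMeasure_nat_singleton_ne_zero :
    ∃ P : Measure ℕ, IsProbabilityMeasure P ∧ ∀ n, P {n} ≠ 0 := by
  refine ⟨Measure.sum fun n ↦ (2⁻¹ : ENNReal) ^ (n + 1) • Measure.dirac n, ⟨?_⟩, fun n h0 ↦ ?_⟩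
  · rw [Measure.sum_apply _ MeasurableSet.univ]
    simp [ENNReal.tsum_geometric_add_one, ENNReal.one_sub_inv_two]
    exact ENNReal.inv_mul_cancel (by norm_num) (by norm_num)
  · have h1 := (Measure.le_sum (fun n ↦ (2⁻¹ : ENNReal) ^ (n + 1) • Measure.dirac n) n) {n}
    rw [h0] at h1
    simp at h1

lemma dimH_mSupp_dilatedMeasure {P : Measure ℕ} (hP : ∀ n, P {n} ≠ 0) (y : ℕ → ℝ × ℝ) {t : ℝ}
    (ht : 0 < t) : dimH (mSupp (dilatedMeasure P y t)) = dimH (closure (range y)) := by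
  have hρ := (Real.smoothTransition.pos_of_pos ht).ne'
  let e : (ℝ × ℝ) ≃L[ℝ] (ℝ × ℝ) := ContinuousLinearEquiv.smulLeft (Units.mk0 _ hρ)
  have h1 : range (fun n ↦ smoothTransition t • y n) = e '' range y := by
    rw [← range_comp]
    rfl
  rw [dilatedMeasure, mSupp_map hP, h1, ← e.image_closure, e.dimH_image]

/-- For every `h ∈ (1,2)` there are a bounded, uniformly continuous,
compactly supported, weakly divergence-free velocity `u` on `[0,∞) × ℝ²`, locally
Lipschitz away from the space-time point `(0,(0,0))`, and a family of finite Borel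
measures `ω t` with `ω 0 = δ₀`, weakly advected by `u` on every `[0,T]`, whose support
has Hausdorff dimension `h` for every `t > 0`. -/
theorem statement0 :
    ∀ h : ℝ, h ∈ Ioo (1 : ℝ) 2 →
    ∃ (u : ℝ → ℝ × ℝ → ℝ × ℝ) (ω : ℝ → Measure (ℝ × ℝ)),
      (∃ C : ℝ, ∀ t ∈ Ici (0 : ℝ), ∀ x, ‖u t x‖ ≤ C) ∧
      UniformContinuousOn (Function.uncurry u) (Ici (0 : ℝ) ×ˢ (univ : Set (ℝ × ℝ))) ∧
      HasCompactSupport (Function.uncurry u) ∧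
      (∀ t ∈ Ici (0 : ℝ), WeakDivFreeAt u t) ∧
      LocallyLipschitzOn
        ((Ici (0 : ℝ) ×ˢ (univ : Set (ℝ × ℝ))) \ {((0 : ℝ), ((0 : ℝ), (0 : ℝ)))})
        (Function.uncurry u) ∧
      (∀ t ∈ Ici (0 : ℝ), IsFiniteMeasure (ω t)) ∧
      ω 0 = Measure.dirac ((0 : ℝ), (0 : ℝ)) ∧
      mSupp (ω 0) = {((0 : ℝ), (0 : ℝ))} ∧
      (∀ T : ℝ, 0 < T → WeaklyAdvected T u ω) ∧
      (∀ t : ℝ, 0 < t → dimH (mSupp (ω t)) = ENNReal.ofReal h) := by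
  intro h hh
  have h1 : 1 < h := hh.1
  have hpos : 0 < h := by linarith
  set r : ℝ := (1 / 4) ^ h⁻¹
  have hr : 0 < r := by positivity
  have hrh : r ^ h = 1 / 4 := Real.rpow_inv_rpow (by norm_num) hpos.ne'
  have hr2 : r < 1 / 2 := by
    by_contra! hle
    have h2 : (1 / 2 : ℝ) ^ (2 : ℝ) < (1 / 2 : ℝ) ^ h :=
      Real.rpow_lt_rpow_of_exponent_gt (by norm_num) (by norm_num) hh.2
    have h3 := Real.rpow_le_rpow (by norm_num) hle hpos.le
    rw [hrh] at h3
    norm_num at h2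
    linarith
  obtain ⟨V, K, M, hV, hM, hV0, hdiv, hfix⟩ := exists_field_eq_self_on_cantor hr hr2
  obtain ⟨P, hP, hP0⟩ := exists_isProbabilityMeasure_nat_singleton_ne_zero
  let y : ℕ → ℝ × ℝ := fun n ↦ cantorPoint r (TopologicalSpace.denseSeq (ℕ → Fin 4) n)
  have hclosure : closure (range y) = range (cantorPoint r) := by
    have hcont := continuous_cantorPoint hr hr2
    refine (closure_minimal ?_ (isCompact_range hcont).isClosed).antisymm ?_
    · rintro _ ⟨n, rfl⟩
      exact mem_range_self _
    · exact hcont.range_subset_closure_image_dense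
        (TopologicalSpace.denseRange_denseSeq (ℕ → Fin 4)) |>.trans
        (closure_mono (by rw [← range_comp]; rfl))
  have hu := continuous_dilationField hV hM
  have hcs := hasCompactSupport_dilationField hV0
  have h0 : dilatedMeasure P y 0 = Measure.dirac ((0 : ℝ), (0 : ℝ)) := by
    have : (fun n ↦ Real.smoothTransition 0 • y n) = fun _ ↦ ((0 : ℝ), (0 : ℝ)) := by
      funext n
      simp
      rfl
    rw [dilatedMeasure, this, Measure.map_const, measure_univ, one_smul]
  refine ⟨dilationField V, dilatedMeasure P y, ?_, ?_, hcs,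
    fun t _ ↦ weakDivFreeAt_dilationField hdiv t, locallyLipschitzOn_dilationField hV hV0,
    fun t _ ↦ by unfold dilatedMeasure; infer_instance, h0, ?_,
    fun T hT ↦ weaklyAdvected_dilatedMeasure hV hM P (fun n ↦ hfix _) hT, fun t ht ↦ ?_⟩
  · obtain ⟨C, hC⟩ := hcs.exists_bound_of_continuous hu
    exact ⟨C, fun t _ x ↦ hC (t, x)⟩
  · exact (hcs.uniformContinuous_of_continuous hu).uniformContinuousOn
  · have h2 : range (fun n ↦ Real.smoothTransition 0 • y n) = {((0 : ℝ), (0 : ℝ))} := by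
      simp
      rfl
    rw [dilatedMeasure, mSupp_map hP0, h2, closure_singleton]
  · rw [dimH_mSupp_dilatedMeasure hP0 y ht, hclosure, dimH_range_cantorPoint hr hr2 hpos hrh]

end
end

section
/- There exist a velocity field u : [0,∞)×ℝ² → ℝ² and a family of finite Borel measures ω(t) on ℝ² (t ≥ 0) such that: u is bounded and uniformly continuous on [0,∞)×ℝ², u has compact support, u is weakly divergence free, u is locally Lipschitz on [0,∞)×(ℝ² \ {(0,0)}); ω(0) is the Dirac measure at the origin, so supp ω(0) = {(0,0)}; ω is weakly advected by u on [0,T] for every T > 0; and the Hausdorff dimension of supp ω(t) equals 2 for every t > 0. -/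
open MeasureTheory Set

noncomputable section

/-! ### The smooth ramp and its derivative -/

lemma contDiff_deriv_ramp {n : ℕ∞} : ContDiff ℝ n (deriv Real.smoothTransition) := by
  have h : ContDiff ℝ (⊤ : ℕ∞) (deriv Real.smoothTransition) :=
    (contDiff_infty_iff_deriv.1 Real.smoothTransition.contDiff).2
  exact h.of_le (by exact_mod_cast le_top)

lemma hasDerivAt_ramp (s : ℝ) :
    HasDerivAt Real.smoothTransition (deriv Real.smoothTransition s) s :=
  ((Real.smoothTransition.contDiff (n := 1)).differentiable (by norm_num) s).hasDerivAt

lemma deriv_ramp_of_nonpos {s : ℝ} (hs : s ≤ 0) : deriv Real.smoothTransition s = 0 := by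
  have hc : Continuous (deriv Real.smoothTransition) :=
    (contDiff_deriv_ramp (n := 0)).continuous
  have h : Set.EqOn (deriv Real.smoothTransition) 0 (Iio 0) := by
    intro x hx
    have : Real.smoothTransition =ᶠ[nhds x] fun _ => 0 := by
      filter_upwards [Iio_mem_nhds hx] with y hy
      exact Real.smoothTransition.zero_of_nonpos (le_of_lt hy)
    simpa using this.deriv_eq
  have h2 := h.closure hc continuous_const
  rw [closure_Iio] at h2
  exact h2 hs

lemma deriv_ramp_of_one_le {s : ℝ} (hs : 1 ≤ s) : deriv Real.smoothTransition s = 0 := by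
  have hc : Continuous (deriv Real.smoothTransition) :=
    (contDiff_deriv_ramp (n := 0)).continuous
  have h : Set.EqOn (deriv Real.smoothTransition) 0 (Ioi 1) := by
    intro x hx
    have : Real.smoothTransition =ᶠ[nhds x] fun _ => 1 := by
      filter_upwards [Ioi_mem_nhds hx] with y hy
      exact Real.smoothTransition.one_of_one_le (le_of_lt hy)
    simpa using this.deriv_eq
  have h2 := h.closure hc continuous_const
  rw [closure_Ioi] at h2
  exact h2 hs

lemma exists_deriv_ramp_bound : ∃ M : ℝ, 1 ≤ M ∧ ∀ s, |deriv Real.smoothTransition s| ≤ M := by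
  have hc : Continuous (deriv Real.smoothTransition) :=
    (contDiff_deriv_ramp (n := 0)).continuous
  obtain ⟨M, hM⟩ := (isCompact_Icc (a := (0 : ℝ)) (b := 1)).exists_bound_of_continuousOn
    hc.continuousOn
  refine ⟨max M 1, le_max_right _ _, fun s => ?_⟩
  by_cases h : s ∈ Icc (0 : ℝ) 1
  · exact (hM s h).trans (le_max_left _ _)
  · have : deriv Real.smoothTransition s = 0 := by
      by_cases h0 : s ≤ 0
      · exact deriv_ramp_of_nonpos h0
      · refine deriv_ramp_of_one_le ?_
        by_contra h1
        exact h ⟨by linarith, by linarith⟩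
    rw [this]
    simp

/-- A bound, at least one, for the derivative of the smooth ramp. -/
def rampBound : ℝ := exists_deriv_ramp_bound.choose

lemma one_le_rampBound : 1 ≤ rampBound := exists_deriv_ramp_bound.choose_spec.1

lemma abs_deriv_ramp_le (s : ℝ) : |deriv Real.smoothTransition s| ≤ rampBound :=
  exists_deriv_ramp_bound.choose_spec.2 s

lemma abs_ramp_le (s : ℝ) : |Real.smoothTransition s| ≤ 1 := by
  rw [abs_of_nonneg (Real.smoothTransition.nonneg s)]
  exact Real.smoothTransition.le_one s

/-! ### Cutoffs -/

/-- A smooth cutoff, equal to `1` on `[-1, 1]` and vanishing outside `[-2, 2]`. -/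
def cutoff (s : ℝ) : ℝ := Real.smoothTransition (2 - s) * Real.smoothTransition (2 + s)

/-- The derivative of `cutoff`. -/
def cutoff' (s : ℝ) : ℝ :=
  -deriv Real.smoothTransition (2 - s) * Real.smoothTransition (2 + s)
    + Real.smoothTransition (2 - s) * deriv Real.smoothTransition (2 + s)

/-- The derivative of `s * cutoff s`. -/
def cutSlope (s : ℝ) : ℝ := cutoff s + s * cutoff' s

lemma contDiff_cutoff {n : ℕ∞} : ContDiff ℝ n cutoff :=
  (Real.smoothTransition.contDiff.comp (contDiff_const.sub contDiff_id)).mul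
    (Real.smoothTransition.contDiff.comp (contDiff_const.add contDiff_id))

lemma contDiff_cutoff' {n : ℕ∞} : ContDiff ℝ n cutoff' :=
  ((contDiff_deriv_ramp.comp (contDiff_const.sub contDiff_id)).neg.mul
    (Real.smoothTransition.contDiff.comp (contDiff_const.add contDiff_id))).add
  ((Real.smoothTransition.contDiff.comp (contDiff_const.sub contDiff_id)).mul
    (contDiff_deriv_ramp.comp (contDiff_const.add contDiff_id)))

lemma contDiff_cutSlope {n : ℕ∞} : ContDiff ℝ n cutSlope :=
  contDiff_cutoff.add (contDiff_id.mul contDiff_cutoff')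

lemma hasDerivAt_cutoff (s : ℝ) : HasDerivAt cutoff (cutoff' s) s := by
  have h1 : HasDerivAt (fun s : ℝ => Real.smoothTransition (2 - s))
      (-deriv Real.smoothTransition (2 - s)) s := by
    simpa [Function.comp_def] using (hasDerivAt_ramp (2 - s)).comp s ((hasDerivAt_id s).const_sub 2)
  have h2 : HasDerivAt (fun s : ℝ => Real.smoothTransition (2 + s))
      (deriv Real.smoothTransition (2 + s)) s := by
    simpa [Function.comp_def] using (hasDerivAt_ramp (2 + s)).comp s ((hasDerivAt_id s).const_add 2)
  exact h1.mul h2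

lemma hasDerivAt_mul_cutoff (s : ℝ) : HasDerivAt (fun s => s * cutoff s) (cutSlope s) s := by
  simpa [cutSlope] using (hasDerivAt_id' s).fun_mul (hasDerivAt_cutoff s)

lemma cutoff_of_abs_le {s : ℝ} (hs : |s| ≤ 1) : cutoff s = 1 := by
  have := abs_le.1 hs
  rw [cutoff, Real.smoothTransition.one_of_one_le (by linarith),
    Real.smoothTransition.one_of_one_le (by linarith), one_mul]

lemma cutoff'_of_abs_le {s : ℝ} (hs : |s| ≤ 1) : cutoff' s = 0 := by
  have := abs_le.1 hs
  rw [cutoff', deriv_ramp_of_one_le (by linarith), deriv_ramp_of_one_le (by linarith)]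
  simp

lemma cutSlope_of_abs_le {s : ℝ} (hs : |s| ≤ 1) : cutSlope s = 1 := by
  rw [cutSlope, cutoff_of_abs_le hs, cutoff'_of_abs_le hs]
  simp

lemma cutoff_of_le_abs {s : ℝ} (hs : 2 ≤ |s|) : cutoff s = 0 := by
  rcases le_abs.1 hs with h | h
  · rw [cutoff, Real.smoothTransition.zero_of_nonpos (by linarith), zero_mul]
  · rw [cutoff, Real.smoothTransition.zero_of_nonpos (x := 2 + s) (by linarith), mul_zero]

lemma cutoff'_of_le_abs {s : ℝ} (hs : 2 ≤ |s|) : cutoff' s = 0 := by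
  rcases le_abs.1 hs with h | h
  · rw [cutoff', Real.smoothTransition.zero_of_nonpos (x := 2 - s) (by linarith),
      deriv_ramp_of_nonpos (s := 2 - s) (by linarith)]
    simp
  · rw [cutoff', Real.smoothTransition.zero_of_nonpos (x := 2 + s) (by linarith),
      deriv_ramp_of_nonpos (s := 2 + s) (by linarith)]
    simp

lemma cutSlope_of_le_abs {s : ℝ} (hs : 2 ≤ |s|) : cutSlope s = 0 := by
  rw [cutSlope, cutoff_of_le_abs hs, cutoff'_of_le_abs hs]
  simp

lemma abs_cutoff_le (s : ℝ) : |cutoff s| ≤ 1 := by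
  rw [cutoff, abs_mul]
  exact mul_le_one₀ (abs_ramp_le _) (abs_nonneg _) (abs_ramp_le _)

lemma abs_cutoff'_le (s : ℝ) : |cutoff' s| ≤ 2 * rampBound := by
  rw [cutoff']
  refine (abs_add_le _ _).trans ?_
  rw [abs_mul, abs_mul, abs_neg]
  have h1 := mul_le_mul (abs_deriv_ramp_le (2 - s)) (abs_ramp_le (2 + s)) (abs_nonneg _)
    (by linarith [one_le_rampBound])
  have h2 := mul_le_mul (abs_ramp_le (2 - s)) (abs_deriv_ramp_le (2 + s)) (abs_nonneg _)
    zero_le_one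
  linarith

lemma abs_mul_cutoff_le (s : ℝ) : |s * cutoff s| ≤ 2 := by
  by_cases h : 2 ≤ |s|
  · simp [cutoff_of_le_abs h]
  · rw [abs_mul]
    nlinarith [abs_cutoff_le s, abs_nonneg s, abs_nonneg (cutoff s)]

lemma abs_cutSlope_le (s : ℝ) : |cutSlope s| ≤ 5 * rampBound := by
  by_cases h : 2 ≤ |s|
  · rw [cutSlope_of_le_abs h]
    simp only [abs_zero]
    linarith [one_le_rampBound]
  · rw [cutSlope]
    refine (abs_add_le _ _).trans ?_
    rw [abs_mul]
    have := one_le_rampBound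
    have h1 : |s| * |cutoff' s| ≤ 2 * (2 * rampBound) :=
      mul_le_mul (by linarith) (abs_cutoff'_le s) (abs_nonneg _) (by norm_num)
    linarith [abs_cutoff_le s]

/-! ### A smooth staircase -/

/-- A smooth staircase, equal to `n` on `[n, n + 1 - δ]` for `0 ≤ n < N`. -/
def stair (N : ℕ) (δ : ℝ) (ξ : ℝ) : ℝ :=
  ∑ n ∈ Finset.range N, Real.smoothTransition ((ξ - (n + 1)) / δ + 1)

/-- The derivative of `stair N δ`. -/
def stair' (N : ℕ) (δ : ℝ) (ξ : ℝ) : ℝ :=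
  ∑ n ∈ Finset.range N, deriv Real.smoothTransition ((ξ - (n + 1)) / δ + 1) / δ

lemma contDiff_stair {m : ℕ∞} (N : ℕ) (δ : ℝ) : ContDiff ℝ m (stair N δ) := by
  refine ContDiff.sum fun n _ => Real.smoothTransition.contDiff.comp ?_
  fun_prop

lemma contDiff_stair' {m : ℕ∞} (N : ℕ) (δ : ℝ) : ContDiff ℝ m (stair' N δ) := by
  refine ContDiff.sum fun n _ => (contDiff_deriv_ramp.comp ?_).div_const _
  fun_prop

lemma hasDerivAt_stair (N : ℕ) (δ ξ : ℝ) : HasDerivAt (stair N δ) (stair' N δ ξ) ξ := by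
  refine HasDerivAt.fun_sum fun n _ => ?_
  have h : HasDerivAt (fun ξ : ℝ => (ξ - (n + 1)) / δ + 1) (1 / δ) ξ :=
    (((hasDerivAt_id ξ).sub_const _).div_const _).add_const _
  simpa [div_eq_mul_inv, Function.comp_def] using (hasDerivAt_ramp _).comp ξ h

lemma abs_stair_le (N : ℕ) (δ ξ : ℝ) : |stair N δ ξ| ≤ N := by
  refine (Finset.abs_sum_le_sum_abs _ _).trans ?_
  refine (Finset.sum_le_sum fun n _ => abs_ramp_le _).trans ?_
  simp

lemma abs_stair'_le (N : ℕ) {δ : ℝ} (hδ : 0 < δ) (hδ1 : δ ≤ 1) (ξ : ℝ) :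
    |stair' N δ ξ| ≤ rampBound / δ := by
  have hM := one_le_rampBound
  have hzero : ∀ n : ℕ, (n : ℤ) + 1 ≠ ⌈ξ⌉ →
      deriv Real.smoothTransition ((ξ - (n + 1)) / δ + 1) / δ = 0 := by
    intro n hn
    rcases lt_or_gt_of_ne hn with h | h
    · have h' : ((n + 1 : ℤ) : ℝ) < ξ := Int.lt_ceil.1 h
      push_cast at h'
      rw [deriv_ramp_of_one_le, zero_div]
      have : 0 ≤ (ξ - (n + 1)) / δ := div_nonneg (by linarith) hδ.le
      linarith
    · have h' : ξ ≤ ((n : ℤ) : ℝ) := Int.ceil_le.1 (by omega)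
      push_cast at h'
      rw [deriv_ramp_of_nonpos, zero_div]
      have : (ξ - (n + 1)) / δ ≤ -1 := by
        rw [div_le_iff₀ hδ]
        linarith
      linarith
  have hB : 0 ≤ rampBound / δ := by positivity
  have hterm : ∀ n : ℕ, |deriv Real.smoothTransition ((ξ - (n + 1)) / δ + 1) / δ|
      ≤ rampBound / δ := by
    intro n
    rw [abs_div, abs_of_pos hδ]
    gcongr
    exact abs_deriv_ramp_le _
  rw [stair']
  by_cases h : ∃ n : ℕ, (n : ℤ) + 1 = ⌈ξ⌉
  · obtain ⟨n, hn⟩ := h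
    have hs := Finset.sum_eq_ite (s := Finset.range N)
      (f := fun n : ℕ => deriv Real.smoothTransition ((ξ - (n + 1)) / δ + 1) / δ) n
      (fun k _ hk => hzero k (by omega))
    rw [hs]
    split_ifs
    · exact hterm n
    · simpa using hB
  · rw [Finset.sum_eq_zero fun n _ => hzero n fun hn => h ⟨n, hn⟩]
    simpa using hB

lemma stair_eq {N n : ℕ} {δ ξ : ℝ} (hδ : 0 < δ) (hn : n < N) (h1 : n ≤ ξ)
    (h2 : ξ ≤ n + 1 - δ) : stair N δ ξ = n ∧ stair' N δ ξ = 0 := by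
  have key : ∀ k : ℕ, (k < n → 1 ≤ (ξ - (k + 1)) / δ + 1) ∧
      (n ≤ k → (ξ - (k + 1)) / δ + 1 ≤ 0) := by
    intro k
    refine ⟨fun hk => ?_, fun hk => ?_⟩
    · have : (k : ℝ) + 1 ≤ n := by exact_mod_cast hk
      have : 0 ≤ (ξ - (k + 1)) / δ := div_nonneg (by linarith) hδ.le
      linarith
    · have : (n : ℝ) ≤ k := by exact_mod_cast hk
      have : (ξ - (k + 1)) / δ ≤ -1 := by
        rw [div_le_iff₀ hδ]
        linarith
      linarith
  constructor
  · have : ∀ k ∈ Finset.range N, Real.smoothTransition ((ξ - (k + 1)) / δ + 1)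
        = if k < n then 1 else 0 := by
      intro k _
      split_ifs with hk
      · exact Real.smoothTransition.one_of_one_le ((key k).1 hk)
      · exact Real.smoothTransition.zero_of_nonpos ((key k).2 (not_lt.1 hk))
    rw [stair, Finset.sum_congr rfl this, ← Finset.sum_filter]
    have : (Finset.range N).filter (· < n) = Finset.range n := by
      ext k
      simp only [Finset.mem_filter, Finset.mem_range]
      omega
    rw [this]
    simp
  · refine Finset.sum_eq_zero fun k _ => ?_
    rcases lt_or_ge k n with hk | hk
    · rw [deriv_ramp_of_one_le ((key k).1 hk), zero_div]
    · rw [deriv_ramp_of_nonpos ((key k).2 hk), zero_div]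

/-! ### Scales of the construction -/

/-- The diameter of the cloud of particles at the end of stage `j`. -/
def amp (j : ℕ) : ℝ := 1 / ((j : ℝ) + 1) ^ 5

/-- The growth of the cloud during stage `j`. -/
def jump (j : ℕ) : ℝ := amp j - amp (j + 1)

/-- Progress of stage `j`, which takes place for `1 / (j + 2) ≤ t ≤ 1 / (j + 1)`. -/
def clock (j : ℕ) (t : ℝ) : ℝ :=
  Real.smoothTransition (((j : ℝ) + 1) * (j + 2) * t - (j + 1))

/-- The derivative of `clock j`. -/
def clock' (j : ℕ) (t : ℝ) : ℝ :=
  deriv Real.smoothTransition (((j : ℝ) + 1) * (j + 2) * t - (j + 1)) * ((j + 1) * (j + 2))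

/-- The diameter of the cloud during stage `j`. -/
def height (j : ℕ) (t : ℝ) : ℝ := amp (j + 1) + jump j * clock j t

/-- The relative size of the gaps between blocks during stage `j`. -/
def gapRatio (j : ℕ) : ℝ := jump (j + 1) / (2 * amp j)

lemma amp_pos (j : ℕ) : 0 < amp j := by
  rw [amp]
  positivity

lemma le_jump (j : ℕ) : 1 / ((j : ℝ) + 2) ^ 6 ≤ jump j := by
  rw [jump, amp, amp, ← sub_nonneg]
  push_cast
  have : 1 / ((j : ℝ) + 1) ^ 5 - 1 / ((j : ℝ) + 1 + 1) ^ 5 - 1 / ((j : ℝ) + 2) ^ 6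
      = (((j : ℝ) + 2) ^ 6 - ((j : ℝ) + 3) * ((j : ℝ) + 1) ^ 5)
        / (((j : ℝ) + 1) ^ 5 * ((j : ℝ) + 2) ^ 6) := by
    field_simp
    ring
  rw [this]
  refine div_nonneg ?_ (by positivity)
  ring_nf
  positivity

lemma jump_pos (j : ℕ) : 0 < jump j := lt_of_lt_of_le (by positivity) (le_jump j)

lemma jump_le_amp (j : ℕ) : jump j ≤ amp j := by
  rw [jump]
  linarith [amp_pos (j + 1)]

lemma amp_succ_le (j : ℕ) : amp (j + 1) ≤ amp j := by
  linarith [jump_pos j, jump.eq_1 j]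

lemma amp_le_one (j : ℕ) : amp j ≤ 1 := by
  rw [amp]
  exact div_le_one_of_le₀ (one_le_pow₀ (by linarith [Nat.cast_nonneg (α := ℝ) j]))
    (by positivity)

lemma gapRatio_pos (j : ℕ) : 0 < gapRatio j :=
  div_pos (jump_pos _) (mul_pos two_pos (amp_pos _))

lemma gapRatio_le_one (j : ℕ) : gapRatio j ≤ 1 := by
  have := amp_pos j
  rw [gapRatio, div_le_one (by linarith)]
  linarith [jump_le_amp (j + 1), amp_succ_le j]

lemma clock_nonneg (j : ℕ) (t : ℝ) : 0 ≤ clock j t := Real.smoothTransition.nonneg _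

lemma clock_le_one (j : ℕ) (t : ℝ) : clock j t ≤ 1 := Real.smoothTransition.le_one _

lemma clock_eq_zero {j : ℕ} {t : ℝ} (h : (j + 2) * t ≤ 1) : clock j t = 0 :=
  Real.smoothTransition.zero_of_nonpos (by nlinarith [Nat.cast_nonneg (α := ℝ) j])

lemma clock_eq_one {j : ℕ} {t : ℝ} (h : 1 ≤ (j + 1) * t) : clock j t = 1 :=
  Real.smoothTransition.one_of_one_le (by nlinarith [Nat.cast_nonneg (α := ℝ) j])

lemma stage_of_clock'_ne_zero {j : ℕ} {t : ℝ} (h : clock' j t ≠ 0) :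
    1 < (j + 2) * t ∧ (j + 1) * t < 1 := by
  constructor
  · by_contra hc
    refine h ?_
    rw [clock', deriv_ramp_of_nonpos (by nlinarith [Nat.cast_nonneg (α := ℝ) j]), zero_mul]
  · by_contra hc
    refine h ?_
    rw [clock', deriv_ramp_of_one_le (by nlinarith [Nat.cast_nonneg (α := ℝ) j]), zero_mul]

lemma hasDerivAt_clock (j : ℕ) (t : ℝ) : HasDerivAt (clock j) (clock' j t) t := by
  have h : HasDerivAt (fun t : ℝ => ((j : ℝ) + 1) * (j + 2) * t - (j + 1))
      (((j : ℝ) + 1) * (j + 2)) t := by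
    simpa using ((hasDerivAt_id t).const_mul (((j : ℝ) + 1) * (j + 2))).sub_const ((j : ℝ) + 1)
  exact (hasDerivAt_ramp _).comp t h

lemma contDiff_clock {n : ℕ∞} (j : ℕ) : ContDiff ℝ n (clock j) := by
  refine Real.smoothTransition.contDiff.comp ?_
  fun_prop

lemma contDiff_clock' {n : ℕ∞} (j : ℕ) : ContDiff ℝ n (clock' j) := by
  refine (contDiff_deriv_ramp.comp ?_).mul contDiff_const
  fun_prop

lemma contDiff_height {n : ℕ∞} (j : ℕ) : ContDiff ℝ n (height j) :=
  contDiff_const.add (contDiff_const.mul (contDiff_clock j))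

lemma abs_clock'_le (j : ℕ) (t : ℝ) : |clock' j t| ≤ rampBound * ((j + 1) * (j + 2)) := by
  rw [clock', abs_mul, abs_of_nonneg (a := ((j : ℝ) + 1) * (j + 2)) (by positivity)]
  gcongr
  exact abs_deriv_ramp_le _

lemma amp_succ_le_height (j : ℕ) (t : ℝ) : amp (j + 1) ≤ height j t := by
  rw [height]
  linarith [mul_nonneg (jump_pos j).le (clock_nonneg j t)]

lemma height_pos (j : ℕ) (t : ℝ) : 0 < height j t :=
  (amp_pos _).trans_le (amp_succ_le_height j t)

lemma height_le_amp (j : ℕ) (t : ℝ) : height j t ≤ amp j := by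
  rw [height]
  linarith [mul_le_mul_of_nonneg_left (clock_le_one j t) (jump_pos j).le, jump.eq_1 j]

/-! ### The velocity of a stage -/

/-- A smooth, compactly supported profile in `x`, equal to the velocity of the blocks on the blocks
of stage `j`. -/
def blockVel (j : ℕ) (t x : ℝ) : ℝ :=
  clock' j t * jump j / 2 ^ j *
    (stair (2 ^ j) (gapRatio j) (2 ^ j * x / height j t) * cutoff (x / amp j))

/-- The spatial derivative of `blockVel`. -/
def blockVel' (j : ℕ) (t x : ℝ) : ℝ :=
  clock' j t * jump j / 2 ^ j *
    (stair' (2 ^ j) (gapRatio j) (2 ^ j * x / height j t) * (2 ^ j / height j t)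
        * cutoff (x / amp j)
      + stair (2 ^ j) (gapRatio j) (2 ^ j * x / height j t) * (cutoff' (x / amp j) / amp j))

/-- The coordinate function, truncated at scale `amp j`. -/
def truncId (j : ℕ) (x : ℝ) : ℝ := amp j * (x / amp j * cutoff (x / amp j))

/-- The derivative of `truncId`. -/
def truncId' (j : ℕ) (x : ℝ) : ℝ := cutSlope (x / amp j)

/-- The first component, at `(x, y)`, of the velocity of stage `j`, which is the rotated gradient
of `blockVel j t x * truncId j y - blockVel j t y * truncId j x`. -/
def stageVel (j : ℕ) (t x y : ℝ) : ℝ :=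
  blockVel j t x * truncId' j y - blockVel' j t y * truncId j x

lemma hasDerivAt_blockVel (j : ℕ) (t x : ℝ) :
    HasDerivAt (blockVel j t) (blockVel' j t x) x := by
  have h1 : HasDerivAt (fun x : ℝ => 2 ^ j * x / height j t) (2 ^ j / height j t) x := by
    simpa using ((hasDerivAt_id x).const_mul ((2 : ℝ) ^ j)).div_const (height j t)
  have h2 : HasDerivAt (fun x : ℝ => x / amp j) (1 / amp j) x :=
    (hasDerivAt_id x).div_const _
  have h3 := (hasDerivAt_stair (2 ^ j) (gapRatio j) _).comp x h1
  have h4 := (hasDerivAt_cutoff _).comp x h2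
  have h5 := (h3.mul h4).const_mul (clock' j t * jump j / 2 ^ j)
  refine h5.congr_deriv ?_
  simp only [blockVel', Function.comp_apply]
  ring

lemma hasDerivAt_truncId (j : ℕ) (x : ℝ) : HasDerivAt (truncId j) (truncId' j x) x := by
  have h2 : HasDerivAt (fun x : ℝ => x / amp j) (1 / amp j) x :=
    (hasDerivAt_id x).div_const _
  have h3 := ((hasDerivAt_mul_cutoff _).comp x h2).const_mul (amp j)
  refine h3.congr_deriv ?_
  have := (amp_pos j).ne'
  rw [truncId']
  field_simp

lemma contDiff_blockVel {n : ℕ∞} (j : ℕ) :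
    ContDiff ℝ n (fun p : ℝ × ℝ => blockVel j p.1 p.2) := by
  have h1 : ContDiff ℝ n (fun p : ℝ × ℝ => 2 ^ j * p.2 / height j p.1) :=
    (contDiff_const.mul contDiff_snd).div ((contDiff_height j).comp contDiff_fst)
      fun p => (height_pos j p.1).ne'
  have h2 : ContDiff ℝ n (fun p : ℝ × ℝ => p.2 / amp j) := contDiff_snd.div_const _
  exact ((((contDiff_clock' j).comp contDiff_fst).mul contDiff_const).div_const _).mul
    (((contDiff_stair _ _).comp h1).mul (contDiff_cutoff.comp h2))

lemma contDiff_blockVel' {n : ℕ∞} (j : ℕ) :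
    ContDiff ℝ n (fun p : ℝ × ℝ => blockVel' j p.1 p.2) := by
  have h0 : ContDiff ℝ n (fun p : ℝ × ℝ => height j p.1) :=
    (contDiff_height j).comp contDiff_fst
  have h1 : ContDiff ℝ n (fun p : ℝ × ℝ => 2 ^ j * p.2 / height j p.1) :=
    (contDiff_const.mul contDiff_snd).div h0 fun p => (height_pos j p.1).ne'
  have h2 : ContDiff ℝ n (fun p : ℝ × ℝ => p.2 / amp j) := contDiff_snd.div_const _
  exact ((((contDiff_clock' j).comp contDiff_fst).mul contDiff_const).div_const _).mul
    (((((contDiff_stair' _ _).comp h1).mul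
      (contDiff_const.div h0 fun p => (height_pos j p.1).ne')).mul (contDiff_cutoff.comp h2)).add
      (((contDiff_stair _ _).comp h1).mul ((contDiff_cutoff'.comp h2).div_const _)))

lemma contDiff_truncId {n : ℕ∞} (j : ℕ) : ContDiff ℝ n (truncId j) := by
  have h2 : ContDiff ℝ n (fun x : ℝ => x / amp j) := contDiff_id.div_const _
  exact contDiff_const.mul (h2.mul (contDiff_cutoff.comp h2))

lemma contDiff_truncId' {n : ℕ∞} (j : ℕ) : ContDiff ℝ n (truncId' j) :=
  contDiff_cutSlope.comp (contDiff_id.div_const _)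

lemma contDiff_stageVel {n : ℕ∞} (j : ℕ) :
    ContDiff ℝ n (fun p : ℝ × ℝ × ℝ => stageVel j p.1 p.2.1 p.2.2) :=
  (((contDiff_blockVel j).comp (contDiff_fst.prodMk (contDiff_fst.comp contDiff_snd))).mul
    ((contDiff_truncId' j).comp (contDiff_snd.comp contDiff_snd))).sub
  (((contDiff_blockVel' j).comp (contDiff_fst.prodMk (contDiff_snd.comp contDiff_snd))).mul
    ((contDiff_truncId j).comp (contDiff_fst.comp contDiff_snd)))

lemma two_le_abs_div_amp {j : ℕ} {x : ℝ} (hx : 2 * amp j ≤ |x|) : 2 ≤ |x / amp j| := by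
  rwa [abs_div, abs_of_pos (amp_pos j), le_div_iff₀ (amp_pos j)]

lemma blockVel_of_le_abs {j : ℕ} (t : ℝ) {x : ℝ} (hx : 2 * amp j ≤ |x|) :
    blockVel j t x = 0 := by
  rw [blockVel, cutoff_of_le_abs (two_le_abs_div_amp hx)]
  simp

lemma blockVel'_of_le_abs {j : ℕ} (t : ℝ) {x : ℝ} (hx : 2 * amp j ≤ |x|) :
    blockVel' j t x = 0 := by
  rw [blockVel', cutoff_of_le_abs (two_le_abs_div_amp hx),
    cutoff'_of_le_abs (two_le_abs_div_amp hx)]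
  simp

lemma truncId_of_le_abs {j : ℕ} {x : ℝ} (hx : 2 * amp j ≤ |x|) : truncId j x = 0 := by
  rw [truncId, cutoff_of_le_abs (two_le_abs_div_amp hx)]
  simp

lemma truncId'_of_le_abs {j : ℕ} {x : ℝ} (hx : 2 * amp j ≤ |x|) : truncId' j x = 0 :=
  cutSlope_of_le_abs (two_le_abs_div_amp hx)

lemma stageVel_of_le_abs {j : ℕ} (t : ℝ) {x y : ℝ} (h : 2 * amp j ≤ |x| ∨ 2 * amp j ≤ |y|) :
    stageVel j t x y = 0 := by
  rcases h with h | h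
  · rw [stageVel, blockVel_of_le_abs t h, truncId_of_le_abs h]
    simp
  · rw [stageVel, blockVel'_of_le_abs t h, truncId'_of_le_abs h]
    simp

lemma stageVel_of_clock' {j : ℕ} {t : ℝ} (h : clock' j t = 0) (x y : ℝ) :
    stageVel j t x y = 0 := by
  simp [stageVel, blockVel, blockVel', h]

lemma ratio_bound (j : ℕ) :
    2 * (amp j / (gapRatio j * amp (j + 1))) ≤ 93312 * ((j : ℝ) + 1) := by
  have hj : (0 : ℝ) ≤ j := Nat.cast_nonneg j
  have h1 : 1 / ((j : ℝ) + 3) ^ 6 ≤ jump (j + 1) := by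
    refine le_trans (le_of_eq ?_) (le_jump (j + 1))
    push_cast
    ring
  have hA : amp j = 1 / ((j : ℝ) + 1) ^ 5 := rfl
  have hB : amp (j + 1) = 1 / ((j : ℝ) + 2) ^ 5 := by
    rw [amp]
    push_cast
    ring
  have hJ := jump_pos (j + 1)
  have e : 2 * (amp j / (gapRatio j * amp (j + 1)))
      = 4 * ((j : ℝ) + 2) ^ 5 / (((j : ℝ) + 1) ^ 10 * jump (j + 1)) := by
    rw [gapRatio, hA, hB]
    field_simp
    ring
  rw [e, div_le_iff₀ (by positivity)]
  have h3 : ((j : ℝ) + 3) ^ 6 ≤ (3 * ((j : ℝ) + 1)) ^ 6 := by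
    gcongr
    linarith
  have h2 : ((j : ℝ) + 2) ^ 5 ≤ (2 * ((j : ℝ) + 1)) ^ 5 := by
    gcongr
    linarith
  have h4 : 1 ≤ (3 * ((j : ℝ) + 1)) ^ 6 * jump (j + 1) := by
    rw [div_le_iff₀ (by positivity)] at h1
    nlinarith
  calc 4 * ((j : ℝ) + 2) ^ 5 ≤ 4 * (2 * ((j : ℝ) + 1)) ^ 5 * 1 := by linarith
    _ ≤ 4 * (2 * ((j : ℝ) + 1)) ^ 5 * ((3 * ((j : ℝ) + 1)) ^ 6 * jump (j + 1)) := by gcongr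
    _ = 93312 * ((j : ℝ) + 1) * (((j : ℝ) + 1) ^ 10 * jump (j + 1)) := by ring

lemma abs_stageVel_le (j : ℕ) (t x y : ℝ) :
    |stageVel j t x y| ≤ 200000 * rampBound ^ 2 * (1 / ((j : ℝ) + 1) ^ 2) := by
  have hM := one_le_rampBound
  have hM0 : 0 < rampBound := by linarith
  have hq := amp_pos j
  have hq' := amp_pos (j + 1)
  have hd := gapRatio_pos j
  have hj : (0 : ℝ) ≤ j := Nat.cast_nonneg j
  set R := rampBound with hR
  set c := R * (((j : ℝ) + 1) * (j + 2)) * amp j with hc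
  have hc0 : 0 ≤ c := by positivity
  have hpow : (0 : ℝ) < 2 ^ j := by positivity
  have hpre : |clock' j t * jump j / 2 ^ j| ≤ c / 2 ^ j := by
    rw [abs_div, abs_mul, abs_of_pos hpow, abs_of_pos (jump_pos j)]
    refine div_le_div_of_nonneg_right ?_ hpow.le
    exact mul_le_mul (abs_clock'_le j t) (jump_le_amp j) (jump_pos j).le (by positivity)
  have hst : ∀ ξ, |stair (2 ^ j) (gapRatio j) ξ| ≤ 2 ^ j := fun ξ => by
    simpa using abs_stair_le (2 ^ j) (gapRatio j) ξ
  have h1 : |blockVel j t x| ≤ c := by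
    rw [blockVel, abs_mul, abs_mul]
    calc _ ≤ c / 2 ^ j * (2 ^ j * 1) := by
          gcongr
          · exact hst _
          · exact abs_cutoff_le _
      _ = c := by field_simp
  have h2 : |truncId' j y| ≤ 5 * R := abs_cutSlope_le _
  have h3 : |truncId j x| ≤ amp j * 2 := by
    rw [truncId, abs_mul, abs_of_pos hq]
    gcongr
    exact abs_mul_cutoff_le _
  have h4 : |blockVel' j t y| ≤ c / 2 ^ j *
      (R / gapRatio j * (2 ^ j / amp (j + 1)) * 1 + 2 ^ j * (2 * R / amp j)) := by
    rw [blockVel', abs_mul]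
    gcongr
    refine (abs_add_le _ _).trans ?_
    rw [abs_mul, abs_mul, abs_mul, abs_div, abs_div, abs_of_pos hq, abs_of_pos (height_pos j t),
      abs_of_pos hpow]
    have := height_pos j t
    gcongr
    · exact abs_stair'_le _ hd (gapRatio_le_one j) _
    · exact amp_succ_le_height j t
    · exact abs_cutoff_le _
    · exact hst _
    · exact abs_cutoff'_le _
  have h5 : |stageVel j t x y| ≤ c * (5 * R) + c / 2 ^ j *
      (R / gapRatio j * (2 ^ j / amp (j + 1)) * 1 + 2 ^ j * (2 * R / amp j)) * (amp j * 2) := by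
    rw [stageVel]
    refine (abs_sub _ _).trans ?_
    rw [abs_mul, abs_mul]
    gcongr
  refine h5.trans ?_
  have e : c * (5 * R) + c / 2 ^ j *
      (R / gapRatio j * (2 ^ j / amp (j + 1)) * 1 + 2 ^ j * (2 * R / amp j)) * (amp j * 2)
      = c * R * (9 + 2 * (amp j / (gapRatio j * amp (j + 1)))) := by
    field_simp
    ring
  rw [e]
  calc c * R * (9 + 2 * (amp j / (gapRatio j * amp (j + 1))))
      ≤ c * R * (100000 * ((j : ℝ) + 1)) := by
        gcongr
        linarith [ratio_bound j]
    _ = 100000 * R ^ 2 * (((j : ℝ) + 2) / ((j : ℝ) + 1) ^ 3) := by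
        rw [hc, amp]
        field_simp
    _ ≤ 100000 * R ^ 2 * (2 / ((j : ℝ) + 1) ^ 2) := by
        gcongr 100000 * R ^ 2 * ?_
        rw [div_le_div_iff₀ (by positivity) (by positivity)]
        have : 0 ≤ (j : ℝ) * (j + 1) ^ 2 := by positivity
        nlinarith
    _ = _ := by ring

lemma summable_inv_succ_sq : Summable fun j : ℕ => 1 / ((j : ℝ) + 1) ^ 2 := by
  have h := (summable_nat_add_iff 1).2 (Real.summable_one_div_nat_pow.2 one_lt_two)
  simpa using h

/-! ### Trajectories -/

/-- Truncation of the binary expansion of `x` after `j` digits. -/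
def dyad (j : ℕ) (x : ℝ) : ℝ := ⌊2 ^ j * x⌋ / 2 ^ j

/-- One coordinate, at time `t`, of the trajectory with label `x`. -/
def pos (t x : ℝ) : ℝ := ∑' j, clock j t * jump j * dyad j x

lemma dyad_le (j : ℕ) (x : ℝ) : dyad j x ≤ x := by
  rw [dyad, div_le_iff₀ (by positivity), mul_comm x]
  exact Int.floor_le _

lemma lt_dyad_add (j : ℕ) (x : ℝ) : x < dyad j x + 1 / 2 ^ j := by
  rw [dyad, ← add_div, lt_div_iff₀ (by positivity), mul_comm x]
  exact Int.lt_floor_add_one _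

lemma dyad_nonneg (j : ℕ) {x : ℝ} (hx : 0 ≤ x) : 0 ≤ dyad j x := by
  have : 0 ≤ ⌊2 ^ j * x⌋ := Int.floor_nonneg.2 (by positivity)
  rw [dyad]
  positivity

lemma abs_dyad_le (j : ℕ) (x : ℝ) : |dyad j x| ≤ |x| + 1 := by
  have h1 : (1 : ℝ) / 2 ^ j ≤ 1 := div_le_one_of_le₀ (one_le_pow₀ (by norm_num)) (by positivity)
  rw [abs_le]
  constructor <;> linarith [dyad_le j x, lt_dyad_add j x, neg_abs_le x, le_abs_self x]

lemma monotone_dyad (j : ℕ) : Monotone (dyad j) := by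
  intro x y hxy
  rw [dyad, dyad]
  gcongr

lemma dyad_refine {j i : ℕ} (h : j ≤ i) (x : ℝ) :
    dyad j x ≤ dyad i x ∧ dyad i x + 1 / 2 ^ i ≤ dyad j x + 1 / 2 ^ j := by
  obtain ⟨k, rfl⟩ := Nat.exists_eq_add_of_le h
  have hp : (0 : ℝ) < 2 ^ j := by positivity
  have h1 : (2 : ℤ) ^ k * ⌊2 ^ j * x⌋ ≤ ⌊2 ^ (j + k) * x⌋ := by
    rw [Int.le_floor]
    push_cast
    have := mul_le_mul_of_nonneg_left (Int.floor_le ((2 : ℝ) ^ j * x))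
      (by positivity : (0 : ℝ) ≤ 2 ^ k)
    calc _ ≤ _ := this
      _ = _ := by ring
  have h2 : ⌊2 ^ (j + k) * x⌋ < (2 : ℤ) ^ k * (⌊2 ^ j * x⌋ + 1) := by
    rw [Int.floor_lt]
    push_cast
    have := mul_lt_mul_of_pos_left (Int.lt_floor_add_one ((2 : ℝ) ^ j * x))
      (by positivity : (0 : ℝ) < 2 ^ k)
    calc _ = _ := by ring
      _ < _ := this
  have h1' : (2 : ℝ) ^ k * ⌊2 ^ j * x⌋ ≤ ⌊2 ^ (j + k) * x⌋ := by exact_mod_cast h1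
  have h2' : (⌊2 ^ (j + k) * x⌋ : ℝ) + 1 ≤ (2 : ℝ) ^ k * (⌊2 ^ j * x⌋ + 1) := by
    exact_mod_cast Int.add_one_le_of_lt h2
  constructor
  · rw [dyad, dyad, div_le_div_iff₀ hp (by positivity)]
    calc _ = 2 ^ j * ((2 : ℝ) ^ k * ⌊2 ^ j * x⌋) := by ring
      _ ≤ 2 ^ j * ⌊2 ^ (j + k) * x⌋ := by gcongr
      _ = _ := by ring
  · rw [dyad, dyad, ← add_div, ← add_div, div_le_div_iff₀ (by positivity) hp]
    calc _ = 2 ^ j * ((⌊2 ^ (j + k) * x⌋ : ℝ) + 1) := by ring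
      _ ≤ 2 ^ j * ((2 : ℝ) ^ k * (⌊2 ^ j * x⌋ + 1)) := by gcongr
      _ = _ := by ring

lemma tendsto_amp : Filter.Tendsto amp Filter.atTop (nhds 0) := by
  refine squeeze_zero (fun j => (amp_pos j).le) (fun j => ?_)
    (tendsto_one_div_add_atTop_nhds_zero_nat (𝕜 := ℝ))
  rw [amp]
  refine one_div_le_one_div_of_le (by positivity) (le_self_pow₀ ?_ (by norm_num))
  linarith [Nat.cast_nonneg (α := ℝ) j]

lemma hasSum_jump (k : ℕ) : HasSum (fun i => jump (i + k)) (amp k) := by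
  rw [hasSum_iff_tendsto_nat_of_nonneg fun i => (jump_pos _).le]
  have h : ∀ n, ∑ i ∈ Finset.range n, jump (i + k) = amp k - amp (n + k) := by
    intro n
    induction n with
    | zero => simp
    | succ n ih =>
      rw [Finset.sum_range_succ, ih, jump, add_right_comm]
      ring
  simp_rw [h]
  simpa using tendsto_const_nhds.sub ((Filter.tendsto_add_atTop_iff_nat k).2 tendsto_amp)

lemma summable_pos (t x : ℝ) : Summable fun j => clock j t * jump j * dyad j x := by
  refine Summable.of_norm_bounded (g := fun j => jump j * (|x| + 1))
    ((hasSum_jump 0).summable.mul_right _) fun j => ?_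
  rw [Real.norm_eq_abs, abs_mul, abs_mul, abs_of_nonneg (clock_nonneg j t),
    abs_of_pos (jump_pos j)]
  have h1 := clock_le_one j t
  have h2 := jump_pos j
  have h3 := abs_dyad_le j x
  calc _ ≤ 1 * jump j * (|x| + 1) := by gcongr
    _ = _ := by ring

lemma hasDerivAt_pos (t x : ℝ) :
    HasDerivAt (fun s => pos s x) (∑' j, clock' j t * jump j * dyad j x) t := by
  refine hasDerivAt_tsum (u := fun j : ℕ => rampBound * 2 * (|x| + 1) * (1 / ((j : ℝ) + 1) ^ 2))
    (summable_inv_succ_sq.mul_left _)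
    (fun j s => ((hasDerivAt_clock j s).mul_const _).mul_const _) (fun j s => ?_)
    (summable_pos 0 x) t
  have hM := one_le_rampBound
  have hj : (0 : ℝ) ≤ j := Nat.cast_nonneg j
  rw [Real.norm_eq_abs, abs_mul, abs_mul, abs_of_pos (jump_pos j)]
  have h1 : |clock' j s| * jump j ≤ rampBound * (((j : ℝ) + 1) * (j + 2)) * amp j :=
    mul_le_mul (abs_clock'_le j s) (jump_le_amp j) (jump_pos j).le (by positivity)
  have h2 : ((j : ℝ) + 1) * (j + 2) * amp j ≤ 2 * (1 / ((j : ℝ) + 1) ^ 2) := by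
    rw [amp, mul_one_div, mul_one_div, div_le_div_iff₀ (by positivity) (by positivity)]
    have : ((j : ℝ) + 2) ≤ 2 * (j + 1) ^ 2 := by nlinarith
    calc _ = ((j : ℝ) + 1) ^ 3 * ((j : ℝ) + 2) := by ring
      _ ≤ ((j : ℝ) + 1) ^ 3 * (2 * (j + 1) ^ 2) := by gcongr
      _ = _ := by ring
  calc _ ≤ rampBound * (((j : ℝ) + 1) * (j + 2)) * amp j * (|x| + 1) :=
        mul_le_mul h1 (abs_dyad_le j x) (abs_nonneg _) ((by have := jump_pos j; positivity : 0 ≤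
          |clock' j s| * jump j).trans h1)
    _ = rampBound * (|x| + 1) * (((j : ℝ) + 1) * (j + 2) * amp j) := by ring
    _ ≤ rampBound * (|x| + 1) * (2 * (1 / ((j : ℝ) + 1) ^ 2)) := by gcongr
    _ = _ := by ring

lemma monotone_pos (t : ℝ) : Monotone (pos t) := fun x y hxy =>
  (summable_pos t x).tsum_le_tsum (fun j => mul_le_mul_of_nonneg_left (monotone_dyad j hxy)
    (mul_nonneg (clock_nonneg j t) (jump_pos j).le)) (summable_pos t y)

lemma pos_zero (x : ℝ) : pos 0 x = 0 := by
  have h : ∀ j, clock j 0 = 0 := fun j => clock_eq_zero (by simp)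
  simp [pos, h]

lemma clock_of_stage_lt {j i : ℕ} {t : ℝ} (h1 : 1 < (j + 2) * t) (h2 : (j + 1) * t < 1)
    (hi : i < j) : clock i t = 0 := by
  have ht : 0 < t := by
    by_contra h
    nlinarith [Nat.cast_nonneg (α := ℝ) j]
  have : (i : ℝ) + 1 ≤ j := by exact_mod_cast hi
  exact clock_eq_zero (by nlinarith)

lemma clock_of_lt_stage {j i : ℕ} {t : ℝ} (h1 : 1 < (j + 2) * t)
    (hi : j < i) : clock i t = 1 := by
  have ht : 0 < t := by
    by_contra h
    nlinarith [Nat.cast_nonneg (α := ℝ) j]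
  have : (j : ℝ) + 1 ≤ i := by exact_mod_cast hi
  exact clock_eq_one (by nlinarith)

lemma clock'_of_ne_stage {j i : ℕ} {t : ℝ} (hj : clock' j t ≠ 0) (hi : i ≠ j) :
    clock' i t = 0 := by
  by_contra h
  obtain ⟨h1, h2⟩ := stage_of_clock'_ne_zero hj
  obtain ⟨h3, h4⟩ := stage_of_clock'_ne_zero h
  have ht : 0 < t := by
    by_contra h
    nlinarith [Nat.cast_nonneg (α := ℝ) j]
  rcases lt_or_gt_of_ne hi with hi | hi
  · have : (i : ℝ) + 1 ≤ j := by exact_mod_cast hi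
    nlinarith
  · have : (j : ℝ) + 1 ≤ i := by exact_mod_cast hi
    nlinarith

lemma hasSum_height {j : ℕ} {t : ℝ} (h1 : 1 < (j + 2) * t) (h2 : (j + 1) * t < 1) :
    HasSum (fun i => clock i t * jump i) (height j t) := by
  rw [← hasSum_nat_add_iff' (j + 1), Finset.sum_range_succ, Finset.sum_eq_zero]
  · have : height j t - (0 + clock j t * jump j) = amp (j + 1) := by
      rw [height]
      ring
    rw [this]
    refine (hasSum_jump (j + 1)).congr_fun fun i => ?_
    rw [clock_of_lt_stage h1 (by omega), one_mul]
  · intro i hi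
    rw [clock_of_stage_lt h1 h2 (Finset.mem_range.1 hi), zero_mul]

lemma pos_mem_block {j : ℕ} {t : ℝ} (h1 : 1 < (j + 2) * t) (h2 : (j + 1) * t < 1) (x : ℝ) :
    dyad j x * height j t ≤ pos t x ∧
      pos t x ≤ (dyad j x + 1 / 2 ^ j) * height j t - jump (j + 1) * (1 / 2 ^ (j + 1)) := by
  have hS := hasSum_height h1 h2
  have hP : HasSum (fun i => clock i t * jump i * dyad i x) (pos t x) :=
    (summable_pos t x).hasSum
  have he : ∀ i, 0 ≤ clock i t * jump i := fun i =>
    mul_nonneg (clock_nonneg i t) (jump_pos i).le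
  constructor
  · rw [mul_comm]
    refine hasSum_le (fun i => ?_) (hS.mul_right (dyad j x)) hP
    rcases lt_or_ge i j with hi | hi
    · simp [clock_of_stage_lt h1 h2 hi]
    · exact mul_le_mul_of_nonneg_left (dyad_refine hi x).1 (he i)
  · have hite := hasSum_ite_eq (j + 1) (jump (j + 1) * (1 / (2 : ℝ) ^ (j + 1)))
    rw [mul_comm]
    refine hasSum_le (fun i => ?_) hP ((hS.mul_right (dyad j x + 1 / 2 ^ j)).sub hite)
    rcases lt_or_ge i j with hi | hi
    · have : i ≠ j + 1 := by omega
      simp [clock_of_stage_lt h1 h2 hi, this]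
    · have hd := (dyad_refine hi x).2
      split_ifs with hij
      · subst hij
        rw [clock_of_lt_stage h1 (Nat.lt_succ_self j), one_mul, ← mul_sub]
        exact mul_le_mul_of_nonneg_left (by linarith) (jump_pos _).le
      · rw [sub_zero]
        refine mul_le_mul_of_nonneg_left ?_ (he i)
        have : (0 : ℝ) < 1 / 2 ^ i := by positivity
        linarith

lemma stageVel_pos (j : ℕ) (t : ℝ) {x y : ℝ} (hx : x ∈ Ico (0 : ℝ) 1) (hy : y ∈ Ico (0 : ℝ) 1) :
    stageVel j t (pos t x) (pos t y) = clock' j t * jump j * dyad j x := by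
  by_cases hc : clock' j t = 0
  · rw [stageVel_of_clock' hc, hc]
    ring
  obtain ⟨h1, h2⟩ := stage_of_clock'_ne_zero hc
  have hH := height_pos j t
  have hHa := height_le_amp j t
  have ha := amp_pos j
  have hpow : (0 : ℝ) < 2 ^ j := by positivity
  have key : ∀ z ∈ Ico (0 : ℝ) 1, |pos t z / amp j| ≤ 1 ∧
      stair (2 ^ j) (gapRatio j) (2 ^ j * pos t z / height j t) = 2 ^ j * dyad j z ∧
      stair' (2 ^ j) (gapRatio j) (2 ^ j * pos t z / height j t) = 0 := by
    intro z hz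
    obtain ⟨hl, hu⟩ := pos_mem_block h1 h2 z
    have hd0 := dyad_nonneg j hz.1
    set n := ⌊2 ^ j * z⌋.toNat with hn
    have hfl : 0 ≤ ⌊2 ^ j * z⌋ := Int.floor_nonneg.2 (mul_nonneg hpow.le hz.1)
    have hnc : (n : ℝ) = 2 ^ j * dyad j z := by
      have : ((n : ℤ) : ℝ) = ⌊2 ^ j * z⌋ := by rw [hn, Int.toNat_of_nonneg hfl]
      rw [dyad, mul_div_cancel₀ _ hpow.ne', ← this]
      simp
    have hnlt : n < 2 ^ j := by
      have : (n : ℝ) < 2 ^ j := by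
        rw [hnc]
        nlinarith [dyad_le j z, hz.2]
      exact_mod_cast this
    have hn1 : (n : ℝ) + 1 ≤ 2 ^ j := by exact_mod_cast hnlt
    have hd1 : dyad j z + 1 / 2 ^ j ≤ 1 := by
      have : dyad j z + 1 / 2 ^ j = (n + 1) / 2 ^ j := by
        rw [hnc]
        field_simp
      rw [this]
      exact div_le_one_of_le₀ hn1 hpow.le
    have hgap : gapRatio j * height j t ≤ jump (j + 1) / 2 := by
      have := (gapRatio_pos j).le
      calc _ ≤ gapRatio j * amp j := by gcongr
        _ = _ := by
          rw [gapRatio]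
          field_simp
    have h0 : 0 ≤ pos t z := le_trans (by positivity) hl
    have hq : pos t z ≤ amp j := by
      have : 0 ≤ jump (j + 1) * (1 / 2 ^ (j + 1)) := by
        have := (jump_pos (j + 1)).le
        positivity
      nlinarith
    refine ⟨?_, ?_⟩
    · rw [abs_of_nonneg (div_nonneg h0 ha.le)]
      exact div_le_one_of_le₀ hq ha.le
    · rw [← hnc]
      refine stair_eq (gapRatio_pos j) hnlt ?_ ?_
      · rw [le_div_iff₀ hH, hnc, mul_assoc]
        gcongr
      · rw [div_le_iff₀ hH]
        calc 2 ^ j * pos t z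
            ≤ 2 ^ j * ((dyad j z + 1 / 2 ^ j) * height j t
              - jump (j + 1) * (1 / 2 ^ (j + 1))) := by gcongr
          _ = (n + 1) * height j t - jump (j + 1) / 2 := by
              rw [hnc]
              field_simp
              ring
          _ ≤ (n + 1 - gapRatio j) * height j t := by
              rw [sub_mul]
              linarith
  obtain ⟨kx1, kx2, -⟩ := key x hx
  obtain ⟨ky1, -, ky3⟩ := key y hy
  rw [stageVel, blockVel, blockVel', truncId', kx2, ky3, cutoff_of_abs_le kx1,
    cutoff'_of_abs_le ky1, cutSlope_of_abs_le ky1]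
  field_simp
  ring

lemma le_pos_sub_pos {t x y : ℝ} {i : ℕ} (hi : 1 ≤ (i + 1) * t) (hxy : 1 / 2 ^ i ≤ y - x) :
    jump i * (1 / 2 ^ i) ≤ pos t y - pos t x := by
  have hp : (0 : ℝ) < 2 ^ i := by positivity
  have hle : x ≤ y := by
    have : (0 : ℝ) < 1 / 2 ^ i := by positivity
    linarith
  have h1 : ∀ k, 0 ≤ clock k t * jump k * dyad k y - clock k t * jump k * dyad k x := by
    intro k
    rw [← mul_sub]
    exact mul_nonneg (mul_nonneg (clock_nonneg k t) (jump_pos k).le)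
      (sub_nonneg.2 (monotone_dyad k hle))
  have h2 := ((summable_pos t y).hasSum.sub (summable_pos t x).hasSum)
  refine le_trans ?_ (le_hasSum h2 i fun k _ => h1 k)
  rw [clock_eq_one hi, one_mul, ← mul_sub]
  refine mul_le_mul_of_nonneg_left ?_ (jump_pos i).le
  rw [dyad, dyad, ← sub_div]
  gcongr
  have h3 : ⌊2 ^ i * x⌋ + 1 ≤ ⌊2 ^ i * y⌋ := by
    rw [← Int.floor_add_one]
    refine Int.floor_le_floor ?_
    rw [div_le_iff₀ hp] at hxy
    linarith
  have h4 : (⌊2 ^ i * x⌋ : ℝ) + 1 ≤ ⌊2 ^ i * y⌋ := by exact_mod_cast h3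
  linarith

lemma exists_mul_pow_le_jump {r : ℝ} (hr0 : 0 < r) (hr1 : r < 1) :
    ∃ c > 0, ∀ i, c * r ^ i ≤ jump i := by
  have h := tendsto_pow_const_mul_const_pow_of_abs_lt_one 6 (r := r) (by rwa [abs_of_pos hr0])
  obtain ⟨K, hK⟩ := h.bddAbove_range
  have hK' : ∀ n : ℕ, (n : ℝ) ^ 6 * r ^ n ≤ K := fun n => hK ⟨n, rfl⟩
  have hKpos : 0 < K := lt_of_lt_of_le (by simpa using hr0) (hK' 1)
  refine ⟨r ^ 2 / K, by positivity, fun i => le_trans ?_ (le_jump i)⟩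
  have := hK' (i + 2)
  push_cast at this
  rw [div_mul_eq_mul_div, div_le_div_iff₀ hKpos (by positivity)]
  calc _ = ((i : ℝ) + 2) ^ 6 * r ^ (i + 2) := by ring
    _ ≤ K := this
    _ = _ := by ring

lemma exists_holder_pos {t α : ℝ} (ht : 0 < t) (hα0 : 0 < α) (hα1 : α < 1) :
    ∃ K : ℝ, 0 ≤ K ∧ ∀ x ∈ Ico (0 : ℝ) 1, ∀ y ∈ Ico (0 : ℝ) 1,
      |x - y| ≤ K * |pos t x - pos t y| ^ α := by
  have hβ : 0 < α⁻¹ - 1 := by linarith [(one_lt_inv₀ hα0).2 hα1]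
  obtain ⟨c, hc, hcj⟩ := exists_mul_pow_le_jump (r := (1 / 2 : ℝ) ^ (α⁻¹ - 1)) (by positivity)
    (Real.rpow_lt_one (by norm_num) (by norm_num) hβ)
  obtain ⟨i₀, hi₀⟩ := exists_nat_gt (1 / t)
  rw [div_lt_iff₀ ht] at hi₀
  have key : ∀ x ∈ Ico (0 : ℝ) 1, ∀ y ∈ Ico (0 : ℝ) 1, x < y →
      y - x ≤ 2 ^ (i₀ + 1) * (1 / c) ^ α * (pos t y - pos t x) ^ α := by
    intro x hx y hy hxy
    obtain ⟨n, hn1, hn2⟩ := exists_nat_pow_near_of_lt_one (x := y - x) (y := (1 / 2 : ℝ))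
      (by linarith) (by linarith [hx.1, hy.2]) (by norm_num) (by norm_num)
    set i := n + 1 + i₀ with hi
    have hit : 1 ≤ ((i : ℝ) + 1) * t := by
      rw [hi]
      push_cast
      have : 0 ≤ ((n : ℝ) + 2) * t := by positivity
      nlinarith
    have hir : 1 / 2 ^ i ≤ y - x := by
      refine le_trans ?_ hn1.le
      rw [← one_div_pow]
      exact pow_le_pow_of_le_one (by norm_num) (by norm_num) (by omega)
    have hd := le_pos_sub_pos hit hir
    have hpw : ((1 / 2 : ℝ) ^ i) ^ α⁻¹ ≤ 1 / c * (pos t y - pos t x) := by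
      have e : ((1 / 2 : ℝ) ^ i) ^ α⁻¹ = ((1 / 2 : ℝ) ^ (α⁻¹ - 1)) ^ i * (1 / 2 ^ i) := by
        rw [← one_div_pow, ← Real.rpow_natCast, ← Real.rpow_natCast, ← Real.rpow_mul (by norm_num),
          ← Real.rpow_mul (by norm_num), ← Real.rpow_add (by norm_num)]
        congr 1
        ring
      rw [e, one_div_mul_eq_div, le_div_iff₀ hc]
      refine le_trans ?_ hd
      calc _ = c * ((1 / 2 : ℝ) ^ (α⁻¹ - 1)) ^ i * (1 / 2 ^ i) := by ring
        _ ≤ _ := by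
          gcongr
          exact hcj i
    have hdp : 0 ≤ pos t y - pos t x := sub_nonneg.2 (monotone_pos t hxy.le)
    have h3 : (1 / 2 : ℝ) ^ i ≤ (1 / c) ^ α * (pos t y - pos t x) ^ α := by
      rw [← Real.mul_rpow (by positivity) hdp]
      calc (1 / 2 : ℝ) ^ i = (((1 / 2 : ℝ) ^ i) ^ α⁻¹) ^ α := by
            rw [← Real.rpow_mul (by positivity), inv_mul_cancel₀ hα0.ne', Real.rpow_one]
        _ ≤ _ := Real.rpow_le_rpow (by positivity) hpw hα0.le
    calc y - x ≤ (1 / 2) ^ n := hn2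
      _ = 2 ^ (i₀ + 1) * (1 / 2) ^ i := by
          rw [hi, one_div_pow, one_div_pow]
          field_simp
          ring
      _ ≤ 2 ^ (i₀ + 1) * ((1 / c) ^ α * (pos t y - pos t x) ^ α) := by gcongr
      _ = _ := by ring
  refine ⟨2 ^ (i₀ + 1) * (1 / c) ^ α, by positivity, fun x hx y hy => ?_⟩
  rcases lt_trichotomy x y with h | h | h
  · rw [abs_sub_comm, abs_sub_comm (pos t x), abs_of_pos (sub_pos.2 h),
      abs_of_nonneg (sub_nonneg.2 (monotone_pos t h.le))]
    exact key x hx y hy h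
  · subst h
    simp [Real.zero_rpow hα0.ne']
  · rw [abs_of_pos (sub_pos.2 h), abs_of_nonneg (sub_nonneg.2 (monotone_pos t h.le))]
    exact key y hy x hx h

/-! ### The velocity field -/

/-- The velocity field: at each time at most one stage is active. -/
def flowVel (t : ℝ) (z : ℝ × ℝ) : ℝ × ℝ :=
  (∑' j, stageVel j t z.1 z.2, ∑' j, stageVel j t z.2 z.1)

lemma continuous_tsum_stageVel :
    Continuous (fun p : ℝ × ℝ × ℝ => ∑' j, stageVel j p.1 p.2.1 p.2.2) := by
  refine continuous_tsum (fun j => (contDiff_stageVel (n := 0) j).continuous)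
    (summable_inv_succ_sq.mul_left (200000 * rampBound ^ 2)) fun j p => ?_
  rw [Real.norm_eq_abs]
  exact abs_stageVel_le j p.1 p.2.1 p.2.2

lemma continuous_flowVel : Continuous (Function.uncurry flowVel) := by
  refine continuous_tsum_stageVel.prodMk ?_
  exact continuous_tsum_stageVel.comp
    (continuous_fst.prodMk (continuous_snd.snd.prodMk continuous_snd.fst))

lemma tsum_stageVel_eq_zero {t x y : ℝ} (h : t ≤ 0 ∨ 1 ≤ t ∨ 2 ≤ |x| ∨ 2 ≤ |y|) :
    ∑' j, stageVel j t x y = 0 := by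
  refine (tsum_congr fun j => ?_).trans tsum_zero
  have h2 : 2 * amp j ≤ 2 := by linarith [amp_le_one j]
  rcases h with h | h | h | h
  · refine stageVel_of_clock' ?_ x y
    by_contra hc
    have := (stage_of_clock'_ne_zero hc).1
    have : ((j : ℝ) + 2) * t ≤ 0 := mul_nonpos_of_nonneg_of_nonpos (by positivity) h
    linarith
  · refine stageVel_of_clock' ?_ x y
    by_contra hc
    have := (stage_of_clock'_ne_zero hc).2
    have : (0 : ℝ) ≤ j := j.cast_nonneg
    nlinarith
  · exact stageVel_of_le_abs t (Or.inl (h2.trans h))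
  · exact stageVel_of_le_abs t (Or.inr (h2.trans h))

lemma hasCompactSupport_flowVel : HasCompactSupport (Function.uncurry flowVel) := by
  refine HasCompactSupport.intro
    (K := Icc (0 : ℝ) 1 ×ˢ (Icc (-2 : ℝ) 2 ×ˢ Icc (-2 : ℝ) 2))
    (isCompact_Icc.prod (isCompact_Icc.prod isCompact_Icc)) ?_
  rintro ⟨t, x, y⟩ h
  have key : t ≤ 0 ∨ 1 ≤ t ∨ 2 ≤ |x| ∨ 2 ≤ |y| := by
    by_contra! hc
    obtain ⟨h1, h2, h3, h4⟩ := hc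
    rw [abs_lt] at h3 h4
    exact h ⟨⟨h1.le, h2.le⟩, ⟨h3.1.le, h3.2.le⟩, ⟨h4.1.le, h4.2.le⟩⟩
  have key' : t ≤ 0 ∨ 1 ≤ t ∨ 2 ≤ |y| ∨ 2 ≤ |x| := by tauto
  simp only [Function.uncurry, flowVel, tsum_stageVel_eq_zero key, tsum_stageVel_eq_zero key']
  rfl

lemma locallyLipschitzOn_flowVel :
    LocallyLipschitzOn
      (Ici (0 : ℝ) ×ˢ ({((0 : ℝ), (0 : ℝ))}ᶜ : Set (ℝ × ℝ))) (Function.uncurry flowVel) := by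
  rintro ⟨t₀, z₀⟩ ⟨-, hz⟩
  have hz0 : 0 < ‖z₀‖ := norm_pos_iff.mpr hz
  obtain ⟨J, hJ⟩ := (tendsto_amp.eventually_lt_const
    (show (0 : ℝ) < ‖z₀‖ / 4 by positivity)).exists_forall_of_atTop
  have hloc : Function.uncurry flowVel =ᶠ[nhds (t₀, z₀)] fun p =>
      (∑ j ∈ Finset.range J, stageVel j p.1 p.2.1 p.2.2,
        ∑ j ∈ Finset.range J, stageVel j p.1 p.2.2 p.2.1) := by
    have hev : ∀ᶠ p : ℝ × ℝ × ℝ in nhds (t₀, z₀), ‖z₀‖ / 2 < ‖p.2‖ :=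
      continuous_snd.norm.continuousAt.eventually_const_lt
        (show ‖z₀‖ / 2 < ‖((t₀, z₀) : ℝ × ℝ × ℝ).2‖ by simp only; linarith)
    filter_upwards [hev] with p hp
    have hmax : ∀ j, j ∉ Finset.range J → 2 * amp j ≤ |p.2.1| ∨ 2 * amp j ≤ |p.2.2| := by
      intro j hj
      have h1 := hJ j (by simpa using hj)
      rw [Prod.norm_def p.2, lt_sup_iff, Real.norm_eq_abs, Real.norm_eq_abs] at hp
      exact hp.imp (fun h => by linarith) fun h => by linarith
    refine Prod.ext ?_ ?_
    · exact tsum_eq_sum fun j hj => stageVel_of_le_abs _ (hmax j hj)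
    · exact tsum_eq_sum fun j hj => stageVel_of_le_abs _ (hmax j hj).symm
  have hC : ContDiff ℝ 1 fun p : ℝ × ℝ × ℝ =>
      (∑ j ∈ Finset.range J, stageVel j p.1 p.2.1 p.2.2,
        ∑ j ∈ Finset.range J, stageVel j p.1 p.2.2 p.2.1) := by
    refine ContDiff.prodMk (ContDiff.sum fun j _ => contDiff_stageVel (n := 1) j)
      (ContDiff.sum fun j _ => ?_)
    exact (contDiff_stageVel (n := 1) j).comp
      (contDiff_fst.prodMk (contDiff_snd.snd.prodMk contDiff_snd.fst))
  obtain ⟨K, s, hs, hL⟩ := hC.contDiffAt.exists_lipschitzOnWith (x := (t₀, z₀))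
  refine ⟨K, s ∩ {p | Function.uncurry flowVel p = _},
    mem_nhdsWithin_of_mem_nhds (Filter.inter_mem hs hloc), fun p hp q hq => ?_⟩
  rw [hp.2, hq.2]
  exact hL hp.1 hq.1

lemma integral_mul_fderiv_add_eq_zero {a c : ℝ × ℝ → ℝ} {ψ : ℝ × ℝ → ℝ}
    (hψ : ContDiff ℝ (⊤ : ℕ∞) ψ) (hc : HasCompactSupport ψ) {v w : ℝ × ℝ}
    (ha : ContDiff ℝ 1 a) (hc' : ContDiff ℝ 1 c)
    (hdiv : ∀ z, fderiv ℝ a z v + fderiv ℝ c z w = 0) :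
    ∫ z, (a z * fderiv ℝ ψ z v + c z * fderiv ℝ ψ z w) = 0 := by
  have hψ' : ∀ v, Continuous fun z => fderiv ℝ ψ z v := fun v =>
    (hψ.continuous_fderiv (by simp)).clm_apply continuous_const
  have hψc : ∀ v, HasCompactSupport fun z => fderiv ℝ ψ z v := fun v => hc.fderiv_apply ℝ v
  have hparts : ∀ {f : ℝ × ℝ → ℝ}, ContDiff ℝ 1 f → ∀ v,
      Integrable (fun z => f z * fderiv ℝ ψ z v) ∧ Integrable (fun z => fderiv ℝ f z v * ψ z) ∧
      ∫ z, f z * fderiv ℝ ψ z v = - ∫ z, fderiv ℝ f z v * ψ z := by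
    intro f hf v
    have h1 : Integrable (fun z => f z * fderiv ℝ ψ z v) :=
      (hf.continuous.mul (hψ' v)).integrable_of_hasCompactSupport (hψc v).mul_left
    have h2 : Integrable (fun z => fderiv ℝ f z v * ψ z) :=
      (((hf.continuous_fderiv (by simp)).clm_apply continuous_const).mul
        hψ.continuous).integrable_of_hasCompactSupport hc.mul_left
    refine ⟨h1, h2, integral_mul_fderiv_eq_neg_fderiv_mul_of_integrable h2 h1
      ((hf.continuous.mul hψ.continuous).integrable_of_hasCompactSupport hc.mul_left)
      (fun z _ => (hf.differentiable (by simp)) z) fun z _ => (hψ.differentiable (by simp)) z⟩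
  obtain ⟨h1, h2, h3⟩ := hparts ha v
  obtain ⟨h4, h5, h6⟩ := hparts hc' w
  rw [integral_add h1 h4, h3, h6, ← neg_add, ← integral_add h2 h5]
  simp_rw [← add_mul, hdiv]
  simp

lemma flowVel_eq_stage {t : ℝ} {j : ℕ} (h : ∀ i, i ≠ j → clock' i t = 0) (z : ℝ × ℝ) :
    flowVel t z = (stageVel j t z.1 z.2, stageVel j t z.2 z.1) :=
  Prod.ext (tsum_eq_single j fun i hi => stageVel_of_clock' (h i hi) _ _)
    (tsum_eq_single j fun i hi => stageVel_of_clock' (h i hi) _ _)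

lemma exists_active_stage (t : ℝ) : ∃ j, ∀ i, i ≠ j → clock' i t = 0 := by
  by_cases h : ∃ j, clock' j t ≠ 0
  · obtain ⟨j, hj⟩ := h
    exact ⟨j, fun i hi => clock'_of_ne_stage hj hi⟩
  · push Not at h
    exact ⟨0, fun i _ => h i⟩

lemma contDiff_stageVel_slice (j : ℕ) (t : ℝ) :
    ContDiff ℝ 1 (fun z : ℝ × ℝ => stageVel j t z.1 z.2) := by
  have h := (contDiff_stageVel (n := 1) j).fun_comp
    (contDiff_const.prodMk contDiff_id : ContDiff ℝ _ fun z : ℝ × ℝ => (t, z))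
  simpa only [WithTop.coe_one] using h

lemma fderiv_stageVel_fst (j : ℕ) (t : ℝ) (z : ℝ × ℝ) :
    fderiv ℝ (fun z : ℝ × ℝ => stageVel j t z.1 z.2) z (1, 0) =
      blockVel' j t z.1 * truncId' j z.2 - blockVel' j t z.2 * truncId' j z.1 := by
  have hd : DifferentiableAt ℝ (fun z : ℝ × ℝ => stageVel j t z.1 z.2) z :=
    (contDiff_stageVel_slice j t).differentiable one_ne_zero z
  have h1 : HasDerivAt (fun s : ℝ => (s, z.2)) ((1 : ℝ), (0 : ℝ)) z.1 :=
    (hasDerivAt_id z.1).prodMk (hasDerivAt_const _ _)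
  have h2 := hd.hasFDerivAt.comp_hasDerivAt_of_eq z.1 h1 rfl
  have h3 := ((hasDerivAt_blockVel j t z.1).mul_const (truncId' j z.2)).sub
    ((hasDerivAt_truncId j z.1).const_mul (blockVel' j t z.2))
  exact h2.unique h3

lemma fderiv_swap_apply {f : ℝ × ℝ → ℝ} (hf : Differentiable ℝ f) (z v : ℝ × ℝ) :
    fderiv ℝ (fun z : ℝ × ℝ => f (z.2, z.1)) z v = fderiv ℝ f (z.2, z.1) (v.2, v.1) := by
  have h1 : HasFDerivAt (fun z : ℝ × ℝ => (z.2, z.1))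
      ((ContinuousLinearMap.snd ℝ ℝ ℝ).prod (ContinuousLinearMap.fst ℝ ℝ ℝ)) z :=
    ((ContinuousLinearMap.snd ℝ ℝ ℝ).prod (ContinuousLinearMap.fst ℝ ℝ ℝ)).hasFDerivAt
  have h2 : HasFDerivAt (fun z : ℝ × ℝ => f (z.2, z.1)) _ z :=
    (hf (z.2, z.1)).hasFDerivAt.comp z h1
  rw [h2.fderiv]
  rfl

lemma weakDivFreeAt_flowVel (t : ℝ) : WeakDivFreeAt flowVel t := by
  intro ψ hψ hc
  obtain ⟨j, hj⟩ := exists_active_stage t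
  have hu := contDiff_stageVel_slice j t
  have hv := hu.fun_comp (contDiff_snd.prodMk contDiff_fst)
  have hswap (z : ℝ × ℝ) : fderiv ℝ (fun z : ℝ × ℝ => stageVel j t z.2 z.1) z (0, 1) =
      blockVel' j t z.2 * truncId' j z.1 - blockVel' j t z.1 * truncId' j z.2 :=
    (fderiv_swap_apply (hu.differentiable one_ne_zero) z (0, 1)).trans
      (fderiv_stageVel_fst j t (z.2, z.1))
  have key := integral_mul_fderiv_add_eq_zero hψ hc (v := (1, 0)) (w := (0, 1)) hu hv
    fun z => by rw [hswap, fderiv_stageVel_fst]; ring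
  rw [← key]
  refine integral_congr_ae (Filter.Eventually.of_forall fun z => ?_)
  simp only [dot2, grad2, flowVel_eq_stage hj]

/-! ### The advected measures -/

/-- Product flow map: both coordinates are transported by `pos`. -/
def flow (t : ℝ) (p : ℝ × ℝ) : ℝ × ℝ := (pos t p.1, pos t p.2)

/-- Lebesgue measure on the unit square, the space of labels of the flow. -/
def labels : Measure (ℝ × ℝ) :=
  volume.restrict (Ico (0 : ℝ) 1 ×ˢ Ico (0 : ℝ) 1)

/-- The advected measure. -/
def cloud (t : ℝ) : Measure (ℝ × ℝ) := labels.map (flow t)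

lemma labels_univ : labels univ = 1 := by
  rw [labels, Measure.restrict_apply_univ, Measure.volume_eq_prod, Measure.prod_prod]
  simp

instance : IsProbabilityMeasure labels := ⟨labels_univ⟩

lemma ae_labels : ∀ᵐ p ∂labels, p.1 ∈ Ico (0 : ℝ) 1 ∧ p.2 ∈ Ico (0 : ℝ) 1 :=
  ae_restrict_mem (measurableSet_Ico.prod measurableSet_Ico)

lemma measurable_flow (t : ℝ) : Measurable (flow t) :=
  ((monotone_pos t).measurable.comp measurable_fst).prodMk
    ((monotone_pos t).measurable.comp measurable_snd)

lemma hasDerivAt_flow (t : ℝ) {p : ℝ × ℝ} (h₁ : p.1 ∈ Ico (0 : ℝ) 1) (h₂ : p.2 ∈ Ico (0 : ℝ) 1) :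
    HasDerivAt (fun s => flow s p) (flowVel t (flow t p)) t := by
  suffices hvel : flowVel t (flow t p) =
      (∑' j, clock' j t * jump j * dyad j p.1, ∑' j, clock' j t * jump j * dyad j p.2) by
    rw [hvel]
    exact (hasDerivAt_pos t p.1).prodMk (hasDerivAt_pos t p.2)
  refine Prod.ext ?_ ?_
  · exact tsum_congr fun j => stageVel_pos j t h₁ h₂
  · exact tsum_congr fun j => stageVel_pos j t h₂ h₁

lemma continuous_flow (p : ℝ × ℝ) : Continuous fun s => flow s p :=
  continuous_iff_continuousAt.mpr fun t =>
    (hasDerivAt_pos t p.1).continuousAt.prodMk (hasDerivAt_pos t p.2).continuousAt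

lemma measurable_uncurry_flow : Measurable (Function.uncurry flow) :=
  measurable_uncurry_of_continuous_of_measurable continuous_flow measurable_flow

instance (t : ℝ) : IsFiniteMeasure (cloud t) := by
  rw [cloud]
  infer_instance

lemma cloud_zero : cloud 0 = Measure.dirac ((0 : ℝ), (0 : ℝ)) := by
  have : flow 0 = fun _ => ((0 : ℝ), (0 : ℝ)) := by
    funext p
    simp [flow, pos_zero]
  rw [cloud, this, Measure.map_const, labels_univ, one_smul]

lemma mSupp_dirac (x : ℝ × ℝ) : mSupp (Measure.dirac x) = {x} := by
  ext y
  constructor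
  · intro h
    by_contra hne
    have := h {x}ᶜ (isOpen_compl_singleton.mem_nhds hne)
    simp at this
  · rintro rfl U hU
    rw [Measure.dirac_apply_of_mem (mem_of_mem_nhds hU)]
    exact one_pos

lemma integrable_comp_flow (T : ℝ) {b : ℝ × ℝ × ℝ → ℝ} (hb : Continuous b)
    (hc : HasCompactSupport b) :
    Integrable (fun q : ℝ × ℝ × ℝ => b (q.1, flow q.1 q.2))
      ((volume.restrict (Icc (0 : ℝ) T)).prod labels) := by
  obtain ⟨C, hC⟩ := hb.bounded_above_of_compact_support hc
  refine Integrable.of_bound ?_ C (Filter.Eventually.of_forall fun q => hC _)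
  exact (hb.measurable.comp (measurable_fst.prodMk measurable_uncurry_flow)).aestronglyMeasurable

lemma integral_cloud (t : ℝ) {b : ℝ × ℝ → ℝ} (hb : Continuous b) :
    ∫ x, b x ∂cloud t = ∫ p, b (flow t p) ∂labels :=
  integral_map (measurable_flow t).aemeasurable hb.aestronglyMeasurable

lemma weaklyAdvected_cloud {T : ℝ} (hT : 0 ≤ T) : WeaklyAdvected T flowVel cloud := by
  intro φ hφ hc
  have hd : Differentiable ℝ (Function.uncurry φ) := hφ.differentiable (by simp)
  have hφ' : Continuous (fderiv ℝ (Function.uncurry φ)) := hφ.continuous_fderiv (by simp)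
  set D := fderiv ℝ (Function.uncurry φ) with hD
  have ht : ∀ t x, deriv (fun s => φ s x) t = D (t, x) (1, 0) := fun t x =>
    ((hd (t, x)).hasFDerivAt.comp_hasDerivAt_of_eq t
      ((hasDerivAt_id t).prodMk (hasDerivAt_const t x)) rfl).deriv
  have hx : ∀ t x v, fderiv ℝ (φ t) x v = D (t, x) (0, v) := by
    intro t x v
    have h1 : HasFDerivAt (fun y : ℝ × ℝ => (t, y)) (ContinuousLinearMap.inr ℝ ℝ (ℝ × ℝ)) x :=
      hasFDerivAt_prodMk_right t x
    have h2 : HasFDerivAt (φ t) _ x := (hd (t, x)).hasFDerivAt.comp x h1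
    rw [h2.fderiv]
    rfl
  set a : ℝ × ℝ × ℝ → ℝ := fun q => D q (1, 0) with ha
  set b : ℝ × ℝ × ℝ → ℝ := fun q => D q (0, flowVel q.1 q.2) with hb
  have hb' : ∀ t x, dot2 (flowVel t x) (grad2 (φ t) x) = b (t, x) := by
    intro t x
    simp only [dot2, grad2, hx, hb]
    rw [← smul_eq_mul, ← smul_eq_mul, ← map_smul, ← map_smul, ← map_add]
    congr 1
    simp
  have hac : Continuous a := hφ'.clm_apply continuous_const
  have hbc : Continuous b := hφ'.clm_apply (continuous_const.prodMk continuous_flowVel)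
  have hDs : HasCompactSupport D := hc.fderiv ℝ
  have has : HasCompactSupport a := hDs.mono' fun q hq => subset_tsupport _ fun h => hq <| by
    simp [ha, h]
  have hbs : HasCompactSupport b := hDs.mono' fun q hq => subset_tsupport _ fun h => hq <| by
    simp [hb, h]
  have hai := integrable_comp_flow T hac has
  have hbi := integrable_comp_flow T hbc hbs
  have hφc : ∀ t, Continuous (φ t) := fun t =>
    hφ.continuous.comp (Continuous.prodMk_right t)
  have hφi : ∀ t, Integrable (fun p => φ t (flow t p)) labels := by
    intro t
    obtain ⟨C, hC⟩ := hφ.continuous.bounded_above_of_compact_support hc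
    exact Integrable.of_bound ((hφc t).measurable.comp (measurable_flow t)).aestronglyMeasurable C
      (Filter.Eventually.of_forall fun p => hC (t, flow t p))
  have hline : ∀ᵐ p ∂labels, ∫ t in Icc (0 : ℝ) T, (a (t, flow t p) + b (t, flow t p)) =
      φ T (flow T p) - φ 0 (flow 0 p) := by
    filter_upwards [ae_labels] with p hp
    have hder : ∀ t, HasDerivAt (fun s => φ s (flow s p))
        (a (t, flow t p) + b (t, flow t p)) t := by
      intro t
      have h := (hd (t, flow t p)).hasFDerivAt.comp_hasDerivAt_of_eq t
        ((hasDerivAt_id t).prodMk (hasDerivAt_flow t hp.1 hp.2)) rfl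
      have hsum : a (t, flow t p) + b (t, flow t p) =
          D (t, flow t p) (1, flowVel t (flow t p)) := by
        refine ((D (t, flow t p)).map_add (1, 0) (0, flowVel t (flow t p))).symm.trans ?_
        congr 1
        simp
      rw [hsum]
      exact h
    have hcont : Continuous fun t => a (t, flow t p) + b (t, flow t p) :=
      (hac.comp (continuous_id.prodMk (continuous_flow p))).add
        (hbc.comp (continuous_id.prodMk (continuous_flow p)))
    rw [integral_Icc_eq_integral_Ioc, ← intervalIntegral.integral_of_le hT]
    exact intervalIntegral.integral_eq_sub_of_hasDerivAt (fun t _ => hder t)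
      (hcont.intervalIntegrable _ _)
  have e1 : ∀ t, ∫ x, deriv (fun s => φ s x) t ∂cloud t = ∫ p, a (t, flow t p) ∂labels := by
    intro t
    simp_rw [ht]
    exact integral_cloud t (b := fun x => a (t, x)) (hac.comp (by fun_prop))
  have e2 : ∀ t, ∫ x, dot2 (flowVel t x) (grad2 (φ t) x) ∂cloud t =
      ∫ p, b (t, flow t p) ∂labels := by
    intro t
    simp_rw [hb']
    exact integral_cloud t (b := fun x => b (t, x)) (hbc.comp (by fun_prop))
  simp_rw [e1, e2]
  rw [integral_cloud T (hφc T), integral_cloud 0 (hφc 0)]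
  have key : (∫ t in Icc (0 : ℝ) T, ∫ p, a (t, flow t p) ∂labels) +
      (∫ t in Icc (0 : ℝ) T, ∫ p, b (t, flow t p) ∂labels) =
      (∫ p, φ T (flow T p) ∂labels) - ∫ p, φ 0 (flow 0 p) ∂labels := by
    rw [← integral_prod _ hai, ← integral_prod _ hbi, ← integral_add hai hbi]
    refine (integral_prod_symm _ (hai.add hbi)).trans ?_
    rw [← integral_sub (hφi T) (hφi 0)]
    exact integral_congr_ae hline
  linarith

/-! ### Dimension of the support -/

lemma mSupp_eq_support (μ : Measure (ℝ × ℝ)) : mSupp μ = μ.support :=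
  Set.ext fun x => (Measure.mem_support_iff_forall x).symm

lemma dimH_le_two (s : Set (ℝ × ℝ)) : dimH s ≤ 2 := by
  refine (dimH_mono (subset_univ s)).trans ?_
  rw [Real.dimH_univ_eq_finrank]
  simp

lemma two_le_dimH_preimage_support (t : ℝ) :
    2 ≤ dimH ((Ico (0 : ℝ) 1 ×ˢ Ico (0 : ℝ) 1) ∩ flow t ⁻¹' mSupp (cloud t)) := by
  have hmeas : MeasurableSet (mSupp (cloud t)) := by
    rw [mSupp_eq_support]
    exact Measure.isClosed_support.measurableSet
  have h0 : labels (flow t ⁻¹' mSupp (cloud t))ᶜ = 0 := by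
    rw [← preimage_compl, ← Measure.map_apply (measurable_flow t) hmeas.compl, mSupp_eq_support]
    exact Measure.measure_compl_support
  have h1 : labels (flow t ⁻¹' mSupp (cloud t)) = 1 :=
    (prob_compl_eq_zero_iff ((measurable_flow t) hmeas)).mp h0
  refine le_dimH_of_hausdorffMeasure_ne_zero (d := 2) ?_
  rw [NNReal.coe_ofNat, hausdorffMeasure_prod_real, inter_comm,
    ← Measure.restrict_apply ((measurable_flow t) hmeas)]
  rw [labels] at h1
  rw [h1]
  exact one_ne_zero

lemma dimH_mSupp_cloud {t : ℝ} (ht : 0 < t) : dimH (mSupp (cloud t)) = 2 := by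
  refine le_antisymm (dimH_le_two _) ?_
  set P := (Ico (0 : ℝ) 1 ×ˢ Ico (0 : ℝ) 1) ∩ flow t ⁻¹' mSupp (cloud t) with hP
  have hαle : ∀ α : NNReal, 0 < α → α < 1 → 2 * (α : ENNReal) ≤ dimH (mSupp (cloud t)) := by
    intro α hα0 hα1
    obtain ⟨K, hK0, hK⟩ := exists_holder_pos ht (α := α) hα0 hα1
    have hdist : ∀ p ∈ P, ∀ q ∈ P, dist p q ≤ K * dist (flow t p) (flow t q) ^ (α : ℝ) := by
      intro p hp q hq
      have hmono : ∀ {r}, 0 ≤ r → r ≤ dist (flow t p) (flow t q) →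
          K * r ^ (α : ℝ) ≤ K * dist (flow t p) (flow t q) ^ (α : ℝ) := fun h0 h =>
        mul_le_mul_of_nonneg_left (Real.rpow_le_rpow h0 h α.coe_nonneg) hK0
      rw [Prod.dist_eq]
      refine max_le ((hK _ hp.1.1 _ hq.1.1).trans (hmono (abs_nonneg _) ?_))
        ((hK _ hp.1.2 _ hq.1.2).trans (hmono (abs_nonneg _) ?_))
      · exact le_max_left _ _
      · exact le_max_right _ _
    have hinj : InjOn (flow t) P := by
      intro p hp q hq h
      have := hdist p hp q hq
      rw [h, dist_self, Real.zero_rpow (by exact_mod_cast hα0.ne'), mul_zero] at this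
      exact dist_le_zero.mp this
    have hinv : LeftInvOn (Function.invFunOn (flow t) P) (flow t) P :=
      hinj.leftInvOn_invFunOn
    have hhold : HolderOnWith K.toNNReal α (Function.invFunOn (flow t) P) (flow t '' P) := by
      rintro _ ⟨p, hp, rfl⟩ _ ⟨q, hq, rfl⟩
      rw [hinv hp, hinv hq, edist_dist, edist_dist,
        ENNReal.ofReal_rpow_of_nonneg dist_nonneg α.coe_nonneg,
        ← ENNReal.ofReal.eq_1 K, ← ENNReal.ofReal_mul hK0]
      exact ENNReal.ofReal_le_ofReal (hdist p hp q hq)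
    have h1 := hhold.dimH_image_le hα0
    rw [hinv.image_image] at h1
    have h2 : dimH (flow t '' P) ≤ dimH (mSupp (cloud t)) :=
      dimH_mono (image_subset_iff.mpr inter_subset_right)
    have h3 := ((two_le_dimH_preimage_support t).trans h1).trans (ENNReal.div_le_div_right h2 _)
    exact (ENNReal.le_div_iff_mul_le (Or.inl (by exact_mod_cast hα0.ne'))
      (Or.inl ENNReal.coe_ne_top)).mp h3
  by_contra! hlt
  obtain ⟨d, hd⟩ : ∃ d : NNReal, (d : ENNReal) = dimH (mSupp (cloud t)) :=
    ⟨_, ENNReal.coe_toNNReal hlt.ne_top⟩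
  rw [← hd] at hlt hαle
  have hd2 : (d : ℝ) < 2 := by exact_mod_cast hlt
  have h := hαle ((d + 2) / 4) (by positivity) (by
    rw [← NNReal.coe_lt_coe]; push_cast; linarith)
  have h' : 2 * (((d : ℝ) + 2) / 4) ≤ d := by exact_mod_cast h
  linarith

/-- There are a bounded, uniformly continuous, compactly supported,
weakly divergence-free velocity `u` on `[0,∞) × ℝ²`, locally Lipschitz on
`[0,∞) × (ℝ² \ {0})`, and a family of finite Borel measures `ω t` with `ω 0 = δ₀`,
weakly advected by `u` on every `[0,T]`, whose support has Hausdorff dimension `2`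
for every `t > 0`. -/
theorem statement1 :
    ∃ (u : ℝ → ℝ × ℝ → ℝ × ℝ) (ω : ℝ → Measure (ℝ × ℝ)),
      (∃ C : ℝ, ∀ t ∈ Ici (0 : ℝ), ∀ x, ‖u t x‖ ≤ C) ∧
      UniformContinuousOn (Function.uncurry u) (Ici (0 : ℝ) ×ˢ (univ : Set (ℝ × ℝ))) ∧
      HasCompactSupport (Function.uncurry u) ∧
      (∀ t ∈ Ici (0 : ℝ), WeakDivFreeAt u t) ∧
      LocallyLipschitzOn
        (Ici (0 : ℝ) ×ˢ ({((0 : ℝ), (0 : ℝ))}ᶜ : Set (ℝ × ℝ)))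
        (Function.uncurry u) ∧
      (∀ t ∈ Ici (0 : ℝ), IsFiniteMeasure (ω t)) ∧
      ω 0 = Measure.dirac ((0 : ℝ), (0 : ℝ)) ∧
      mSupp (ω 0) = {((0 : ℝ), (0 : ℝ))} ∧
      (∀ T : ℝ, 0 < T → WeaklyAdvected T u ω) ∧
      (∀ t : ℝ, 0 < t → dimH (mSupp (ω t)) = 2) := by
  refine ⟨flowVel, cloud, ?_, ?_, hasCompactSupport_flowVel, fun t _ => weakDivFreeAt_flowVel t,
    locallyLipschitzOn_flowVel, fun t _ => inferInstance, cloud_zero, ?_,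
    fun T hT => weaklyAdvected_cloud hT.le, fun t ht => dimH_mSupp_cloud ht⟩
  · obtain ⟨C, hC⟩ := continuous_flowVel.bounded_above_of_compact_support hasCompactSupport_flowVel
    exact ⟨C, fun t _ x => hC (t, x)⟩
  · exact (hasCompactSupport_flowVel.uniformContinuous_of_continuous
      continuous_flowVel).uniformContinuousOn
  · rw [cloud_zero, mSupp_dirac]

end
end

section
/- There exist a continuous kernel K : ℝ² → ℝ², a time T > 0, and a family of finite Borel measures ω(t) on ℝ² for t ∈ [0,T], such that the velocity u(t,x) := ∫_{ℝ²} K(x−y) dω(t)(y) is continuous on [0,T]×ℝ², ω is weakly advected by u on [0,T], the Hausdorff dimension of supp ω(0) equals 0, and the Hausdorff dimension of supp ω(T) equals 1. -/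
open MeasureTheory Set

noncomputable section

theorem deriv_time_eq {φ : ℝ → ℝ × ℝ → ℝ} (hφ : Differentiable ℝ (Function.uncurry φ))
    (t : ℝ) (x : ℝ × ℝ) :
    deriv (fun s => φ s x) t = fderiv ℝ (Function.uncurry φ) (t, x) (1, 0) := by
  have h := (hφ (t, x)).hasFDerivAt.comp_hasDerivAt t
    ((hasDerivAt_id t).prodMk (hasDerivAt_const t x))
  exact h.deriv

theorem dot2_grad2_eq {φ : ℝ → ℝ × ℝ → ℝ} (hφ : Differentiable ℝ (Function.uncurry φ))
    (t : ℝ) (x v : ℝ × ℝ) :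
    dot2 v (grad2 (φ t) x) = fderiv ℝ (Function.uncurry φ) (t, x) (0, v) := by
  have h : HasFDerivAt (φ t) ((fderiv ℝ (Function.uncurry φ) (t, x)).comp
      (ContinuousLinearMap.inr ℝ ℝ (ℝ × ℝ))) x :=
    HasFDerivAt.comp (f := fun y : ℝ × ℝ => (t, y)) x (hφ (t, x)).hasFDerivAt
      (hasFDerivAt_prodMk_right t x)
  have hv : ((0 : ℝ), v) = v.1 • ((0 : ℝ), ((1 : ℝ), (0 : ℝ))) + v.2 • (0, (0, 1)) := by
    ext <;> simp
  rw [hv, map_add, map_smul, map_smul]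
  simp [dot2, grad2, h.fderiv]

/-- Transporting a finite, compactly carried measure along `C¹` trajectories that follow the
velocity `u` yields a weakly advected family. -/
theorem weaklyAdvected_map {T : ℝ} (hT : 0 ≤ T) {u : ℝ → ℝ × ℝ → ℝ × ℝ}
    {ν : Measure ℝ} [IsFiniteMeasure ν] {S : Set ℝ} (hS : IsCompact S) (hν : ∀ᵐ s ∂ν, s ∈ S)
    {X w : ℝ → ℝ → ℝ × ℝ} (hX : Continuous (Function.uncurry X))
    (hw : Continuous (Function.uncurry w))
    (hXw : ∀ t s, HasDerivAt (fun r => X r s) (w t s) t)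
    (hu : ∀ t ∈ Icc 0 T, ∀ᵐ s ∂ν, u t (X t s) = w t s)
    (hum : ∀ t ∈ Icc 0 T, Continuous (u t)) :
    WeaklyAdvected T u (fun t => ν.map (X t)) := by
  intro φ hφ _
  have hdiff : Differentiable ℝ (Function.uncurry φ) := hφ.differentiable (by simp)
  have hDc : Continuous (fderiv ℝ (Function.uncurry φ)) := hφ.continuous_fderiv (by simp)
  have hXt (t : ℝ) : Continuous (X t) := by fun_prop
  have integrable_time_label {E : ℝ × ℝ → ℝ} (hE : Continuous E) :
      Integrable E ((volume.restrict (Icc 0 T)).prod ν) := by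
    have := hE.continuousOn.integrableOn_compact (μ := volume.prod ν)
      ((isCompact_Icc (a := 0) (b := T)).prod hS)
    rwa [IntegrableOn, ← Measure.prod_restrict, Measure.restrict_eq_self_of_ae_mem hν] at this
  have integrable_label {E : ℝ → ℝ} (hE : Continuous E) : Integrable E ν := by
    have := hE.continuousOn.integrableOn_compact (μ := ν) hS
    rwa [IntegrableOn, Measure.restrict_eq_self_of_ae_mem hν] at this
  set D := fderiv ℝ (Function.uncurry φ) with hD
  have hA : Continuous fun p : ℝ × ℝ => D (p.1, X p.1 p.2) (1, 0) := by fun_prop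
  have hB : Continuous fun p : ℝ × ℝ => D (p.1, X p.1 p.2) (0, w p.1 p.2) := by fun_prop
  have hφc (t : ℝ) : Continuous (φ t) := by
    have := hφ.continuous
    fun_prop
  have hmap (t : ℝ) {f : ℝ × ℝ → ℝ} (hf : Continuous f) :
      ∫ x, f x ∂(ν.map (X t)) = ∫ s, f (X t s) ∂ν :=
    integral_map (hXt t).aemeasurable hf.aestronglyMeasurable
  have h1 : ∫ t in Icc (0 : ℝ) T, ∫ x, deriv (fun s => φ s x) t ∂(ν.map (X t)) =
      ∫ t in Icc (0 : ℝ) T, ∫ s, D (t, X t s) (1, 0) ∂ν := by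
    refine integral_congr_ae (.of_forall fun t => ?_)
    simp only [deriv_time_eq hdiff]
    exact hmap t (f := fun x => D (t, x) (1, 0)) (by fun_prop)
  have h2 : ∫ t in Icc (0 : ℝ) T, ∫ x, dot2 (u t x) (grad2 (φ t) x) ∂(ν.map (X t)) =
      ∫ t in Icc (0 : ℝ) T, ∫ s, D (t, X t s) (0, w t s) ∂ν := by
    refine setIntegral_congr_fun measurableSet_Icc fun t ht => ?_
    have := hum t ht
    simp only [dot2_grad2_eq hdiff]
    rw [hmap t (f := fun x => D (t, x) (0, u t x)) (by fun_prop)]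
    refine integral_congr_ae ?_
    filter_upwards [hu t ht] with s hs
    rw [hs]
  have key (s : ℝ) : ∫ t in Icc 0 T, (D (t, X t s) (1, 0) + D (t, X t s) (0, w t s)) =
      φ T (X T s) - φ 0 (X 0 s) := by
    rw [integral_Icc_eq_integral_Ioc, ← intervalIntegral.integral_of_le hT]
    refine intervalIntegral.integral_eq_sub_of_hasDerivAt (f := fun t => φ t (X t s))
      (fun t _ => ?_) (Continuous.intervalIntegrable (by fun_prop) _ _)
    have := (hdiff (t, X t s)).hasFDerivAt.comp_hasDerivAt t
      ((hasDerivAt_id t).prodMk (hXw t s))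
    rw [← map_add]
    simp only [Prod.mk_add_mk, add_zero, zero_add]
    exact this
  have h3 := integral_integral_swap
    (f := fun t s => D (t, X t s) (1, 0) + D (t, X t s) (0, w t s))
    (μ := volume.restrict (Icc 0 T)) (ν := ν) (integrable_time_label (by fun_prop))
  have h4 := integral_add (integrable_time_label hA).integral_prod_left (integrable_time_label hB).integral_prod_left
  have h5 : ∫ t in Icc 0 T, ∫ s, (D (t, X t s) (1, 0) + D (t, X t s) (0, w t s)) ∂ν =
      ∫ t in Icc 0 T, ((∫ s, D (t, X t s) (1, 0) ∂ν) + ∫ s, D (t, X t s) (0, w t s) ∂ν) :=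
    integral_congr_ae (.of_forall fun t => integral_add (integrable_label (by fun_prop)) (integrable_label (by fun_prop)))
  have h6 : ∫ s, (φ T (X T s) - φ 0 (X 0 s)) ∂ν =
      (∫ s, φ T (X T s) ∂ν) - ∫ s, φ 0 (X 0 s) ∂ν :=
    integral_sub (integrable_label ((hφc T).comp (hXt T))) (integrable_label ((hφc 0).comp (hXt 0)))
  simp only [key] at h3
  rw [h1, h2, hmap T (hφc T), hmap 0 (hφc 0)]
  linarith

theorem mSupp_subset_of_isClosed {μ : Measure (ℝ × ℝ)} {F : Set (ℝ × ℝ)} (hF : IsClosed F)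
    (h : μ Fᶜ = 0) : mSupp μ ⊆ F := by
  intro x hx
  by_contra hxF
  exact (hx _ (hF.isOpen_compl.mem_nhds hxF)).ne' h

theorem dimH_range_prodMk_zero_le : dimH (range fun r : ℝ => (r, (0 : ℝ))) ≤ 1 :=
  (LipschitzWith.prodMk_right (0 : ℝ)).dimH_range_le.trans Real.dimH_univ.le

theorem hasDerivAt_max_zero_sq (x : ℝ) :
    HasDerivAt (fun y : ℝ => max y 0 ^ 2) (2 * max x 0) x := by
  rcases lt_trichotomy x 0 with hx | rfl | hx
  · rw [max_eq_right hx.le, mul_zero]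
    refine (hasDerivAt_const x (0 : ℝ)).congr_of_eventuallyEq ?_
    filter_upwards [gt_mem_nhds hx] with y hy
    simp [max_eq_right hy.le]
  · have h := (hasDerivAt_pow 2 (0 : ℝ)).isLittleO
    rw [max_self, mul_zero]
    refine .of_isLittleO (Asymptotics.IsBigO.trans_isLittleO (.of_bound 1 (.of_forall fun y => ?_)) h)
    rcases le_total y 0 with hy | hy <;> simp [hy, sq_nonneg]
  · rw [max_eq_left hx.le]
    have h : HasDerivAt (fun y : ℝ => y ^ 2) (2 * x) x := by simpa using hasDerivAt_pow 2 x
    refine h.congr_of_eventuallyEq ?_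
    filter_upwards [lt_mem_nhds hx] with y hy
    simp [max_eq_left hy.le]

namespace DimensionJump

/-- The interaction kernel: particles move right with speed `2 √x` relative to a source placed
one unit below, and feel nothing from sources at or above their own height. -/
def kernel (z : ℝ × ℝ) : ℝ × ℝ := (2 * √z.1 * max z.2 0, 0)

/-- The trajectory with label `s`: labels in `[0, 1]` leave the origin at time `s`, and the label
`2` is the fixed source `(0, -1)`. -/
def traj (t s : ℝ) : ℝ × ℝ := (max (t - s) 0 ^ 2, -max (s - 1) 0)

/-- Uniform distribution of departure times, together with the source. -/
def labels : Measure ℝ := volume.restrict (Icc 0 1) + Measure.dirac 2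

/-- The advected vorticity. -/
def vorticity (t : ℝ) : Measure (ℝ × ℝ) := labels.map (traj t)

instance : IsFiniteMeasure labels := by unfold labels; infer_instance

theorem continuous_kernel : Continuous kernel := by unfold kernel; fun_prop

theorem continuous_traj : Continuous (Function.uncurry traj) := by
  unfold traj Function.uncurry; fun_prop

theorem continuous_traj_right (t : ℝ) : Continuous (traj t) := by unfold traj; fun_prop

theorem ae_labels {p : ℝ → Prop} (hp : MeasurableSet {s | p s}) (h : ∀ s ∈ Icc 0 1, p s)
    (h2 : p 2) : ∀ᵐ s ∂labels, p s := by
  rw [labels, ae_add_measure_iff, ae_dirac_iff hp]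
  exact ⟨(ae_restrict_iff' measurableSet_Icc).2 (.of_forall h), h2⟩

theorem velocity_eq (t : ℝ) (x : ℝ × ℝ) : ∫ y, kernel (x - y) ∂(vorticity t) =
    (∫ s in Icc 0 1, kernel (x - traj t s)) + kernel (x - traj t 2) := by
  have hk := continuous_kernel
  have ht := continuous_traj_right t
  rw [vorticity, integral_map ht.aemeasurable
    (by fun_prop : Continuous fun y => kernel (x - y)).aestronglyMeasurable, labels,
    integral_add_measure _ (integrable_dirac (by simp)), integral_dirac]
  exact Continuous.integrableOn_Icc (by fun_prop)

theorem continuous_velocity :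
    Continuous (Function.uncurry fun t x => ∫ y, kernel (x - y) ∂(vorticity t)) := by
  have hk := continuous_kernel
  have ht := continuous_traj
  simp only [velocity_eq]
  refine Continuous.add ?_ (by fun_prop)
  exact continuous_parametric_integral_of_continuous
    (f := fun (p : ℝ × ℝ × ℝ) s => kernel (p.2 - traj p.1 s)) (by fun_prop) isCompact_Icc

theorem velocity_traj {t s : ℝ} (ht : t ∈ Icc (0 : ℝ) 1) (hs : s ∈ Icc (0 : ℝ) 1 ∪ {2}) :
    ∫ y, kernel (traj t s - y) ∂(vorticity t) = (2 * max (t - s) 0, 0) := by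
  have h0 : ∫ r in Icc 0 1, kernel (traj t s - traj t r) = 0 := by
    refine setIntegral_eq_zero_of_forall_eq_zero fun r hr => ?_
    simp [kernel, traj, hr.2]
  have h2 : t - 2 ≤ 0 := by linarith [ht.2]
  rw [velocity_eq, h0, zero_add]
  rcases hs with hs | rfl
  · norm_num [kernel, traj, h2, hs.2]
  · simp [kernel, h2]

theorem weaklyAdvected_vorticity :
    WeaklyAdvected 1 (fun t x => ∫ y, kernel (x - y) ∂(vorticity t)) vorticity := by
  refine weaklyAdvected_map zero_le_one (isCompact_Icc (a := (0 : ℝ)) (b := 2))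
    (ae_labels measurableSet_Icc (fun s hs => ⟨hs.1, hs.2.trans one_le_two⟩) (by simp))
    continuous_traj (w := fun t s => (2 * max (t - s) 0, 0)) (by fun_prop) (fun t s => ?_)
    (fun t ht => ?_) (fun t _ => continuous_velocity.comp (by fun_prop : Continuous fun x => (t, x)))
  · exact ((hasDerivAt_max_zero_sq (t - s)).comp_sub_const t s).prodMk (hasDerivAt_const t _)
  · have := ae_labels (p := fun s => s ∈ Icc (0 : ℝ) 1 ∪ {2})
      (measurableSet_Icc.union (measurableSet_singleton _)) (fun s => Or.inl) (Or.inr rfl)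
    filter_upwards [this] with s hs using velocity_traj ht hs

theorem vorticity_compl_eq_zero {t : ℝ} {F : Set (ℝ × ℝ)} (hF : IsClosed F)
    (h : ∀ s ∈ Icc (0 : ℝ) 1, traj t s ∈ F) (h2 : traj t 2 ∈ F) : vorticity t Fᶜ = 0 := by
  have hm := (continuous_traj_right t).measurable
  rw [vorticity, Measure.map_apply hm hF.measurableSet.compl]
  exact ae_labels (p := fun s => traj t s ∈ F) (hm hF.measurableSet) h h2

theorem dimH_mSupp_vorticity_zero : dimH (mSupp (vorticity 0)) = 0 := by
  have hfin : ({(0, 0), (0, -1)} : Set (ℝ × ℝ)).Finite := by simp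
  refine (hfin.subset (mSupp_subset_of_isClosed hfin.isClosed
    (vorticity_compl_eq_zero hfin.isClosed (fun s hs => ?_) ?_))).dimH_zero
  · simp [traj, hs.1, hs.2]
  · norm_num [traj]

theorem traj_mem_mSupp {t s : ℝ} (hs : s ∈ Ioo (0 : ℝ) 1) : traj t s ∈ mSupp (vorticity t) := by
  intro U hU
  obtain ⟨V, hVU, hV, hsV⟩ := mem_nhds_iff.1 hU
  have ht := continuous_traj_right t
  calc 0 < volume (traj t ⁻¹' V ∩ Ioo 0 1) :=
        ((hV.preimage ht).inter isOpen_Ioo).measure_pos _ ⟨s, hsV, hs⟩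
    _ ≤ volume (traj t ⁻¹' V ∩ Icc 0 1) := by gcongr; exact Ioo_subset_Icc_self
    _ = volume.restrict (Icc 0 1) (traj t ⁻¹' V) :=
        (Measure.restrict_apply (hV.preimage ht).measurableSet).symm
    _ ≤ labels (traj t ⁻¹' V) := by rw [labels, Measure.add_apply]; exact le_self_add
    _ = vorticity t V := (Measure.map_apply ht.measurable hV.measurableSet).symm
    _ ≤ vorticity t U := measure_mono hVU

theorem dimH_mSupp_vorticity_one : dimH (mSupp (vorticity 1)) = 1 := by
  apply le_antisymm
  · have hcl : IsClosed (range (fun r : ℝ => (r, (0 : ℝ))) ∪ {(0, -1)}) :=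
      (Isometry.of_dist_eq fun a b => by simp [Prod.dist_eq]).isClosedEmbedding.isClosed_range.union
        isClosed_singleton
    refine (dimH_mono (mSupp_subset_of_isClosed hcl
      (vorticity_compl_eq_zero hcl (fun s hs => Or.inl ?_) (Or.inr ?_)))).trans ?_
    · exact ⟨max (1 - s) 0 ^ 2, by simp [traj, hs.2]⟩
    · norm_num [traj]
    · rw [dimH_union, dimH_singleton]
      exact max_le dimH_range_prodMk_zero_le zero_le_one
  · have hsub : Ioo (0 : ℝ) 1 ⊆ Prod.fst '' mSupp (vorticity 1) := by
      intro r hr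
      have h1 : √r < 1 := by rw [Real.sqrt_lt' one_pos]; simpa using hr.2
      have h0 : 0 < √r := Real.sqrt_pos.2 hr.1
      refine ⟨traj 1 (1 - √r), traj_mem_mSupp ⟨by linarith, by linarith⟩, ?_⟩
      simp [traj, hr.1.le]
    have hdim : dimH (Ioo (0 : ℝ) 1) = 1 := by
      rw [Real.dimH_of_nonempty_interior (by rw [interior_Ioo]; exact nonempty_Ioo.2 one_pos)]
      simp
    calc 1 = dimH (Ioo (0 : ℝ) 1) := hdim.symm
      _ ≤ dimH (Prod.fst '' mSupp (vorticity 1)) := dimH_mono hsub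
      _ ≤ dimH (mSupp (vorticity 1)) := LipschitzWith.prod_fst.dimH_image_le _

end DimensionJump

/-- There are a continuous kernel `K : ℝ² → ℝ²`, a time `T > 0` and a
family of finite Borel measures `ω t`, weakly advected by the induced velocity
`u t x = ∫ K (x - y) dω(t)(y)`, which is continuous on `[0,T] × ℝ²`, such that the
support of `ω 0` has Hausdorff dimension `0` and the support of `ω T` has Hausdorff
dimension `1`. -/
theorem statement2 :
    ∃ (K : ℝ × ℝ → ℝ × ℝ) (T : ℝ) (ω : ℝ → Measure (ℝ × ℝ)),
      Continuous K ∧ 0 < T ∧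
      (∀ t ∈ Icc (0 : ℝ) T, IsFiniteMeasure (ω t)) ∧
      ContinuousOn
        (Function.uncurry (fun t x => ∫ y, K (x - y) ∂(ω t)))
        (Icc (0 : ℝ) T ×ˢ (univ : Set (ℝ × ℝ))) ∧
      WeaklyAdvected T (fun t x => ∫ y, K (x - y) ∂(ω t)) ω ∧
      dimH (mSupp (ω 0)) = 0 ∧
      dimH (mSupp (ω T)) = 1 := by
  exact ⟨DimensionJump.kernel, 1, DimensionJump.vorticity, DimensionJump.continuous_kernel, one_pos,
    fun t _ => Measure.isFiniteMeasure_map _ _, DimensionJump.continuous_velocity.continuousOn,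
    DimensionJump.weaklyAdvected_vorticity, DimensionJump.dimH_mSupp_vorticity_zero,
    DimensionJump.dimH_mSupp_vorticity_one⟩

end
end

section
/- There exist a continuous matrix-valued kernel K : ℝ³ → ℝ^{3×3}, a time T > 0, and a family of finite ℝ³-valued Borel vector measures ω(t) on ℝ³ for t ∈ [0,T], such that: for each t there is a finite signed Borel measure ν(t) on ℝ³ (the distributional divergence of ω(t)) satisfying ∫ ψ dν(t) = −∫ ∇ψ(x)·dω(t)(x) for every smooth compactly supported ψ : ℝ³ → ℝ; the velocity u(t,x) := ∫ K(x−y) dω(t)(y) is continuous and weakly divergence free; ω is weakly advected by u on [0,T] in the vector-valued sense with stretching; the Hausdorff dimension of the support of ω(0) equals 1; and the Hausdorff dimension of the support of ω(T) equals 2. -/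
open MeasureTheory Set

noncomputable section

/-- Integral of a real function against a finite signed Borel measure, via the
Jordan decomposition. -/
def sInt (f : (Fin 3 → ℝ) → ℝ) (s : SignedMeasure (Fin 3 → ℝ)) : ℝ :=
  (∫ x, f x ∂s.toJordanDecomposition.posPart)
    - ∫ x, f x ∂s.toJordanDecomposition.negPart

/-- Integral `∫ f · dω` of a vector field against an `ℝ³`-valued vector measure
(given by its three signed components). -/
def vInt (f : (Fin 3 → ℝ) → (Fin 3 → ℝ))
    (ω : Fin 3 → SignedMeasure (Fin 3 → ℝ)) : ℝ :=
  ∑ i, sInt (fun x => f x i) (ω i)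

/-- The support of an `ℝ³`-valued vector measure: the complement of the largest open
set on whose Borel subsets all components vanish (equivalently, the smallest closed
set such that the measure vanishes on every Borel set disjoint from it). -/
def vSupp (ω : Fin 3 → SignedMeasure (Fin 3 → ℝ)) : Set (Fin 3 → ℝ) :=
  (⋃₀ {U : Set (Fin 3 → ℝ) |
      IsOpen U ∧ ∀ V : Set (Fin 3 → ℝ), MeasurableSet V → V ⊆ U → ∀ i, ω i V = 0})ᶜ

/-- The velocity `u(x) = ∫ K (x - y) dω(y)` induced by a matrix kernel and an
`ℝ³`-valued vector measure. -/
def uVel (K : (Fin 3 → ℝ) → Matrix (Fin 3) (Fin 3) ℝ)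
    (ω : Fin 3 → SignedMeasure (Fin 3 → ℝ)) (x : Fin 3 → ℝ) : Fin 3 → ℝ :=
  fun i => ∑ j, sInt (fun y => K (x - y) i j) (ω j)

/-- `ν` is the distributional divergence of the vector measure `ω`
(`∫ ψ dν = -∫ ∇ψ · dω` for all test functions `ψ`). -/
def IsDistribDiv (ω : Fin 3 → SignedMeasure (Fin 3 → ℝ))
    (ν : SignedMeasure (Fin 3 → ℝ)) : Prop :=
  ∀ ψ : (Fin 3 → ℝ) → ℝ, ContDiff ℝ (⊤ : ℕ∞) ψ → HasCompactSupport ψ →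
    sInt ψ ν = -(∑ i, sInt (fun x => fderiv ℝ ψ x (Pi.single i 1)) (ω i))

/-- A velocity field on `ℝ³` is weakly divergence free (with respect to Lebesgue
measure) at a given time. -/
def WeakDivFree3At (u : (Fin 3 → ℝ) → (Fin 3 → ℝ)) : Prop :=
  ∀ ψ : (Fin 3 → ℝ) → ℝ, ContDiff ℝ (⊤ : ℕ∞) ψ → HasCompactSupport ψ →
    ∫ x, (∑ i, u x i * fderiv ℝ ψ x (Pi.single i 1)) = 0

/-- The family of `ℝ³`-valued vector measures `ω t`, with distributional divergences
`ν t`, is weakly advected (in the vector-valued sense with stretching) by the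
continuous velocity `u` on `[0,T]`. -/
def WeaklyAdvectedStretch (T : ℝ) (u : ℝ → (Fin 3 → ℝ) → (Fin 3 → ℝ))
    (ω : ℝ → Fin 3 → SignedMeasure (Fin 3 → ℝ))
    (ν : ℝ → SignedMeasure (Fin 3 → ℝ)) : Prop :=
  ∀ φ : ℝ → (Fin 3 → ℝ) → (Fin 3 → ℝ),
    ContDiff ℝ (⊤ : ℕ∞) (Function.uncurry φ) → HasCompactSupport (Function.uncurry φ) →
    (∫ t in Icc (0 : ℝ) T, vInt (fun x => deriv (fun s => φ s x) t) (ω t))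
      - vInt (φ T) (ω T) + vInt (φ 0) (ω 0)
      + (∫ t in Icc (0 : ℝ) T, vInt (fun x => fderiv ℝ (φ t) x (u t x)) (ω t))
      - (∫ t in Icc (0 : ℝ) T,
          vInt (fun x j => ∑ i, u t x i * fderiv ℝ (fun y => φ t y i) x (Pi.single j 1))
            (ω t))
      - (∫ t in Icc (0 : ℝ) T, sInt (fun x => ∑ i, φ t x i * u t x i) (ν t)) = 0

theorem sInt_zero (f : (Fin 3 → ℝ) → ℝ) : sInt f 0 = 0 := by
  simp [sInt, SignedMeasure.toJordanDecomposition_zero]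

theorem sInt_jordan (f : (Fin 3 → ℝ) → ℝ) (j : JordanDecomposition (Fin 3 → ℝ)) :
    sInt f j.toSignedMeasure = (∫ x, f x ∂j.posPart) - ∫ x, f x ∂j.negPart := by
  rw [sInt, SignedMeasure.toJordanDecomposition_eq rfl]

theorem sInt_toSignedMeasure (f : (Fin 3 → ℝ) → ℝ) (μ : Measure (Fin 3 → ℝ))
    [IsFiniteMeasure μ] : sInt f μ.toSignedMeasure = ∫ x, f x ∂μ := by
  have h := sInt_jordan f ⟨μ, 0, Measure.MutuallySingular.zero_right⟩
  simpa [JordanDecomposition.toSignedMeasure] using h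

namespace FilamentBranching

/-- Velocity profile, equal to `2 √s` on `[0, 1]`; it is not Lipschitz at `0`. -/
def profile (s : ℝ) : ℝ := 2 * √(min s (2 - s))

/-- Position at time `t` of the particle labelled `s`: for `s ∈ [0, 1]` it leaves the origin
at time `s`, for `s ∈ [2, 3]` it rests at the point `10`. -/
def pos (t s : ℝ) : ℝ := max (t - s) 0 ^ 2 + 10 * max 0 (min (s - 1) 1)

/-- Labels of the filaments. -/
def labels : Set ℝ := Icc 0 1 ∪ Icc 2 3

/-- Labels of the filaments, together with the height along them. -/
def params : Set (ℝ × ℝ) := labels ×ˢ Icc 0 1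

/-- The vertical plane spanned by the diagonal direction. -/
def emb (c : ℝ × ℝ) : Fin 3 → ℝ := ![c.1, c.1, c.2]

/-- The point at height `c.2` of the filament labelled `c.1`. -/
def path (t : ℝ) (c : ℝ × ℝ) : Fin 3 → ℝ := emb (pos t c.1, c.2)

/-- A sum of two horizontal shear flows, generated by the vertical component. -/
def kernel (x : Fin 3 → ℝ) : Matrix (Fin 3) (Fin 3) ℝ :=
  !![0, 0, profile (x 1 + 10); 0, 0, profile (x 0 + 10); 0, 0, 0]

theorem isCompact_labels : IsCompact labels := isCompact_Icc.union isCompact_Icc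

theorem isCompact_params : IsCompact params := isCompact_labels.prod isCompact_Icc

instance : IsFiniteMeasure (volume.restrict params) :=
  isFiniteMeasure_restrict.2 isCompact_params.measure_lt_top.ne

instance : IsFiniteMeasure (volume.restrict labels) :=
  isFiniteMeasure_restrict.2 isCompact_labels.measure_lt_top.ne

theorem continuous_profile : Continuous profile := by unfold profile; fun_prop

theorem continuous_pos : Continuous fun q : ℝ × ℝ => pos q.1 q.2 := by unfold pos; fun_prop

theorem continuous_emb : Continuous emb := by
  refine continuous_pi fun i => ?_
  fin_cases i <;> simp [emb] <;> fun_prop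

theorem continuous_path_uncurry : Continuous fun q : ℝ × ℝ × ℝ => path q.1 q.2 := by
  unfold path
  exact continuous_emb.comp ((continuous_pos.comp (by fun_prop :
    Continuous fun q : ℝ × ℝ × ℝ => (q.1, q.2.1))).prodMk (by fun_prop))

theorem continuous_path (t : ℝ) : Continuous (path t) :=
  continuous_path_uncurry.comp (by fun_prop : Continuous fun c : ℝ × ℝ => (t, c))

theorem continuous_kernel : Continuous kernel := by
  refine continuous_pi fun i => continuous_pi fun j => ?_
  have h := continuous_profile
  fin_cases i <;> fin_cases j <;> simp [kernel] <;> fun_prop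

theorem isometry_emb : Isometry emb := by
  refine Isometry.of_dist_eq fun a b => ?_
  refine le_antisymm ((dist_pi_le_iff dist_nonneg).2 fun i => ?_) (max_le ?_ ?_)
  · fin_cases i <;> simp [emb, Prod.dist_eq]
  · exact dist_le_pi_dist (emb a) (emb b) 0
  · exact dist_le_pi_dist (emb a) (emb b) 2

/-- The bundle of vertical filaments at time `t`. -/
def filaments (t : ℝ) : Measure (Fin 3 → ℝ) := (volume.restrict params).map (path t)

/-- The endpoints of the filaments at height `z` and time `t`. -/
def endpoints (t z : ℝ) : Measure (Fin 3 → ℝ) :=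
  (volume.restrict labels).map fun s => path t (s, z)

instance (t : ℝ) : IsFiniteMeasure (filaments t) := by unfold filaments; infer_instance

instance (t z : ℝ) : IsFiniteMeasure (endpoints t z) := by unfold endpoints; infer_instance

/-- The vertical vector measure carried by the filaments. -/
def vorticity (t : ℝ) : Fin 3 → SignedMeasure (Fin 3 → ℝ) :=
  ![0, 0, (filaments t).toSignedMeasure]

theorem continuous_path_left (t z : ℝ) : Continuous fun s => path t (s, z) :=
  (continuous_path t).comp (by fun_prop)

theorem endpoints_mutuallySingular (t : ℝ) : endpoints t 0 ⟂ₘ endpoints t 1 := by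
  have hs : MeasurableSet {x : Fin 3 → ℝ | x 2 ≠ 0} :=
    (measurableSet_singleton (0 : ℝ)).compl.preimage (measurable_pi_apply 2)
  refine ⟨_, hs, ?_, ?_⟩
  · rw [endpoints, Measure.map_apply (continuous_path_left t 0).measurable hs]
    simp [path, emb]
  · rw [endpoints, Measure.map_apply (continuous_path_left t 1).measurable hs.compl]
    simp [path, emb]

/-- The divergence of the filaments, carried by their endpoints. -/
def divergence (t : ℝ) : SignedMeasure (Fin 3 → ℝ) :=
  (JordanDecomposition.mk (endpoints t 0) (endpoints t 1)
    (endpoints_mutuallySingular t)).toSignedMeasure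

theorem sInt_filaments {f : (Fin 3 → ℝ) → ℝ} (hf : Continuous f) (t : ℝ) :
    sInt f (vorticity t 2) = ∫ c in params, f (path t c) := by
  have : vorticity t 2 = (filaments t).toSignedMeasure := rfl
  rw [this, sInt_toSignedMeasure, filaments,
    integral_map (continuous_path t).aemeasurable hf.aestronglyMeasurable]

theorem vInt_vorticity {f : (Fin 3 → ℝ) → Fin 3 → ℝ} (t : ℝ) (hf : Continuous fun x => f x 2) :
    vInt f (vorticity t) = ∫ c in params, f (path t c) 2 := by
  rw [vInt, Fin.sum_univ_three, sInt_filaments hf]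
  simp [vorticity, sInt_zero]

theorem sInt_divergence {f : (Fin 3 → ℝ) → ℝ} (hf : Continuous f) (t : ℝ) :
    sInt f (divergence t)
      = (∫ s in labels, f (path t (s, 0))) - ∫ s in labels, f (path t (s, 1)) := by
  rw [divergence, sInt_jordan]
  simp only [endpoints]
  rw [integral_map (continuous_path_left t 0).aemeasurable hf.aestronglyMeasurable,
    integral_map (continuous_path_left t 1).aemeasurable hf.aestronglyMeasurable]

/-- The horizontal speed generated by the filaments. -/
def speed (t a : ℝ) : ℝ := ∫ c in params, profile (a - pos t c.1 + 10)

theorem continuous_speed : Continuous fun q : ℝ × ℝ => speed q.1 q.2 := by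
  refine continuous_parametric_integral_of_continuous
    (f := fun (q : ℝ × ℝ) (c : ℝ × ℝ) => profile (q.2 - pos q.1 c.1 + 10)) ?_ isCompact_params
  have h : Continuous fun q : (ℝ × ℝ) × (ℝ × ℝ) => pos q.1.1 q.2.1 :=
    continuous_pos.comp (by fun_prop : Continuous fun q : (ℝ × ℝ) × (ℝ × ℝ) => (q.1.1, q.2.1))
  exact continuous_profile.comp (by fun_prop)

theorem uVel_vorticity (t : ℝ) (x : Fin 3 → ℝ) :
    uVel kernel (vorticity t) x = ![speed t (x 1), speed t (x 0), 0] := by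
  have h (i : Fin 3) : uVel kernel (vorticity t) x i
      = ∫ c in params, kernel (x - path t c) i 2 := by
    have hc : Continuous fun y => kernel (x - y) i 2 :=
      (continuous_kernel.comp (continuous_const.sub continuous_id)).matrix_elem i 2
    rw [uVel, Fin.sum_univ_three, sInt_filaments hc]
    simp [vorticity, sInt_zero]
  ext i
  rw [h]
  fin_cases i <;> simp [kernel, speed, path, emb]

theorem pos_eq_of_mem_left {s : ℝ} (hs : s ∈ Icc (0 : ℝ) 1) (t : ℝ) :
    pos t s = max (t - s) 0 ^ 2 := by
  have : min (s - 1) 1 ≤ 0 := (min_le_left _ _).trans (by linarith [hs.2])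
  simp [pos, this]

theorem pos_eq_of_mem_right {t s : ℝ} (ht : t ≤ 1) (hs : s ∈ Icc (2 : ℝ) 3) : pos t s = 10 := by
  have h1 : min (s - 1) 1 = 1 := min_eq_right (by linarith [hs.1])
  have h2 : max (t - s) 0 = 0 := max_eq_right (by linarith [hs.1])
  simp [pos, h1, h2]

theorem profile_eq_zero {s : ℝ} (hs : s ≤ 0 ∨ 2 ≤ s) : profile s = 0 := by
  have : min s (2 - s) ≤ 0 := by
    rcases hs with h | h
    · exact (min_le_left _ _).trans h
    · exact (min_le_right _ _).trans (by linarith)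
  simp [profile, Real.sqrt_eq_zero_of_nonpos this]

theorem profile_sq {r : ℝ} (h0 : 0 ≤ r) (h1 : r ≤ 1) : profile (r ^ 2) = 2 * r := by
  have : min (r ^ 2) (2 - r ^ 2) = r ^ 2 := min_eq_left (by nlinarith)
  rw [profile, this, Real.sqrt_sq h0]

theorem pos_mem_left {t s : ℝ} (ht : t ∈ Icc (0 : ℝ) 1) (hs : s ∈ Icc (0 : ℝ) 1) :
    pos t s ∈ Icc (0 : ℝ) 1 := by
  rw [pos_eq_of_mem_left hs]
  exact ⟨sq_nonneg _, pow_le_one₀ (le_max_right _ _)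
    (max_le (by linarith [ht.2, hs.1]) zero_le_one)⟩

theorem profile_pos {t s : ℝ} (ht : t ∈ Icc (0 : ℝ) 1) (hs : s ∈ labels) :
    profile (pos t s) = 2 * max (t - s) 0 := by
  rcases hs with hs | hs
  · rw [pos_eq_of_mem_left hs]
    exact profile_sq (le_max_right _ _) (max_le (by linarith [ht.2, hs.1]) zero_le_one)
  · rw [pos_eq_of_mem_right ht.2 hs, profile_eq_zero (Or.inr (by norm_num)),
      max_eq_right (by linarith [ht.2, hs.1]), mul_zero]

theorem volume_Icc_prod : volume.real (Icc (2 : ℝ) 3 ×ˢ Icc (0 : ℝ) 1) = 1 := by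
  rw [Measure.volume_eq_prod, measureReal_prod_prod]
  norm_num

theorem speed_pos {t s : ℝ} (ht : t ∈ Icc (0 : ℝ) 1) (hs : s ∈ labels) :
    speed t (pos t s) = 2 * max (t - s) 0 := by
  have hm : MeasurableSet (Icc (2 : ℝ) 3 ×ˢ Icc (0 : ℝ) 1) :=
    measurableSet_Icc.prod measurableSet_Icc
  have hsub : Icc (2 : ℝ) 3 ×ˢ Icc (0 : ℝ) 1 ⊆ params := prod_mono subset_union_right subset_rfl
  have hp : pos t s ∈ Icc (0 : ℝ) 1 ∨ pos t s = 10 :=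
    hs.imp (pos_mem_left ht) (pos_eq_of_mem_right ht.2)
  have h : ∀ c ∈ params, profile (pos t s - pos t c.1 + 10)
      = (Icc (2 : ℝ) 3 ×ˢ Icc (0 : ℝ) 1).indicator (fun _ => profile (pos t s)) c := by
    rintro c ⟨hc | hc, hz⟩
    · have hc' := pos_mem_left ht hc
      have hn : c ∉ Icc (2 : ℝ) 3 ×ˢ Icc (0 : ℝ) 1 := fun h => by linarith [h.1.1, hc.2]
      rw [indicator_of_notMem hn]
      refine profile_eq_zero (Or.inr ?_)
      rcases hp with hp | hp
      · linarith [hp.1, hc'.2]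
      · linarith [hc'.2]
    · rw [indicator_of_mem (show c ∈ Icc (2 : ℝ) 3 ×ˢ Icc (0 : ℝ) 1 from ⟨hc, hz⟩),
        pos_eq_of_mem_right ht.2 hc, sub_add_cancel]
  rw [speed, setIntegral_congr_fun isCompact_params.measurableSet h, setIntegral_indicator hm,
    inter_eq_right.2 hsub, setIntegral_const, volume_Icc_prod, one_smul, profile_pos ht hs]

theorem hasDerivAt_max_sq (r : ℝ) : HasDerivAt (fun r : ℝ => max r 0 ^ 2) (2 * max r 0) r := by
  rcases lt_trichotomy r 0 with h | rfl | h
  · rw [max_eq_right h.le, mul_zero]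
    refine (hasDerivAt_const r (0 : ℝ)).congr_of_eventuallyEq ?_
    filter_upwards [Iio_mem_nhds h] with x hx
    simp [max_eq_right (mem_Iio.1 hx).le]
  · rw [max_self, mul_zero]
    refine HasDerivAt.of_isLittleO ?_
    have : (fun x : ℝ => x ^ 2) =o[nhds 0] fun x => x := by
      simpa using Asymptotics.isLittleO_pow_id (𝕜 := ℝ) (n := 2) (by norm_num)
    refine (Asymptotics.IsBigO.of_norm_le fun x => ?_).trans_isLittleO (by simpa using this)
    rcases le_total x 0 with hx | hx <;> simp [hx, sq_nonneg]
  · rw [max_eq_left h.le]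
    refine ((hasDerivAt_pow 2 r).congr_of_eventuallyEq ?_).congr_deriv (by simp)
    filter_upwards [Ioi_mem_nhds h] with x hx
    simp [max_eq_left (mem_Ioi.1 hx).le]

theorem hasDerivAt_pos (t s : ℝ) : HasDerivAt (fun t => pos t s) (2 * max (t - s) 0) t := by
  have h := (hasDerivAt_max_sq (t - s)).comp t ((hasDerivAt_id t).sub_const s)
  simpa [pos, Function.comp_def] using h.add_const (10 * max 0 (min (s - 1) 1))

theorem hasDerivAt_path (t : ℝ) (c : ℝ × ℝ) :
    HasDerivAt (fun t => path t c) ![2 * max (t - c.1) 0, 2 * max (t - c.1) 0, 0] t := by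
  refine hasDerivAt_pi.2 fun i => ?_
  fin_cases i
  · exact hasDerivAt_pos t c.1
  · exact hasDerivAt_pos t c.1
  · exact hasDerivAt_const t c.2

theorem hasDerivAt_path_height (t s z : ℝ) :
    HasDerivAt (fun z => path t (s, z)) (Pi.single 2 1) z := by
  refine hasDerivAt_pi.2 fun i => ?_
  fin_cases i
  · simpa [path, emb] using hasDerivAt_const z (pos t s)
  · simpa [path, emb] using hasDerivAt_const z (pos t s)
  · simpa [path, emb] using hasDerivAt_id' z

theorem setIntegral_Icc_deriv {f f' : ℝ → ℝ} (h : ∀ x, HasDerivAt f (f' x) x)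
    (hf' : Continuous f') : ∫ x in Icc (0 : ℝ) 1, f' x = f 1 - f 0 := by
  rw [integral_Icc_eq_integral_Ioc, ← intervalIntegral.integral_of_le zero_le_one]
  exact intervalIntegral.integral_eq_sub_of_hasDerivAt (fun x _ => h x)
    (hf'.intervalIntegrable 0 1)

theorem setIntegral_params_deriv {f f' : ℝ × ℝ → ℝ}
    (h : ∀ s z, HasDerivAt (fun z => f (s, z)) (f' (s, z)) z) (hf : Continuous f)
    (hf' : Continuous f') :
    ∫ c in params, f' c = (∫ s in labels, f (s, 1)) - ∫ s in labels, f (s, 0) := by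
  have hi (z : ℝ) : IntegrableOn (fun s => f (s, z)) labels :=
    (hf.comp (by fun_prop : Continuous fun s : ℝ => (s, z))).continuousOn.integrableOn_compact
      isCompact_labels
  rw [← integral_sub (hi 1) (hi 0), Measure.volume_eq_prod, params, setIntegral_prod _
    (hf'.continuousOn.integrableOn_compact isCompact_params)]
  congr 1 with s
  exact setIntegral_Icc_deriv (h s) (hf'.comp (by fun_prop))

theorem isDistribDiv (t : ℝ) : IsDistribDiv (vorticity t) (divergence t) := by
  intro ψ hψ _
  have hd : Continuous (fderiv ℝ ψ) := hψ.continuous_fderiv (by simp)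
  have hv := vInt_vorticity (f := fun x i => fderiv ℝ ψ x (Pi.single i 1)) t (by fun_prop)
  rw [vInt] at hv
  have hi := setIntegral_params_deriv (f := fun c => ψ (path t c))
    (f' := fun c => fderiv ℝ ψ (path t c) (Pi.single 2 1))
    (fun s z => ((hψ.differentiable (by simp)) _).hasFDerivAt.comp_hasDerivAt z
      (hasDerivAt_path_height t s z))
    (hψ.continuous.comp (continuous_path t))
    ((hd.comp (continuous_path t)).clm_apply continuous_const)
  rw [sInt_divergence hψ.continuous, hv, hi]
  ring

theorem continuous_uVel :
    Continuous (Function.uncurry fun t x => uVel kernel (vorticity t) x) := by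
  have h (i : Fin 3) : Continuous fun q : ℝ × (Fin 3 → ℝ) => speed q.1 (q.2 i) :=
    continuous_speed.comp (by fun_prop : Continuous fun q : ℝ × (Fin 3 → ℝ) => (q.1, q.2 i))
  refine continuous_pi fun i => ?_
  simp only [Function.uncurry_def, uVel_vorticity]
  fin_cases i
  · exact h 1
  · exact h 0
  · exact continuous_const

theorem integral_shear {g : ℝ → ℝ} (hg : Continuous g) {i j : Fin 3} (hij : i ≠ j)
    {ψ : (Fin 3 → ℝ) → ℝ} (hψ : ContDiff ℝ (⊤ : ℕ∞) ψ) (hc : HasCompactSupport ψ) :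
    Integrable (fun x => g (x j) * fderiv ℝ ψ x (Pi.single i 1)) ∧
      ∫ x, g (x j) * fderiv ℝ ψ x (Pi.single i 1) = 0 := by
  have hd : Continuous fun x => fderiv ℝ ψ x (Pi.single i 1) :=
    (hψ.continuous_fderiv (by simp)).clm_apply continuous_const
  have hg' : Continuous fun x : Fin 3 → ℝ => g (x j) := by fun_prop
  have hi : Integrable (fun x => g (x j) * fderiv ℝ ψ x (Pi.single i 1)) :=
    (hg'.mul hd).integrable_of_hasCompactSupport (hc.fderiv_apply ℝ _).mul_left
  refine ⟨hi, ?_⟩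
  have key := integral_bilinear_hasLineDerivAt_right_eq_neg_left_of_integrable
    (μ := volume) (f := fun x : Fin 3 → ℝ => g (x j)) (f' := fun _ => 0) (g := ψ)
    (g' := fun x => fderiv ℝ ψ x (Pi.single i 1)) (v := Pi.single i 1)
    (B := ContinuousLinearMap.mul ℝ ℝ) (by simp) (by simpa using hi)
    ((hg'.mul hψ.continuous).integrable_of_hasCompactSupport hc.mul_left)
    (fun x _ => ?_) (fun x _ => ((hψ.differentiable (by simp)) x).hasFDerivAt.hasLineDerivAt _)
  · simpa using key
  · simpa [HasLineDerivAt, hij.symm] using hasDerivAt_const (0 : ℝ) (g (x j))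

theorem weakDivFree (t : ℝ) : WeakDivFree3At (uVel kernel (vorticity t)) := by
  intro ψ hψ hc
  have hg : Continuous (speed t) :=
    continuous_speed.comp (by fun_prop : Continuous fun a : ℝ => (t, a))
  obtain ⟨h0, h0'⟩ := integral_shear hg (i := 0) (j := 1) (by decide) hψ hc
  obtain ⟨h1, h1'⟩ := integral_shear hg (i := 1) (j := 0) (by decide) hψ hc
  simp only [uVel_vorticity, Fin.sum_univ_three, Matrix.cons_val, zero_mul, add_zero]
  rw [integral_add h0 h1, h0', h1', add_zero]

theorem setIntegral_swap {f : ℝ → ℝ × ℝ → ℝ} (hf : Continuous (Function.uncurry f)) :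
    ∫ t in Icc (0 : ℝ) 1, ∫ c in params, f t c = ∫ c in params, ∫ t in Icc (0 : ℝ) 1, f t c := by
  refine integral_integral_swap ?_
  rw [Measure.prod_restrict]
  exact hf.continuousOn.integrableOn_compact (isCompact_Icc.prod isCompact_params)

/-- The terms of the weak formulation that see the endpoints of the filaments cancel. -/
theorem stretching_cancel {Φ : ℝ × (Fin 3 → ℝ) → Fin 3 → ℝ} (hΦ : ContDiff ℝ (⊤ : ℕ∞) Φ) (t : ℝ) :
    vInt (fun x j => ∑ i, uVel kernel (vorticity t) x i
        * fderiv ℝ (fun y => Φ (t, y) i) x (Pi.single j 1)) (vorticity t)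
      = -sInt (fun x => ∑ i, Φ (t, x) i * uVel kernel (vorticity t) x i) (divergence t) := by
  have hu (i : Fin 3) : Continuous fun x => uVel kernel (vorticity t) x i :=
    (continuous_apply i).comp
      (continuous_uVel.comp (by fun_prop : Continuous fun x : Fin 3 → ℝ => (t, x)))
  have hs (i : Fin 3) : ContDiff ℝ (⊤ : ℕ∞) fun y => Φ (t, y) i :=
    (contDiff_apply ℝ ℝ i).comp (hΦ.comp (contDiff_const.prodMk contDiff_id))
  have hd (i : Fin 3) : Continuous fun x => fderiv ℝ (fun y => Φ (t, y) i) x (Pi.single 2 1) :=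
    ((hs i).continuous_fderiv (by simp)).clm_apply continuous_const
  have hsum : Continuous fun x => ∑ i, Φ (t, x) i * uVel kernel (vorticity t) x i :=
    continuous_finsetSum _ fun i _ => (hs i).continuous.mul (hu i)
  have hsum' : Continuous fun x => ∑ i, uVel kernel (vorticity t) x i
      * fderiv ℝ (fun y => Φ (t, y) i) x (Pi.single 2 1) :=
    continuous_finsetSum _ fun i _ => (hu i).mul (hd i)
  have hconst (s z : ℝ) : uVel kernel (vorticity t) (path t (s, z))
      = uVel kernel (vorticity t) (path t (s, 0)) := by
    simp [uVel_vorticity, path, emb]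
  rw [vInt_vorticity t hsum', sInt_divergence hsum, setIntegral_params_deriv
    (f := fun c => ∑ i, Φ (t, path t c) i * uVel kernel (vorticity t) (path t c) i)
    (f' := fun c => ∑ i, uVel kernel (vorticity t) (path t c) i
      * fderiv ℝ (fun y => Φ (t, y) i) (path t c) (Pi.single 2 1))
    (fun s z => ?_) (hsum.comp (continuous_path t)) (hsum'.comp (continuous_path t))]
  · ring
  · simp only [hconst s]
    refine HasDerivAt.fun_sum fun i _ => ?_
    rw [mul_comm]
    exact (((hs i).differentiable (by simp) _).hasFDerivAt.comp_hasDerivAt z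
      (hasDerivAt_path_height t s z)).mul_const _

/-- The velocity of the filaments. -/
def drift (t : ℝ) (c : ℝ × ℝ) : Fin 3 → ℝ := ![2 * max (t - c.1) 0, 2 * max (t - c.1) 0, 0]

theorem continuous_drift : Continuous fun q : ℝ × ℝ × ℝ => drift q.1 q.2 := by
  refine continuous_pi fun i => ?_
  fin_cases i <;> simp [drift] <;> fun_prop

theorem uVel_path {t : ℝ} (ht : t ∈ Icc (0 : ℝ) 1) {c : ℝ × ℝ} (hc : c ∈ params) :
    uVel kernel (vorticity t) (path t c) = drift t c := by
  have h := speed_pos ht hc.1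
  simp [uVel_vorticity, path, emb, h, drift]

theorem hasFDerivAt_of_contDiff {Φ : ℝ × (Fin 3 → ℝ) → Fin 3 → ℝ} (hΦ : ContDiff ℝ (⊤ : ℕ∞) Φ)
    (q : ℝ × (Fin 3 → ℝ)) : HasFDerivAt Φ (fderiv ℝ Φ q) q :=
  (hΦ.differentiable (by simp) q).hasFDerivAt

theorem vInt_deriv_time {Φ : ℝ × (Fin 3 → ℝ) → Fin 3 → ℝ} (hΦ : ContDiff ℝ (⊤ : ℕ∞) Φ) (t : ℝ) :
    vInt (fun x => deriv (fun s => Φ (s, x)) t) (vorticity t)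
      = ∫ c in params, fderiv ℝ Φ (t, path t c) (1, 0) 2 := by
  have htime (x : Fin 3 → ℝ) : deriv (fun s => Φ (s, x)) t = fderiv ℝ Φ (t, x) (1, 0) :=
    ((hasFDerivAt_of_contDiff hΦ (t, x)).comp_hasDerivAt t
      ((hasDerivAt_id t).prodMk (hasDerivAt_const t x))).deriv
  have hD : Continuous (fderiv ℝ Φ) := hΦ.continuous_fderiv (by simp)
  simp only [htime]
  refine vInt_vorticity t ?_
  exact (continuous_apply 2).comp
    ((hD.comp (continuous_const.prodMk continuous_id)).clm_apply continuous_const)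

theorem vInt_fderiv_space {Φ : ℝ × (Fin 3 → ℝ) → Fin 3 → ℝ} (hΦ : ContDiff ℝ (⊤ : ℕ∞) Φ) {t : ℝ}
    (ht : t ∈ Icc (0 : ℝ) 1) :
    vInt (fun x => fderiv ℝ (fun y => Φ (t, y)) x (uVel kernel (vorticity t) x)) (vorticity t)
      = ∫ c in params, fderiv ℝ Φ (t, path t c) (0, drift t c) 2 := by
  have hspace (x v : Fin 3 → ℝ) :
      fderiv ℝ (fun y => Φ (t, y)) x v = fderiv ℝ Φ (t, x) (0, v) := by
    have h := ((hasFDerivAt_of_contDiff hΦ (t, x)).comp x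
      ((hasFDerivAt_const t x).prodMk (hasFDerivAt_id x))).fderiv
    exact congrArg (fun L => L v) h
  have hD : Continuous (fderiv ℝ Φ) := hΦ.continuous_fderiv (by simp)
  have hu : Continuous (uVel kernel (vorticity t)) :=
    continuous_uVel.uncurry_left t
  simp only [hspace]
  have hc : Continuous fun x => fderiv ℝ Φ (t, x) (0, uVel kernel (vorticity t) x) :=
    (hD.comp (continuous_const.prodMk continuous_id)).clm_apply (continuous_const.prodMk hu)
  rw [vInt_vorticity t ((continuous_apply 2).comp hc)]
  refine setIntegral_congr_fun isCompact_params.measurableSet fun c hc => ?_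
  simp only [uVel_path ht hc]

theorem hasDerivAt_along_path {Φ : ℝ × (Fin 3 → ℝ) → Fin 3 → ℝ} (hΦ : ContDiff ℝ (⊤ : ℕ∞) Φ)
    (t : ℝ) (c : ℝ × ℝ) :
    HasDerivAt (fun t => Φ (t, path t c) 2)
      (fderiv ℝ Φ (t, path t c) (1, 0) 2 + fderiv ℝ Φ (t, path t c) (0, drift t c) 2) t := by
  have h := (hasFDerivAt_of_contDiff hΦ (t, path t c)).comp_hasDerivAt t
    ((hasDerivAt_id t).prodMk (hasDerivAt_path t c))
  refine (hasDerivAt_pi.1 h 2).congr_deriv ?_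
  rw [← Pi.add_apply, ← map_add, Prod.mk_add_mk, add_zero, zero_add]
  rfl

theorem setIntegral_swap_deriv {F A B : ℝ → ℝ × ℝ → ℝ} (hF : Continuous (Function.uncurry F))
    (hA : Continuous (Function.uncurry A)) (hB : Continuous (Function.uncurry B))
    (h : ∀ t c, HasDerivAt (fun t => F t c) (A t c + B t c) t) :
    (∫ t in Icc (0 : ℝ) 1, ∫ c in params, A t c) + (∫ t in Icc (0 : ℝ) 1, ∫ c in params, B t c)
      = (∫ c in params, F 1 c) - ∫ c in params, F 0 c := by
  have hint {f : ℝ → ℝ × ℝ → ℝ} (hf : Continuous (Function.uncurry f)) :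
      IntegrableOn (fun c => ∫ t in Icc (0 : ℝ) 1, f t c) params :=
    (continuous_parametric_integral_of_continuous (f := fun c t => f t c) (hf.comp
      continuous_swap) isCompact_Icc).continuousOn.integrableOn_compact isCompact_params
  have hsec {f : ℝ → ℝ × ℝ → ℝ} (hf : Continuous (Function.uncurry f)) (c : ℝ × ℝ) :
      Continuous fun t => f t c := hf.comp (by fun_prop : Continuous fun t : ℝ => (t, c))
  have hfix (t : ℝ) : IntegrableOn (F t) params :=
    (hF.comp (by fun_prop : Continuous fun c : ℝ × ℝ => (t, c))).continuousOn.integrableOn_compact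
      isCompact_params
  rw [setIntegral_swap hA, setIntegral_swap hB, ← integral_add (hint hA) (hint hB),
    ← integral_sub (hfix 1) (hfix 0)]
  congr 1 with c
  rw [← integral_add ((hsec hA c).continuousOn.integrableOn_compact isCompact_Icc)
    ((hsec hB c).continuousOn.integrableOn_compact isCompact_Icc)]
  exact setIntegral_Icc_deriv (fun t => h t c) ((hsec hA c).add (hsec hB c))

/-- The material derivative of a test field along the filaments integrates to its increment. -/
theorem transport_eq {Φ : ℝ × (Fin 3 → ℝ) → Fin 3 → ℝ} (hΦ : ContDiff ℝ (⊤ : ℕ∞) Φ) :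
    (∫ t in Icc (0 : ℝ) 1, vInt (fun x => deriv (fun s => Φ (s, x)) t) (vorticity t))
      + (∫ t in Icc (0 : ℝ) 1, vInt (fun x => fderiv ℝ (fun y => Φ (t, y)) x
          (uVel kernel (vorticity t) x)) (vorticity t))
      = vInt (fun x => Φ (1, x)) (vorticity 1) - vInt (fun x => Φ (0, x)) (vorticity 0) := by
  have hD : Continuous (fderiv ℝ Φ) := hΦ.continuous_fderiv (by simp)
  have hpath : Continuous fun q : ℝ × ℝ × ℝ => (q.1, path q.1 q.2) :=
    continuous_fst.prodMk continuous_path_uncurry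
  have hsc (t : ℝ) : Continuous fun x => Φ (t, x) 2 :=
    (continuous_apply 2).comp (hΦ.continuous.comp (continuous_const.prodMk continuous_id))
  simp only [vInt_deriv_time hΦ]
  rw [setIntegral_congr_fun measurableSet_Icc fun t ht => vInt_fderiv_space hΦ ht,
    vInt_vorticity 1 (hsc 1), vInt_vorticity 0 (hsc 0)]
  exact setIntegral_swap_deriv (F := fun t c => Φ (t, path t c) 2)
    ((continuous_apply 2).comp (hΦ.continuous.comp hpath))
    ((continuous_apply 2).comp ((hD.comp hpath).clm_apply continuous_const))
    ((continuous_apply 2).comp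
      ((hD.comp hpath).clm_apply (continuous_const.prodMk continuous_drift)))
    (hasDerivAt_along_path hΦ)

theorem weaklyAdvected :
    WeaklyAdvectedStretch 1 (fun t => uVel kernel (vorticity t)) vorticity divergence := by
  intro φ hφ _
  have h1 := transport_eq hφ
  have h2 := stretching_cancel hφ
  simp only [Function.uncurry_apply_pair] at h1 h2
  simp only [h2, integral_neg]
  linarith

theorem params_subset_closure_interior : params ⊆ closure (interior params) := by
  have h {a b : ℝ} (hab : a < b) : Icc a b ×ˢ Icc (0 : ℝ) 1
      ⊆ closure (interior (Icc a b ×ˢ Icc (0 : ℝ) 1)) := by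
    rw [interior_prod_eq, closure_prod_eq, interior_Icc, interior_Icc, closure_Ioo hab.ne,
      closure_Ioo zero_ne_one]
  rw [params, labels, union_prod]
  exact union_subset
    ((h one_pos).trans (closure_mono (interior_mono subset_union_left)))
    ((h (by norm_num)).trans (closure_mono (interior_mono subset_union_right)))

theorem vSupp_vorticity (t : ℝ) : vSupp (vorticity t) = path t '' params := by
  have happ {V : Set (Fin 3 → ℝ)} (hV : MeasurableSet V) :
      vorticity t 2 V = volume.real (path t ⁻¹' V ∩ params) := by
    have : vorticity t 2 = (filaments t).toSignedMeasure := rfl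
    rw [this, Measure.toSignedMeasure_apply_measurable hV, measureReal_def, filaments,
      Measure.map_apply (continuous_path t).measurable hV,
      Measure.restrict_apply ((continuous_path t).measurable hV), measureReal_def]
  refine subset_antisymm (fun x hx => ?_) ?_
  · by_contra hn
    refine hx (mem_sUnion.2 ⟨(path t '' params)ᶜ,
      ⟨(isCompact_params.image (continuous_path t)).isClosed.isOpen_compl, ?_⟩, hn⟩)
    intro V hV hVs i
    have he : path t ⁻¹' V ∩ params = ∅ := by
      ext c
      simp only [mem_inter_iff, mem_preimage, mem_empty_iff_false, iff_false, not_and]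
      exact fun hc hc' => hVs hc (mem_image_of_mem _ hc')
    fin_cases i
    · simp [vorticity]
    · simp [vorticity]
    · simpa [he] using happ hV
  · rintro _ ⟨c, hc, rfl⟩ ⟨U, ⟨hU, hUV⟩, hcU⟩
    have h0 := hUV U hU.measurableSet subset_rfl 2
    rw [happ hU.measurableSet, measureReal_eq_zero_iff
      (measure_ne_top_of_subset inter_subset_right isCompact_params.measure_lt_top.ne)] at h0
    have hne : (path t ⁻¹' U ∩ interior params).Nonempty :=
      mem_closure_iff.1 (params_subset_closure_interior hc) _ (hU.preimage (continuous_path t)) hcU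
    exact ((hU.preimage (continuous_path t)).inter isOpen_interior).measure_pos volume hne |>.ne'
      (measure_mono_null (inter_subset_inter_right _ interior_subset) h0)

theorem isometry_vertical (a : ℝ) : Isometry fun z => emb (a, z) := by
  refine isometry_emb.comp (Isometry.of_dist_eq fun x y => ?_)
  simp [Prod.dist_eq]

theorem dimH_vSupp_zero : dimH (vSupp (vorticity 0)) = 1 := by
  rw [vSupp_vorticity]
  refine le_antisymm ?_ ?_
  · have hsub : path 0 '' params
        ⊆ (fun z => emb (0, z)) '' univ ∪ (fun z => emb (10, z)) '' univ := by
      rintro _ ⟨c, ⟨hc | hc, -⟩, rfl⟩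
      · refine Or.inl ⟨c.2, mem_univ _, ?_⟩
        simp [path, pos_eq_of_mem_left hc, hc.1]
      · refine Or.inr ⟨c.2, mem_univ _, ?_⟩
        simp [path, pos_eq_of_mem_right zero_le_one hc]
    refine (dimH_mono hsub).trans ?_
    rw [dimH_union, (isometry_vertical 0).dimH_image, (isometry_vertical 10).dimH_image,
      Real.dimH_univ, max_self]
  · have hsub : (fun z => emb (0, z)) '' Icc 0 1 ⊆ path 0 '' params := by
      rintro _ ⟨z, hz, rfl⟩
      refine ⟨(0, z), ⟨Or.inl (by simp), hz⟩, ?_⟩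
      simp [path, pos]
    refine le_trans ?_ (dimH_mono hsub)
    rw [(isometry_vertical 0).dimH_image, Real.dimH_of_nonempty_interior (by simp)]
    simp

theorem dimH_vSupp_one : dimH (vSupp (vorticity 1)) = 2 := by
  rw [vSupp_vorticity]
  refine le_antisymm ?_ ?_
  · have hsub : path 1 '' params ⊆ emb '' univ := by
      rintro _ ⟨c, -, rfl⟩
      exact ⟨_, mem_univ _, rfl⟩
    refine (dimH_mono hsub).trans ?_
    rw [isometry_emb.dimH_image, Real.dimH_univ_eq_finrank]
    simp
  · have hsub : emb '' (Icc 0 1 ×ˢ Icc 0 1) ⊆ path 1 '' params := by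
      rintro _ ⟨c, hc, rfl⟩
      have hs : 1 - √c.1 ∈ Icc (0 : ℝ) 1 :=
        ⟨sub_nonneg.2 (Real.sqrt_le_one.2 hc.1.2), by linarith [Real.sqrt_nonneg c.1]⟩
      refine ⟨(1 - √c.1, c.2), ⟨Or.inl hs, hc.2⟩, ?_⟩
      simp [path, pos_eq_of_mem_left hs, Real.sqrt_nonneg, Real.sq_sqrt hc.1.1]
    refine le_trans ?_ (dimH_mono hsub)
    rw [isometry_emb.dimH_image, Real.dimH_of_nonempty_interior (by
      rw [interior_prod_eq]; simp)]
    simp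

end FilamentBranching

/-- There are a continuous matrix kernel `K : ℝ³ → ℝ^{3×3}`, a time
`T > 0` and a family of finite `ℝ³`-valued Borel vector measures `ω t` whose
distributional divergences are finite signed Borel measures `ν t`, such that the
induced velocity `u t x = ∫ K (x - y) dω(t)(y)` is continuous and weakly divergence
free, `ω` is weakly advected by `u` in the vector-valued sense with stretching, and
the support of `ω 0` has Hausdorff dimension `1` while the support of `ω T` has
Hausdorff dimension `2`. -/
theorem statement3 :
    ∃ (K : (Fin 3 → ℝ) → Matrix (Fin 3) (Fin 3) ℝ) (T : ℝ)
      (ω : ℝ → Fin 3 → SignedMeasure (Fin 3 → ℝ))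
      (ν : ℝ → SignedMeasure (Fin 3 → ℝ)),
      Continuous K ∧ 0 < T ∧
      (∀ t ∈ Icc (0 : ℝ) T, IsDistribDiv (ω t) (ν t)) ∧
      ContinuousOn (Function.uncurry (fun t x => uVel K (ω t) x))
        (Icc (0 : ℝ) T ×ˢ (univ : Set (Fin 3 → ℝ))) ∧
      (∀ t ∈ Icc (0 : ℝ) T, WeakDivFree3At (uVel K (ω t))) ∧
      WeaklyAdvectedStretch T (fun t => uVel K (ω t)) ω ν ∧
      dimH (vSupp (ω 0)) = 1 ∧
      dimH (vSupp (ω T)) = 2 := by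
  open FilamentBranching in
  exact ⟨kernel, 1, vorticity, divergence, continuous_kernel, one_pos,
    fun t _ => isDistribDiv t, continuous_uVel.continuousOn, fun t _ => weakDivFree t,
    weaklyAdvected, dimH_vSupp_zero, dimH_vSupp_one⟩

end
end
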